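/- arXiv:math-ph/0507049 — 3 statements merged into one kernel-verified Lean document; each statement's English description precedes it below -/
import Mathlib

section
/- Generalized Dyson Lemma, multi-centered case: Let v be a potential with scattering length a_v supported in {|x| < R₀} as in the context, and let R > R₀, χ, h, f_R, w_R, U be as in the context. Let y₁,…,y_M ∈ ℝ³ satisfy |y_i − y_j| ≥ 2R for all i ≠ j. Then for every ε > 0 and every Schwartz function ψ: ℝ³ → ℂ, ∫_{ℝ³} |(χ(p)∇ψ)(x)|² dx + (1/2) Σ_{i=1}^M ∫_{ℝ³} v(x−y_i)|ψ(x)|² dx ≥ Σ_{i=1}^M ∫_{ℝ³} ( (1−ε) a_v U(x−y_i) − (a_v/ε) w_R(x−y_i) ) |ψ(x)|² dx. -/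
/-!
STATEMENT 8: Generalized Dyson Lemma, multi-centered case.
`v` is as in the scattering context (nonnegative, bounded, measurable, radial,
supported in `{|x| < R₀}`, scattering length `a`).  `R > R₀`, `θ_R` is the
characteristic function of `{|x| < R}`, `χ : ℝ³ → [0,1]` is radial with
`h := \widehat{1-χ}` bounded and integrable, `f_R(x) = sup_{|y|≤R} |h(x-y)-h(x)|`
is integrable, `w_R(x) = (2/π²) f_R(x) ∫ f_R`, and `U ≥ 0` is radial, supported
in `{R₀ ≤ |x| ≤ R}`, with `∫ U = 4π`.  Let `y₁,…,y_M ∈ ℝ³` with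
`|y_i - y_j| ≥ 2R` for `i ≠ j`.  Then for every `ε > 0` and every Schwartz `ψ`,
`∫ |(χ(p)∇ψ)(x)|² dx + (1/2) ∑_i ∫ v(x-y_i) |ψ(x)|² dx
   ≥ ∑_i ∫ ((1-ε) a U(x-y_i) - (a/ε) w_R(x-y_i)) |ψ(x)|² dx`,
where `χ(p)∇ψ` is the function whose Fourier transform at `p` is
`χ(p)·(ip)·ψ̂(p)` (realized below via the inverse Fourier transform).
We use the symmetric convention `ψ̂(p) = (2π)^{-3/2} ∫ e^{-i p·x} ψ(x) dx`.
-/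

open MeasureTheory Real
open scoped RealInnerProductSpace

noncomputable section

abbrev R3 := EuclideanSpace ℝ (Fin 3)

/-- Fourier transform, convention `(2π)^{-3/2} ∫ e^{-i⟨x,p⟩} g(x) dx`. -/
def ft (g : R3 → ℂ) (p : R3) : ℂ :=
  (((2 * π) ^ (-(3:ℝ)/2) : ℝ) : ℂ) * ∫ x : R3, Complex.exp (-(Complex.I * (⟪x, p⟫ : ℝ))) * g x

/-- Inverse Fourier transform, convention `(2π)^{-3/2} ∫ e^{+i⟨p,x⟩} g(p) dp`. -/
def ift (g : R3 → ℂ) (x : R3) : ℂ :=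
  (((2 * π) ^ (-(3:ℝ)/2) : ℝ) : ℂ) * ∫ p : R3, Complex.exp (Complex.I * (⟪p, x⟫ : ℝ)) * g p

/-- The surface measure on the unit sphere of `ℝ³`. -/
abbrev sphereMeasure : Measure (Metric.sphere (0 : R3) 1) := (volume : Measure R3).toSphere

section Polar

variable {F : Type*} [NormedAddCommGroup F] [NormedSpace ℝ F]

lemma map_val_volumeIoiPow (n : ℕ) :
    (Measure.volumeIoiPow n).map Subtype.val =
      (volume.restrict (Set.Ioi (0 : ℝ))).withDensity fun r => ENNReal.ofReal (r ^ n) := by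
  have he : MeasurableEmbedding (Subtype.val : Set.Ioi (0 : ℝ) → ℝ) :=
    MeasurableEmbedding.subtype_coe measurableSet_Ioi
  ext s hs
  rw [he.map_apply, Measure.volumeIoiPow, withDensity_apply _ (he.measurable hs),
    withDensity_apply _ hs,
    ← map_comap_subtype_coe measurableSet_Ioi (volume : Measure ℝ), he.restrict_map,
    he.lintegral_map]

lemma measurePreserving_polar :
    MeasurePreserving (fun p : Metric.sphere (0 : R3) 1 × ℝ => p.2 • (p.1 : R3))
      (sphereMeasure.prod ((volume.restrict (Set.Ioi (0 : ℝ))).withDensity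
        fun r => ENNReal.ofReal (r ^ 2))) volume := by
  have h1 := ((volume : Measure R3).measurePreserving_homeomorphUnitSphereProd).symm
    (homeomorphUnitSphereProd R3).toMeasurableEquiv
  have h2 : MeasurePreserving (Subtype.val : ({0}ᶜ : Set R3) → R3)
      ((volume : Measure R3).comap (↑)) volume := by
    refine ⟨measurable_subtype_coe, ?_⟩
    rw [map_comap_subtype_coe (measurableSet_singleton _).compl,
      restrict_compl_singleton]
  have h3 := h2.comp h1
  have hdim : Module.finrank ℝ R3 - 1 = 2 := by simp
  rw [hdim] at h3
  have he : MeasurableEmbedding (Prod.map id Subtype.val :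
      Metric.sphere (0 : R3) 1 × Set.Ioi (0 : ℝ) → Metric.sphere (0 : R3) 1 × ℝ) :=
    MeasurableEmbedding.id.prodMap (MeasurableEmbedding.subtype_coe measurableSet_Ioi)
  have hs : SigmaFinite ((Measure.volumeIoiPow 2).map Subtype.val) := by
    rw [map_val_volumeIoiPow]; infer_instance
  have h4 : (sphereMeasure.prod (Measure.volumeIoiPow 2)).map (Prod.map id Subtype.val) =
      sphereMeasure.prod ((volume.restrict (Set.Ioi (0 : ℝ))).withDensity
        fun r => ENNReal.ofReal (r ^ 2)) := by
    rw [← map_val_volumeIoiPow,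
      ← Measure.map_prod_map _ _ measurable_id measurable_subtype_coe, Measure.map_id]
  refine ⟨by fun_prop, ?_⟩
  rw [← h4, Measure.map_map (by fun_prop) he.measurable]
  exact h3.map_eq

lemma sphere_prod_withDensity :
    (sphereMeasure.prod ((volume.restrict (Set.Ioi (0 : ℝ))).withDensity
        fun r => ENNReal.ofReal (r ^ 2))) =
    (sphereMeasure.prod (volume.restrict (Set.Ioi (0 : ℝ)))).withDensity
      fun p => ENNReal.ofReal (p.2 ^ 2) := by
  rw [prod_withDensity_right]
  fun_prop

lemma integrable_polar {G : R3 → F} (hG : Integrable G) :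
    Integrable (fun p : Metric.sphere (0 : R3) 1 × ℝ => p.2 ^ 2 • G (p.2 • (p.1 : R3)))
      (sphereMeasure.prod (volume.restrict (Set.Ioi (0 : ℝ)))) := by
  have h := measurePreserving_polar.integrable_comp_of_integrable hG
  rw [sphere_prod_withDensity, integrable_withDensity_iff_integrable_smul' (by fun_prop)
    (by simp)] at h
  refine h.congr (ae_of_all _ fun p => ?_)
  simp [ENNReal.toReal_ofReal (sq_nonneg p.2)]

lemma integral_polar {G : R3 → F} (hG : Integrable G) :
    ∫ ω, (∫ s in Set.Ioi (0 : ℝ), s ^ 2 • G (s • (ω : R3))) ∂sphereMeasure = ∫ x, G x := by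
  rw [← integral_prod _ (integrable_polar hG), ← measurePreserving_polar.map_eq,
    integral_map measurePreserving_polar.measurable.aemeasurable
      (by rw [measurePreserving_polar.map_eq]; exact hG.aestronglyMeasurable),
    sphere_prod_withDensity]
  have := integral_withDensity_eq_integral_smul
    (μ := sphereMeasure.prod (volume.restrict (Set.Ioi (0 : ℝ))))
    (f := fun p => Real.toNNReal (p.2 ^ 2)) (by fun_prop)
    (fun p : Metric.sphere (0 : R3) 1 × ℝ => G (p.2 • (p.1 : R3)))
  refine Eq.trans ?_ this.symm
  congr 1 with p
  rw [NNReal.smul_def, Real.coe_toNNReal _ (sq_nonneg _)]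

lemma sphereMeasure_real_univ : sphereMeasure.real Set.univ = 4 * π := by
  rw [Measure.toSphere_real_apply_univ, measureReal_def, EuclideanSpace.volume_ball_fin_three]
  have : (0 : ℝ) ≤ π * 4 / 3 := by positivity
  simp [ENNReal.toReal_ofReal this]
  ring

end Polar

section Radial

variable {E : Type*} [NormedAddCommGroup E] [NormedSpace ℝ E] [CompleteSpace E]

/-- Integration by parts against the primitive of a merely integrable function. -/
lemma integral_primitive_smul_deriv {ρ : ℝ → ℝ} {Ψ Ψ' : ℝ → E} {r : ℝ} (hr : 0 ≤ r)
    (hρ : IntegrableOn ρ (Set.Ioc 0 r)) (hΨ : ∀ s, HasDerivAt Ψ (Ψ' s) s)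
    (hc : Continuous Ψ') :
    ∫ s in 0..r, (∫ t in 0..s, ρ t) • Ψ' s = ∫ t in 0..r, ρ t • (Ψ r - Ψ t) := by
  rw [intervalIntegral.integral_of_le hr, intervalIntegral.integral_of_le hr]
  have hΨ'i : IntegrableOn Ψ' (Set.Ioc 0 r) := hc.integrableOn_Ioc
  have hprod : Integrable (Function.uncurry fun s t : ℝ =>
      (Set.Iic s).indicator ρ t • Ψ' s)
      ((volume.restrict (Set.Ioc 0 r)).prod (volume.restrict (Set.Ioc 0 r))) := by
    have h1 : Integrable (fun p : ℝ × ℝ => ρ p.2 • Ψ' p.1)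
        ((volume.restrict (Set.Ioc 0 r)).prod (volume.restrict (Set.Ioc 0 r))) :=
      (hρ.smul_prod hΨ'i).swap
    have h2 := h1.indicator (s := {p : ℝ × ℝ | p.2 ≤ p.1})
      (measurableSet_le measurable_snd measurable_fst)
    refine h2.congr (ae_of_all _ fun p => ?_)
    by_cases hp : p.2 ≤ p.1 <;> simp [Function.uncurry, Set.indicator, hp]
  have hL : ∫ s in Set.Ioc 0 r, (∫ t in 0..s, ρ t) • Ψ' s =
      ∫ s in Set.Ioc 0 r, ∫ t in Set.Ioc 0 r, (Set.Iic s).indicator ρ t • Ψ' s := by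
    refine setIntegral_congr_fun measurableSet_Ioc fun s hs => ?_
    rw [integral_smul_const, intervalIntegral.integral_of_le hs.1.le,
      setIntegral_indicator measurableSet_Iic]
    congr 3
    ext t
    simp only [Set.mem_Ioc, Set.mem_inter_iff, Set.mem_Iic]
    constructor
    · rintro ⟨h1, h2⟩; exact ⟨⟨h1, h2.trans hs.2⟩, h2⟩
    · rintro ⟨⟨h1, _⟩, h2⟩; exact ⟨h1, h2⟩
  rw [hL, integral_integral_swap hprod]
  refine setIntegral_congr_fun measurableSet_Ioc fun t ht => ?_
  have : ∀ s, (Set.Iic s).indicator ρ t • Ψ' s = (Set.Ici t).indicator (fun s => ρ t • Ψ' s) s := by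
    intro s
    by_cases h : t ≤ s <;> simp [Set.indicator, h]
  simp only [this]
  rw [setIntegral_indicator measurableSet_Ici, integral_smul,
    ← intervalIntegral.integral_eq_sub_of_hasDerivAt (fun s _ => hΨ s)
      (hc.intervalIntegrable _ _), intervalIntegral.integral_of_le ht.2]
  congr 1
  have : Set.Ioc 0 r ∩ Set.Ici t = Set.Icc t r := by
    ext s
    simp only [Set.mem_Ioc, Set.mem_inter_iff, Set.mem_Ici, Set.mem_Icc]
    constructor
    · rintro ⟨⟨_, h1⟩, h2⟩; exact ⟨h2, h1⟩
    · rintro ⟨h1, h2⟩; exact ⟨⟨ht.1.trans_le h1, h2⟩, h1⟩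
  rw [this, integral_Icc_eq_integral_Ioc]

end Radial

section Profile

/-- The spherical average of a function on `ℝ³`, as a function of a signed radius. -/
def sphericalMean (φ : R3 → ℝ) (s : ℝ) : ℝ :=
  (4 * π)⁻¹ * ∫ ω, φ (s • (ω : R3)) ∂sphereMeasure

/-- The spherical average of the radial derivative. -/
def sphericalMeanDeriv (φ : R3 → ℝ) (s : ℝ) : ℝ :=
  (4 * π)⁻¹ * ∫ ω, fderiv ℝ φ (s • (ω : R3)) (ω : R3) ∂sphereMeasure

lemma continuous_sphere_integral {G : ℝ → Metric.sphere (0 : R3) 1 → ℝ}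
    (hG : Continuous (Function.uncurry G)) :
    Continuous fun s => ∫ ω, G s ω ∂sphereMeasure := by
  have := continuous_parametric_integral_of_continuous (μ := sphereMeasure) hG
    (s := Set.univ) isCompact_univ
  simpa using this

lemma integrable_sphere {G : Metric.sphere (0 : R3) 1 → ℝ} (hG : Continuous G) :
    Integrable G sphereMeasure := by
  have := hG.continuousOn.integrableOn_compact (μ := sphereMeasure) isCompact_univ
  simpa using this

variable {φ : R3 → ℝ}

lemma continuous_fderiv_ray (hφ : ContDiff ℝ 1 φ) :
    Continuous fun p : ℝ × Metric.sphere (0 : R3) 1 =>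
      fderiv ℝ φ (p.1 • (p.2 : R3)) (p.2 : R3) := by
  have h := hφ.continuous_fderiv one_ne_zero
  exact (h.comp (by fun_prop : Continuous fun p : ℝ × Metric.sphere (0 : R3) 1 =>
    p.1 • (p.2 : R3))).clm_apply (by fun_prop)

lemma continuous_sphericalMeanDeriv (hφ : ContDiff ℝ 1 φ) :
    Continuous (sphericalMeanDeriv φ) :=
  continuous_const.mul (continuous_sphere_integral
    (G := fun s ω => fderiv ℝ φ (s • (ω : R3)) (ω : R3)) (continuous_fderiv_ray hφ))

lemma hasDerivAt_sphericalMean (hφ : ContDiff ℝ 1 φ) (s : ℝ) :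
    HasDerivAt (sphericalMean φ) (sphericalMeanDeriv φ s) s := by
  refine HasDerivAt.const_mul _ ?_
  have hcont := continuous_fderiv_ray hφ
  obtain ⟨C, hC⟩ := ((isCompact_closedBall s 1).prod
    (isCompact_univ : IsCompact (Set.univ : Set (Metric.sphere (0 : R3) 1)))).exists_bound_of_continuousOn
      hcont.continuousOn
  refine (hasDerivAt_integral_of_dominated_loc_of_deriv_le (μ := sphereMeasure)
    (F := fun s ω => φ (s • (ω : R3)))
    (F' := fun s ω => fderiv ℝ φ (s • (ω : R3)) (ω : R3))
    (bound := fun _ => C) (Metric.closedBall_mem_nhds s one_pos) ?_ ?_ ?_ ?_ ?_ ?_).2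
  · exact Filter.Eventually.of_forall fun t => (integrable_sphere
      (by have := hφ.continuous; fun_prop)).aestronglyMeasurable
  · exact integrable_sphere (by have := hφ.continuous; fun_prop)
  · exact (integrable_sphere (hcont.comp (by fun_prop : Continuous
      fun ω : Metric.sphere (0 : R3) 1 => (s, ω)))).aestronglyMeasurable
  · exact ae_of_all _ fun ω t ht => hC (t, ω) ⟨ht, Set.mem_univ _⟩
  · exact integrable_const _
  · refine ae_of_all _ fun ω t _ => ?_
    have h1 : HasDerivAt (fun t : ℝ => t • (ω : R3)) (ω : R3) t := by
      simpa using (hasDerivAt_id t).smul_const (ω : R3)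
    exact ((hφ.differentiable one_ne_zero _).hasFDerivAt.comp_hasDerivAt t h1)

lemma sphericalMean_nonneg (h : ∀ x, 0 ≤ φ x) (s : ℝ) : 0 ≤ sphericalMean φ s :=
  mul_nonneg (by positivity) (integral_nonneg fun _ => h _)

lemma sphericalMean_le_one (hφ : Continuous φ) (h : ∀ x, φ x ≤ 1) (s : ℝ) :
    sphericalMean φ s ≤ 1 := by
  have h1 : ∫ ω, φ (s • (ω : R3)) ∂sphereMeasure ≤ ∫ _, (1 : ℝ) ∂sphereMeasure :=
    integral_mono (integrable_sphere (by fun_prop)) (integrable_const _) fun _ => h _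
  rw [integral_const, sphereMeasure_real_univ, smul_eq_mul, mul_one] at h1
  unfold sphericalMean
  rw [inv_mul_le_iff₀ (by positivity)]
  simpa using h1

lemma sq_mul_sphericalMeanDeriv_eq (hφ : ContDiff ℝ 1 φ) {R0 a : ℝ} (hR0 : 0 < R0)
    (hφ_eq : ∀ x : R3, R0 ≤ ‖x‖ → φ x = 1 - a / ‖x‖) {s : ℝ} (hs : R0 ≤ s) :
    s ^ 2 * sphericalMeanDeriv φ s = a := by
  have hs0 : 0 < s := hR0.trans_le hs
  have heq : ∀ t ∈ Set.Ici R0, sphericalMean φ t = 1 - a * t⁻¹ := by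
    intro t ht
    have ht0 : 0 < t := hR0.trans_le ht
    have : ∀ ω : Metric.sphere (0 : R3) 1, φ (t • (ω : R3)) = 1 - a * t⁻¹ := by
      intro ω
      have hn : ‖t • (ω : R3)‖ = t := by simp [norm_smul, abs_of_pos ht0]
      rw [hφ_eq _ (by rw [hn]; exact ht), hn, div_eq_mul_inv]
    simp only [sphericalMean, this]
    rw [integral_const, sphereMeasure_real_univ, smul_eq_mul, inv_mul_cancel_left₀ (by positivity)]
  have h1 : HasDerivWithinAt (fun t => 1 - a * t⁻¹) (sphericalMeanDeriv φ s) (Set.Ici R0) s :=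
    (hasDerivAt_sphericalMean hφ s).hasDerivWithinAt.congr (fun t ht => (heq t ht).symm)
      (heq s hs).symm
  have h2 : HasDerivWithinAt (fun t => 1 - a * t⁻¹) (-(a * -(s ^ 2)⁻¹)) (Set.Ici R0) s :=
    (((hasDerivAt_inv hs0.ne').const_mul a).const_sub 1).hasDerivWithinAt
  rw [(uniqueDiffOn_Ici R0 s hs).eq_deriv _ h1 h2]
  field_simp

end Profile

section RadialEquation

lemma inner_gradient_comp_normSq {φ : R3 → ℝ} {m m' : ℝ → ℝ} (hm : ∀ t, HasDerivAt m (m' t) t)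
    (x : R3) :
    ⟪gradient φ x, gradient (fun x : R3 => m (‖x‖ ^ 2)) x⟫ =
      m' (‖x‖ ^ 2) * (2 * fderiv ℝ φ x x) := by
  have h1 : HasFDerivAt (fun x : R3 => m (‖x‖ ^ 2)) (m' (‖x‖ ^ 2) • (2 • (innerSL ℝ x))) x :=
    (hm _).comp_hasFDerivAt x (hasStrictFDerivAt_norm_sq x).hasFDerivAt
  rw [real_inner_comm, gradient, gradient, InnerProductSpace.toDual_symm_apply, h1.fderiv]
  have h2 : (innerSL ℝ x) ((InnerProductSpace.toDual ℝ R3).symm (fderiv ℝ φ x)) =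
      fderiv ℝ φ x x := by
    rw [innerSL_apply_apply, real_inner_comm, InnerProductSpace.toDual_symm_apply]
  change m' (‖x‖ ^ 2) • (2 • (innerSL ℝ x) _) = _
  rw [h2, two_nsmul, ← two_mul, smul_eq_mul]

variable {v φ : R3 → ℝ} {V : ℝ → ℝ}

lemma locallyIntegrable_radial_density (hV_meas : Measurable V) {C : ℝ}
    (hV_bdd : ∀ s, |V s| ≤ C) {f : ℝ → ℝ} (hf : Continuous f) {A B : ℝ} :
    IntegrableOn (fun t => 1 / 2 * (t ^ 2 * V t * f t)) (Set.Ioc A B) := by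
  have hc : IntegrableOn (fun t => t ^ 2 * f t) (Set.Ioc A B) :=
    (by fun_prop : Continuous fun t => t ^ 2 * f t).integrableOn_Ioc
  have := hc.bdd_mul (f := V) (c := C) hV_meas.aestronglyMeasurable (ae_of_all _ hV_bdd)
  refine (this.const_mul (1 / 2)).congr (ae_of_all _ fun t => ?_)
  simp only; ring

/-- The integrated form of the radial scattering equation, tested against a smooth function. -/
lemma integral_radial_test (hφ : ContDiff ℝ 1 φ) (hv : ∀ x, v x = V ‖x‖)
    (hV_meas : Measurable V) {C : ℝ} (hV_bdd : ∀ s, |V s| ≤ C)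
    (hφ_scatt : ∀ g : R3 → ℝ, ContDiff ℝ (⊤ : ℕ∞) g → HasCompactSupport g →
      (∫ x : R3, ⟪gradient φ x, gradient g x⟫) + (1/2) * ∫ x : R3, v x * φ x * g x = 0)
    {m m' : ℝ → ℝ} (hm : ∀ t, HasDerivAt m (m' t) t) (hmc : ContDiff ℝ (⊤ : ℕ∞) m)
    {r : ℝ} (hr : 0 < r) (hm0 : ∀ t, r ^ 2 ≤ t → m t = 0) :
    (∫ s in 0..r, s ^ 2 * sphericalMeanDeriv φ s * (m' (s ^ 2) * (2 * s))) +
      ∫ s in 0..r, 1 / 2 * (s ^ 2 * V s * sphericalMean φ s) * m (s ^ 2) = 0 := by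
  have hm'0 : ∀ t, r ^ 2 < t → m' t = 0 := fun t ht => by
    refine (hm t).unique ((hasDerivAt_const t (0 : ℝ)).congr_of_eventuallyEq ?_)
    filter_upwards [lt_mem_nhds ht] with u hu using hm0 u hu.le
  have hm'c : Continuous m' := by
    have : m' = deriv m := funext fun t => (hm t).deriv.symm
    rw [this]; exact hmc.continuous_deriv (by norm_cast)
  have hn : ∀ x : R3, x ∉ Metric.closedBall (0 : R3) r → r ^ 2 < ‖x‖ ^ 2 := fun x hx => by
    have : r < ‖x‖ := by simpa using hx
    gcongr
  have hg : ContDiff ℝ (⊤ : ℕ∞) fun x : R3 => m (‖x‖ ^ 2) := hmc.comp (contDiff_norm_sq ℝ)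
  have hgs : HasCompactSupport fun x : R3 => m (‖x‖ ^ 2) :=
    HasCompactSupport.intro (isCompact_closedBall (0 : R3) r) fun x hx => hm0 _ (hn x hx).le
  have hmain := hφ_scatt _ hg hgs
  have h1c : Continuous fun x : R3 => m' (‖x‖ ^ 2) * (2 * fderiv ℝ φ x x) := by
    have := (hφ.continuous_fderiv one_ne_zero).clm_apply continuous_id
    exact (hm'c.comp (by fun_prop)).mul (continuous_const.mul this)
  have h1s : HasCompactSupport fun x : R3 => m' (‖x‖ ^ 2) * (2 * fderiv ℝ φ x x) :=
    HasCompactSupport.intro (isCompact_closedBall (0 : R3) r) fun x hx => by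
      rw [hm'0 _ (hn x hx), zero_mul]
  have h1i := h1c.integrable_of_hasCompactSupport h1s (μ := volume)
  have h2i : Integrable fun x : R3 => v x * φ x * m (‖x‖ ^ 2) := by
    have h0 : Integrable fun x : R3 => φ x * m (‖x‖ ^ 2) :=
      (hφ.continuous.mul hg.continuous).integrable_of_hasCompactSupport hgs.mul_left
    have := h0.bdd_mul (f := v) (c := C) (by
      rw [show v = fun x => V ‖x‖ from funext hv]
      exact (hV_meas.comp measurable_norm).aestronglyMeasurable)
      (ae_of_all _ fun x => by rw [hv]; exact hV_bdd _)
    simpa only [mul_assoc] using this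
  simp only [inner_gradient_comp_normSq hm] at hmain
  have hswap : ∀ {G : R3 → ℝ}, Integrable G → ∫ x, G x =
      ∫ s in Set.Ioi (0 : ℝ), s ^ 2 * ∫ ω, G (s • (ω : R3)) ∂sphereMeasure := by
    intro G hG
    rw [← integral_polar hG, integral_integral_swap (integrable_polar hG)]
    simp only [smul_eq_mul, integral_const_mul]
  have hcut : ∀ {k : ℝ → ℝ}, (∀ s, r < s → k s = 0) →
      ∫ s in Set.Ioi (0 : ℝ), k s = ∫ s in 0..r, k s := by
    intro k hk
    rw [intervalIntegral.integral_of_le hr.le]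
    refine (setIntegral_eq_of_subset_of_forall_sdiff_eq_zero measurableSet_Ioi
      Set.Ioc_subset_Ioi_self fun s hs => hk s ?_)
    by_contra h
    exact hs.2 ⟨hs.1, not_lt.1 h⟩
  have hpi : (4 * π) ≠ 0 := by positivity
  have hnorm : ∀ s : ℝ, 0 < s → ∀ ω : Metric.sphere (0 : R3) 1, ‖s • (ω : R3)‖ = s := by
    intro s hs ω; simp [norm_smul, abs_of_pos hs]
  rw [hswap h1i, hswap h2i] at hmain
  have e1 : ∫ s in Set.Ioi (0 : ℝ), s ^ 2 * ∫ ω, m' (‖s • (ω : R3)‖ ^ 2) *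
      (2 * fderiv ℝ φ (s • (ω : R3)) (s • (ω : R3))) ∂sphereMeasure =
      4 * π * ∫ s in 0..r, s ^ 2 * sphericalMeanDeriv φ s * (m' (s ^ 2) * (2 * s)) := by
    rw [← hcut (k := fun s => s ^ 2 * sphericalMeanDeriv φ s * (m' (s ^ 2) * (2 * s))) (by
      intro s hs
      rw [hm'0 _ (by gcongr)]; simp), ← integral_const_mul]
    refine setIntegral_congr_fun measurableSet_Ioi fun s hs => ?_
    simp only [hnorm s hs, map_smul, smul_eq_mul, integral_const_mul, sphericalMeanDeriv]
    field_simp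
  have e2 : ∫ s in Set.Ioi (0 : ℝ), s ^ 2 * ∫ ω, v (s • (ω : R3)) * φ (s • (ω : R3)) *
      m (‖s • (ω : R3)‖ ^ 2) ∂sphereMeasure =
      4 * π * (2 * ∫ s in 0..r, 1 / 2 * (s ^ 2 * V s * sphericalMean φ s) * m (s ^ 2)) := by
    rw [← hcut (k := fun s => 1 / 2 * (s ^ 2 * V s * sphericalMean φ s) * m (s ^ 2)) (by
      intro s hs
      rw [hm0 _ (by gcongr)]; simp), ← integral_const_mul, ← integral_const_mul]
    refine setIntegral_congr_fun measurableSet_Ioi fun s hs => ?_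
    simp only [hv, hnorm s hs, integral_const_mul, integral_mul_const, sphericalMean]
    field_simp
  rw [e1, e2] at hmain
  have : 4 * π * ((∫ s in 0..r, s ^ 2 * sphericalMeanDeriv φ s * (m' (s ^ 2) * (2 * s))) +
      ∫ s in 0..r, 1 / 2 * (s ^ 2 * V s * sphericalMean φ s) * m (s ^ 2)) = 0 := by
    linarith
  exact (mul_eq_zero.1 this).resolve_left hpi

/-- The first integral of the radial scattering equation. -/
lemma sq_mul_sphericalMeanDeriv_eq_integral (hφ : ContDiff ℝ 1 φ) (hv : ∀ x, v x = V ‖x‖)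
    (hV_meas : Measurable V) {C : ℝ} (hV_bdd : ∀ s, |V s| ≤ C)
    (hφ_scatt : ∀ g : R3 → ℝ, ContDiff ℝ (⊤ : ℕ∞) g → HasCompactSupport g →
      (∫ x : R3, ⟪gradient φ x, gradient g x⟫) + (1/2) * ∫ x : R3, v x * φ x * g x = 0)
    {s : ℝ} (hs : 0 < s) :
    s ^ 2 * sphericalMeanDeriv φ s =
      ∫ t in 0..s, 1 / 2 * (t ^ 2 * V t * sphericalMean φ t) := by
  set ρ : ℝ → ℝ := fun t => 1 / 2 * (t ^ 2 * V t * sphericalMean φ t) with hρ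
  have hfc : Continuous (sphericalMean φ) :=
    continuous_iff_continuousAt.2 fun s => (hasDerivAt_sphericalMean hφ s).continuousAt
  have hρi : ∀ A B, IntegrableOn ρ (Set.Ioc A B) := fun A B =>
    locallyIntegrable_radial_density hV_meas hV_bdd hfc
  have hqc : Continuous fun s => ∫ t in 0..s, ρ t :=
    intervalIntegral.continuous_primitive (fun A B => ⟨hρi A B, hρi B A⟩) 0
  set K : ℝ → ℝ := fun s => s ^ 2 * sphericalMeanDeriv φ s - ∫ t in 0..s, ρ t with hK
  have hKc : Continuous K :=
    ((continuous_id.pow 2).mul (continuous_sphericalMeanDeriv hφ)).sub hqc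
  have hcont : Continuous fun y : ℝ => K (√y) := hKc.comp continuous_sqrt
  have hae : ∀ᵐ y : ℝ, y ∈ Set.Ioi (0 : ℝ) → K (√y) = 0 := by
    refine isOpen_Ioi.ae_eq_zero_of_integral_contDiff_smul_eq_zero
      (hcont.continuousOn.locallyIntegrableOn measurableSet_Ioi) fun β hβ hβs hβt => ?_
    obtain ⟨b, hb⟩ := hβs.isBounded.subset_closedBall (0 : ℝ)
    set r := max 1 (b + 1) with hr
    have hr1 : 1 ≤ r := le_max_left _ _
    have hr0 : 0 < r := by linarith
    have hβ0 : ∀ t, r ≤ t → β t = 0 := by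
      intro t ht
      by_contra h
      have h1 := hb (subset_tsupport β h)
      rw [mem_closedBall_zero_iff, Real.norm_eq_abs] at h1
      have h2 := le_abs_self t
      have h3 : b + 1 ≤ r := le_max_right _ _
      linarith
    set m : ℝ → ℝ := fun t => -∫ x in (r ^ 2)..t, β x with hmdef
    have hm : ∀ t, HasDerivAt m (-β t) t := fun t =>
      (hβ.continuous.integral_hasStrictDerivAt _ _).hasDerivAt.neg
    have hmc : ContDiff ℝ (⊤ : ℕ∞) m := by
      rw [contDiff_infty_iff_deriv]
      refine ⟨fun t => (hm t).differentiableAt, ?_⟩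
      rw [show deriv m = fun t => -β t from funext fun t => (hm t).deriv]
      exact hβ.neg
    have hr2 : r ≤ r ^ 2 := by nlinarith
    have hm0 : ∀ t, r ^ 2 ≤ t → m t = 0 := by
      intro t ht
      rw [hmdef]
      simp only [neg_eq_zero]
      rw [intervalIntegral.integral_congr (g := fun _ => (0 : ℝ)), intervalIntegral.integral_zero]
      intro x hx
      rw [Set.uIcc_of_le ht] at hx
      exact hβ0 x (hr2.trans hx.1)
    have h1 := integral_radial_test hφ hv hV_meas hV_bdd hφ_scatt hm hmc hr0 hm0
    have h2 := integral_primitive_smul_deriv (E := ℝ) hr0.le (hρi 0 r)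
      (Ψ := fun s => m (s ^ 2)) (Ψ' := fun s => -β (s ^ 2) * (2 * s)) (fun s => by
        have := (hm (s ^ 2)).comp s (hasDerivAt_pow 2 s)
        simpa [Function.comp_def] using this) (by have := hβ.continuous; fun_prop)
    simp only [hm0 _ le_rfl, zero_sub, smul_eq_mul, mul_neg] at h2
    rw [intervalIntegral.integral_neg] at h2
    have h3 : ∫ s in 0..r, K s * (-β (s ^ 2) * (2 * s)) = 0 := by
      simp only [hK, sub_mul]
      rw [intervalIntegral.integral_sub, h2]
      · linarith
      · have h4 := continuous_sphericalMeanDeriv hφ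
        have h5 := hβ.continuous
        exact (by fun_prop : Continuous _).intervalIntegrable _ _
      · have h5 := hβ.continuous
        exact (hqc.mul (by fun_prop)).intervalIntegrable _ _
    have h4 : ∫ y, β y • K (√y) = ∫ y in Set.Ioi (0 : ℝ), β y • K (√y) := by
      rw [setIntegral_eq_integral_of_forall_compl_eq_zero]
      intro y hy
      rw [image_eq_zero_of_notMem_tsupport fun h => hy (hβt h), zero_smul]
    rw [h4, ← integral_comp_rpow_Ioi_of_pos (p := 2) two_pos]
    have h5 : ∀ s ∈ Set.Ioi (0 : ℝ), (2 * s ^ ((2 : ℝ) - 1)) • β (s ^ (2 : ℝ)) •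
        K (√(s ^ (2 : ℝ))) = -(K s * (-β (s ^ 2) * (2 * s))) := by
      intro s hs
      have hs' : (0 : ℝ) ≤ s := le_of_lt hs
      have : (2 : ℝ) - 1 = 1 := by norm_num
      rw [this, Real.rpow_one, Real.rpow_two, Real.sqrt_sq hs', smul_eq_mul, smul_eq_mul]
      ring
    rw [setIntegral_congr_fun measurableSet_Ioi h5, integral_neg, neg_eq_zero]
    refine Eq.trans ?_ h3
    rw [intervalIntegral.integral_of_le hr0.le]
    refine (setIntegral_eq_of_subset_of_forall_sdiff_eq_zero measurableSet_Ioi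
      Set.Ioc_subset_Ioi_self fun s hs => ?_)
    have : r < s := by
      by_contra h
      exact hs.2 ⟨hs.1, not_lt.1 h⟩
    rw [hβ0 (s ^ 2) (by nlinarith)]
    simp
  have heq : Set.EqOn (fun y : ℝ => K (√y)) (fun _ => 0) (Set.Ioi 0) :=
    Measure.eqOn_open_of_ae_eq (μ := volume) ((ae_restrict_iff' measurableSet_Ioi).2 hae)
      isOpen_Ioi hcont.continuousOn continuousOn_const
  have := heq (x := s ^ 2) (by simp only [Set.mem_Ioi]; positivity)
  simp only [Real.sqrt_sq hs.le, hK] at this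
  linarith

end RadialEquation

section Ray

/-- The Dyson inequality along a single ray. -/
lemma ray_inequality {V f d : ℝ → ℝ} (hV_meas : Measurable V) (hV0 : ∀ s, 0 ≤ V s) {C : ℝ}
    (hV_bdd : ∀ s, |V s| ≤ C) (hd : Continuous d) (hf : ∀ s, HasDerivAt f (d s) s)
    (hf0 : ∀ s, 0 ≤ f s) (hf1 : ∀ s, f s ≤ 1)
    (hq : ∀ s, 0 < s → s ^ 2 * d s = ∫ t in 0..s, 1 / 2 * (t ^ 2 * V t * f t))
    {a r : ℝ} (ha : 0 ≤ a) (hr : 0 < r) (hra : r ^ 2 * d r = a)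
    {g Ψ Ψ' : ℝ → ℂ} (hg : Continuous g) (hΨ : ∀ s, HasDerivAt Ψ (Ψ' s) s)
    (hΨ' : Continuous Ψ') {δ : ℝ}
    (hδ : ∀ s, 0 ≤ s → s ≤ r → ‖(Ψ r - Ψ s) - (g r - g s)‖ ≤ δ) {ε : ℝ} (hε : 0 < ε) :
    (1 - ε) * a * ‖g r‖ ^ 2 ≤
      (∫ s in 0..r, (s ^ 2 * ‖Ψ' s‖ ^ 2 + 1 / 2 * (s ^ 2 * V s * ‖g s‖ ^ 2))) +
        a / ε * δ ^ 2 := by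
  set ρ : ℝ → ℝ := fun t => 1 / 2 * (t ^ 2 * V t * f t) with hρ
  have hfc : Continuous f := continuous_iff_continuousAt.2 fun s => (hf s).continuousAt
  have hΨc : Continuous Ψ := continuous_iff_continuousAt.2 fun s => (hΨ s).continuousAt
  have hρi : IntegrableOn ρ (Set.Ioc 0 r) := locallyIntegrable_radial_density hV_meas hV_bdd hfc
  have hρI : IntervalIntegrable ρ volume 0 r :=
    (intervalIntegrable_iff_integrableOn_Ioc_of_le hr.le).2 hρi
  have hρ0 : ∀ s, 0 ≤ ρ s := fun s => by
    have := hV0 s; have := hf0 s; simp only [hρ]; positivity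
  have hρa : ∫ t in 0..r, ρ t = a := by rw [← hra, hq r hr]
  have hqd : ∀ {E : Type} [NormedAddCommGroup E] [NormedSpace ℝ E] (u : ℝ → E),
      ∫ s in 0..r, (∫ t in 0..s, ρ t) • u s = ∫ s in 0..r, (s ^ 2 * d s) • u s := by
    intro E _ _ u
    refine intervalIntegral.integral_congr_ae (ae_of_all _ fun s hs => ?_)
    rw [Set.uIoc_of_le hr.le] at hs
    rw [hq s hs.1]
  have hVi : ∀ {u : ℝ → ℝ}, Continuous u →
      IntervalIntegrable (fun t => 1 / 2 * (t ^ 2 * V t * u t)) volume 0 r := fun hu =>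
    (intervalIntegrable_iff_integrableOn_Ioc_of_le hr.le).2
      (locallyIntegrable_radial_density hV_meas hV_bdd hu)
  have hρu : ∀ {E : Type} [NormedAddCommGroup E] [NormedSpace ℝ E] {u : ℝ → E}, Continuous u →
      IntervalIntegrable (fun t => ρ t • u t) volume 0 r := fun hu =>
    hρI.smul_continuousOn hu.continuousOn
  -- the energy of the radial profile
  have henergy : ∫ s in 0..r, (s ^ 2 * d s ^ 2 + ρ s * f s) ≤ a := by
    have h1 := integral_primitive_smul_deriv hr.le hρi hf hd
    rw [hqd] at h1
    simp only [smul_eq_mul] at h1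
    have hi : IntervalIntegrable (fun s => ρ s * f s) volume 0 r := hρu hfc
    have h2 : ∫ s in 0..r, ρ s * (f r - f s) = a * f r - ∫ s in 0..r, ρ s * f s := by
      simp only [mul_sub]
      rw [intervalIntegral.integral_sub (hρI.mul_const _) hi,
        intervalIntegral.integral_mul_const, hρa]
    have h3 : ∫ s in 0..r, (s ^ 2 * d s ^ 2 + ρ s * f s) = a * f r := by
      rw [intervalIntegral.integral_add _ hi]
      · have : ∀ s, s ^ 2 * d s ^ 2 = s ^ 2 * d s * d s := fun s => by ring
        simp only [this]
        rw [h1, h2]; ring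
      · exact (by fun_prop : Continuous fun s => s ^ 2 * d s ^ 2).intervalIntegrable _ _
    rw [h3]
    nlinarith [hf1 r]
  have hI1 : IntervalIntegrable (fun s => ρ s * ‖g s‖) volume 0 r := hρu hg.norm
  have hI2 : IntervalIntegrable (fun s => s ^ 2 * |d s| * ‖Ψ' s‖) volume 0 r := by
    have := hd.abs; have := hΨ'.norm
    exact (by fun_prop : Continuous fun s => s ^ 2 * |d s| * ‖Ψ' s‖).intervalIntegrable _ _
  have hlow : a * ‖g r‖ ≤
      (∫ s in 0..r, (ρ s * ‖g s‖ + s ^ 2 * |d s| * ‖Ψ' s‖)) + a * δ := by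
    have h1 := integral_primitive_smul_deriv hr.le hρi hΨ hΨ'
    rw [hqd] at h1
    have hid : a • g r = (∫ s in 0..r, ρ s • g s) + (∫ s in 0..r, (s ^ 2 * d s) • Ψ' s) -
        ∫ s in 0..r, ρ s • ((Ψ r - Ψ s) - (g r - g s)) := by
      rw [h1, ← intervalIntegral.integral_add, ← intervalIntegral.integral_sub, ← hρa,
        ← intervalIntegral.integral_smul_const]
      · refine intervalIntegral.integral_congr fun s _ => ?_
        simp only [← smul_add, ← smul_sub]
        congr 1; ring
      · exact (hρu hg).add (hρu (by fun_prop))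
      · exact hρu (by fun_prop)
      · exact hρu hg
      · exact hρu (by fun_prop)
    have hn1 : ‖∫ s in 0..r, ρ s • g s‖ ≤ ∫ s in 0..r, ρ s * ‖g s‖ := by
      refine intervalIntegral.norm_integral_le_of_norm_le hr.le (ae_of_all _ fun s _ => ?_) hI1
      rw [norm_smul, Real.norm_of_nonneg (hρ0 s)]
    have hn2 : ‖∫ s in 0..r, (s ^ 2 * d s) • Ψ' s‖ ≤ ∫ s in 0..r, s ^ 2 * |d s| * ‖Ψ' s‖ := by
      refine intervalIntegral.norm_integral_le_of_norm_le hr.le (ae_of_all _ fun s _ => ?_) hI2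
      rw [norm_smul, norm_mul, Real.norm_of_nonneg (sq_nonneg s), Real.norm_eq_abs]
    have hn3 : ‖∫ s in 0..r, ρ s • ((Ψ r - Ψ s) - (g r - g s))‖ ≤ a * δ := by
      rw [← hρa, ← intervalIntegral.integral_mul_const]
      refine intervalIntegral.norm_integral_le_of_norm_le hr.le (ae_of_all _ fun s hs => ?_)
        (hρI.mul_const _)
      rw [norm_smul, Real.norm_of_nonneg (hρ0 s)]
      exact mul_le_mul_of_nonneg_left (hδ s hs.1.le hs.2) (hρ0 s)
    have hna : ‖a • g r‖ = a * ‖g r‖ := by rw [norm_smul, Real.norm_of_nonneg ha]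
    rw [← hna, hid, intervalIntegral.integral_add hI1 hI2]
    exact (norm_sub_le _ _).trans (add_le_add ((norm_add_le _ _).trans (add_le_add hn1 hn2)) hn3)
  have hyoung : 2 * ‖g r‖ * (∫ s in 0..r, (ρ s * ‖g s‖ + s ^ 2 * |d s| * ‖Ψ' s‖)) ≤
      (∫ s in 0..r, (s ^ 2 * ‖Ψ' s‖ ^ 2 + 1 / 2 * (s ^ 2 * V s * ‖g s‖ ^ 2))) +
        ‖g r‖ ^ 2 * ∫ s in 0..r, (s ^ 2 * d s ^ 2 + ρ s * f s) := by
    have hJ1 : IntervalIntegrable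
        (fun s => s ^ 2 * ‖Ψ' s‖ ^ 2 + 1 / 2 * (s ^ 2 * V s * ‖g s‖ ^ 2)) volume 0 r := by
      refine IntervalIntegrable.add ?_ (hVi (hg.norm.pow 2))
      have := hΨ'.norm
      exact (by fun_prop : Continuous fun s => s ^ 2 * ‖Ψ' s‖ ^ 2).intervalIntegrable _ _
    have hJ2 : IntervalIntegrable (fun s => s ^ 2 * d s ^ 2 + ρ s * f s) volume 0 r :=
      ((by fun_prop : Continuous fun s => s ^ 2 * d s ^ 2).intervalIntegrable _ _).add (hρu hfc)
    rw [← intervalIntegral.integral_const_mul, ← intervalIntegral.integral_const_mul,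
      ← intervalIntegral.integral_add hJ1 (hJ2.const_mul _)]
    refine intervalIntegral.integral_mono_on hr.le ((hI1.add hI2).const_mul _)
      (hJ1.add (hJ2.const_mul _)) fun s _ => ?_
    have e1 : 0 ≤ s ^ 2 * (‖Ψ' s‖ - ‖g r‖ * |d s|) ^ 2 := by positivity
    have e2 : 0 ≤ 1 / 2 * (s ^ 2 * V s * (‖g s‖ - ‖g r‖ * f s) ^ 2) := by
      have := hV0 s; positivity
    have e3 : |d s| ^ 2 = d s ^ 2 := sq_abs _
    simp only [hρ]
    rw [← e3]
    nlinarith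
  have hfin : 2 * ‖g r‖ * δ ≤ ε * ‖g r‖ ^ 2 + δ ^ 2 / ε := by
    have h1 : ε * ‖g r‖ ^ 2 + δ ^ 2 / ε - 2 * ‖g r‖ * δ = (ε * ‖g r‖ - δ) ^ 2 / ε := by
      field_simp; ring
    have h2 : 0 ≤ (ε * ‖g r‖ - δ) ^ 2 / ε := by positivity
    linarith
  have h1 : ‖g r‖ ^ 2 * ∫ s in 0..r, (s ^ 2 * d s ^ 2 + ρ s * f s) ≤ ‖g r‖ ^ 2 * a :=
    mul_le_mul_of_nonneg_left henergy (sq_nonneg _)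
  have h2 := mul_le_mul_of_nonneg_left hlow (by positivity : 0 ≤ 2 * ‖g r‖)
  have h3 := mul_le_mul_of_nonneg_left hfin ha
  have h4 : a * (ε * ‖g r‖ ^ 2 + δ ^ 2 / ε) = a * ε * ‖g r‖ ^ 2 + a / ε * δ ^ 2 := by ring
  rw [h4] at h3
  nlinarith

end Ray

section Correlation

open scoped SchwartzMap LineDeriv

/-- The correlation `x ↦ ∫ h(u) k(x + u) du`. -/
def correlation (h k : R3 → ℂ) (x : R3) : ℂ := ∫ u, h u * k (x + u)

/-- The normalizing constant of the symmetric Fourier transform on `ℝ³`. -/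
abbrev fourierConst : ℝ := (2 * π) ^ (-(3 : ℝ) / 2)

/-- The `j`-th partial derivative of a Schwartz function. -/
abbrev schwartzPartial (j : Fin 3) (ψ : 𝓢(R3, ℂ)) : 𝓢(R3, ℂ) :=
  ∂_{(EuclideanSpace.single j (1 : ℝ) : R3)} ψ

lemma SchwartzMap.exists_norm_le (k : 𝓢(R3, ℂ)) : ∃ C, ∀ x, ‖k x‖ ≤ C :=
  ⟨_, SchwartzMap.norm_le_seminorm ℝ k⟩

lemma lineDeriv_eq_sum (ψ : 𝓢(R3, ℂ)) (ω x : R3) :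
    (∂_{ω} ψ) x = ∑ j, (ω j : ℂ) * schwartzPartial j ψ x := by
  have hω : ω = ∑ j, ω j • (EuclideanSpace.single j (1 : ℝ) : R3) := by
    ext i
    simp [Fin.sum_univ_three]
    fin_cases i <;> simp
  simp only [schwartzPartial, SchwartzMap.lineDerivOp_apply_eq_fderiv]
  conv_lhs => rw [hω]
  simp [map_sum]

variable {h : R3 → ℂ}

lemma integrable_correlation_integrand (hh : Integrable h) (k : 𝓢(R3, ℂ)) (x : R3) :
    Integrable fun u => h u * k (x + u) := by
  obtain ⟨C, hC⟩ := k.exists_norm_le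
  exact hh.mul_bdd (c := C)
    (by have := k.continuous; exact (by fun_prop : Continuous fun u => k (x + u)).aestronglyMeasurable)
    (ae_of_all _ fun u => hC _)

lemma continuous_correlation (hh : Integrable h) (k : 𝓢(R3, ℂ)) :
    Continuous (correlation h k) := by
  obtain ⟨C, hC⟩ := k.exists_norm_le
  refine continuous_of_dominated (bound := fun u => ‖h u‖ * C)
    (fun x => (integrable_correlation_integrand hh k x).aestronglyMeasurable)
    (fun x => ae_of_all _ fun u => ?_) (hh.norm.mul_const _) (ae_of_all _ fun u => ?_)
  · rw [norm_mul]
    exact mul_le_mul_of_nonneg_left (hC _) (norm_nonneg _)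
  · have := k.continuous; fun_prop

lemma norm_correlation_le (hh : Integrable h) (k : 𝓢(R3, ℂ)) :
    ∃ C, ∀ x, ‖correlation h k x‖ ≤ C := by
  obtain ⟨C, hC⟩ := k.exists_norm_le
  refine ⟨∫ u, ‖h u‖ * C, fun x => norm_integral_le_of_norm_le (hh.norm.mul_const _)
    (ae_of_all _ fun u => ?_)⟩
  rw [norm_mul]
  exact mul_le_mul_of_nonneg_left (hC _) (norm_nonneg _)

lemma integrable_correlation (hh : Integrable h) (k : 𝓢(R3, ℂ)) :
    Integrable (correlation h k) := by
  have := hh.comp_neg.integrable_convolution (ContinuousLinearMap.mul ℝ ℂ) k.integrable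
    (μ := volume)
  refine this.congr (ae_of_all _ fun x => ?_)
  rw [convolution_def, correlation, ← integral_neg_eq_self]
  simp

lemma hasDerivAt_correlation_ray (hh : Integrable h) (ψ : 𝓢(R3, ℂ)) (y ω : R3) (s : ℝ) :
    HasDerivAt (fun s : ℝ => correlation h ψ (y + s • ω))
      (correlation h (∂_{ω} ψ : 𝓢(R3, ℂ)) (y + s • ω)) s := by
  obtain ⟨C, hC⟩ := (∂_{ω} ψ : 𝓢(R3, ℂ)).exists_norm_le
  refine (hasDerivAt_integral_of_dominated_loc_of_deriv_le
    (F := fun s u => h u * ψ (y + s • ω + u))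
    (F' := fun s u => h u * (∂_{ω} ψ : 𝓢(R3, ℂ)) (y + s • ω + u))
    (bound := fun u => ‖h u‖ * C) Filter.univ_mem ?_ ?_ ?_ ?_ ?_ ?_).2
  · exact Filter.Eventually.of_forall fun t =>
      (integrable_correlation_integrand hh ψ _).aestronglyMeasurable
  · exact integrable_correlation_integrand hh ψ _
  · exact (integrable_correlation_integrand hh _ _).aestronglyMeasurable
  · refine ae_of_all _ fun u t _ => ?_
    rw [norm_mul]
    exact mul_le_mul_of_nonneg_left (hC _) (norm_nonneg _)
  · exact hh.norm.mul_const _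
  · refine ae_of_all _ fun u t _ => HasDerivAt.const_mul _ ?_
    rw [SchwartzMap.lineDerivOp_apply_eq_fderiv]
    have h1 : HasDerivAt (fun t : ℝ => y + t • ω + u) ω t := by
      simpa using (((hasDerivAt_id t).smul_const ω).const_add y).add_const u
    exact (ψ.differentiableAt.hasFDerivAt).comp_hasDerivAt t h1

lemma hasDerivAt_schwartz_ray (ψ : 𝓢(R3, ℂ)) (y ω : R3) (s : ℝ) :
    HasDerivAt (fun s : ℝ => ψ (y + s • ω)) ((∂_{ω} ψ : 𝓢(R3, ℂ)) (y + s • ω)) s := by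
  rw [SchwartzMap.lineDerivOp_apply_eq_fderiv]
  have h1 : HasDerivAt (fun t : ℝ => y + t • ω) ω s := by
    simpa using ((hasDerivAt_id s).smul_const ω).const_add y
  exact (ψ.differentiableAt.hasFDerivAt).comp_hasDerivAt s h1

/-- The `j`-th component of `χ(p)∇ψ`, in terms of `h`, the Fourier transform of `1 - χ`. -/
def filteredPartial (h : R3 → ℂ) (ψ : 𝓢(R3, ℂ)) (j : Fin 3) (x : R3) : ℂ :=
  schwartzPartial j ψ x - fourierConst * correlation h (schwartzPartial j ψ) x

lemma continuous_filteredPartial (hh : Integrable h) (ψ : 𝓢(R3, ℂ)) (j : Fin 3) :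
    Continuous (filteredPartial h ψ j) :=
  (schwartzPartial j ψ).continuous.sub (continuous_const.mul (continuous_correlation hh _))

lemma integrable_normSq_filteredPartial (hh : Integrable h) (ψ : 𝓢(R3, ℂ)) (j : Fin 3) :
    Integrable fun x => ‖filteredPartial h ψ j x‖ ^ 2 := by
  obtain ⟨C1, hC1⟩ := (schwartzPartial j ψ).exists_norm_le
  obtain ⟨C2, hC2⟩ := norm_correlation_le hh (schwartzPartial j ψ)
  have hi : Integrable (filteredPartial h ψ j) :=
    (schwartzPartial j ψ).integrable.sub ((integrable_correlation hh _).const_mul _)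
  have := hi.norm.mul_bdd (g := fun x => ‖filteredPartial h ψ j x‖)
    (c := C1 + fourierConst * C2) hi.norm.aestronglyMeasurable (ae_of_all _ fun x => ?_)
  · simpa only [sq] using this
  · rw [norm_norm]
    refine (norm_sub_le _ _).trans (add_le_add (hC1 x) ?_)
    rw [norm_mul, Complex.norm_real, Real.norm_of_nonneg (by positivity)]
    exact mul_le_mul_of_nonneg_left (hC2 x) (by positivity)

/-- The radial derivative of `ψ - (2π)^{-3/2} correlation h ψ` along a ray. -/
lemma hasDerivAt_filtered_ray (hh : Integrable h) (ψ : 𝓢(R3, ℂ)) (y ω : R3) (s : ℝ) :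
    HasDerivAt (fun s : ℝ => ψ (y + s • ω) - fourierConst * correlation h ψ (y + s • ω))
      (∑ j, (ω j : ℂ) * filteredPartial h ψ j (y + s • ω)) s := by
  refine ((hasDerivAt_schwartz_ray ψ y ω s).sub
    ((hasDerivAt_correlation_ray hh ψ y ω s).const_mul (fourierConst : ℂ))).congr_deriv ?_
  have : correlation h (∂_{ω} ψ : 𝓢(R3, ℂ)) (y + s • ω) =
      ∑ j, (ω j : ℂ) * correlation h (schwartzPartial j ψ) (y + s • ω) := by
    have h1 : ∀ u, h u * (∂_{ω} ψ : 𝓢(R3, ℂ)) (y + s • ω + u) =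
        ∑ j, h u * ((ω j : ℂ) * schwartzPartial j ψ (y + s • ω + u)) := fun u => by
      rw [lineDeriv_eq_sum, Finset.mul_sum]
    simp only [correlation, h1]
    rw [integral_finsetSum]
    · refine Finset.sum_congr rfl fun j _ => ?_
      rw [← integral_const_mul]
      congr 1 with u
      ring
    · intro j _
      refine ((integrable_correlation_integrand hh (schwartzPartial j ψ) (y + s • ω)).const_mul
        (ω j : ℂ)).congr (ae_of_all _ fun u => ?_)
      simp only; ring
  rw [this, lineDeriv_eq_sum, Finset.mul_sum, ← Finset.sum_sub_distrib]
  refine Finset.sum_congr rfl fun j _ => ?_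
  simp only [filteredPartial]
  ring

lemma normSq_sum_mul_le (ω : Metric.sphere (0 : R3) 1) (F : Fin 3 → ℂ) :
    ‖∑ j, ((ω : R3) j : ℂ) * F j‖ ^ 2 ≤ ∑ j, ‖F j‖ ^ 2 := by
  have h1 : ‖∑ j, ((ω : R3) j : ℂ) * F j‖ ≤ ∑ j, |(ω : R3) j| * ‖F j‖ := by
    refine (norm_sum_le _ _).trans (le_of_eq (Finset.sum_congr rfl fun j _ => ?_))
    rw [norm_mul, Complex.norm_real, Real.norm_eq_abs]
  have h2 := Finset.sum_mul_sq_le_sq_mul_sq Finset.univ (fun j => |(ω : R3) j|) fun j => ‖F j‖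
  have h3 : ∑ j, |(ω : R3) j| ^ 2 = 1 := by
    have := EuclideanSpace.norm_sq_eq (ω : R3)
    rw [norm_eq_of_mem_sphere ω] at this
    simpa using this.symm
  rw [h3, one_mul] at h2
  exact (pow_le_pow_left₀ (norm_nonneg _) h1 2).trans h2

end Correlation

section Fourier

open scoped SchwartzMap LineDeriv FourierTransform

lemma fourierConst_sq : fourierConst ^ 2 = ((2 * π) ^ 3)⁻¹ := by
  rw [fourierConst, ← Real.rpow_natCast, ← Real.rpow_mul (by positivity), ← Real.rpow_natCast,
    ← Real.rpow_neg (by positivity)]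
  norm_num

lemma ft_eq_fourier (k : R3 → ℂ) (p : R3) :
    ft k p = fourierConst * 𝓕 k ((2 * π)⁻¹ • p) := by
  rw [ft, Real.fourier_eq']
  congr 2 with x
  rw [real_inner_smul_right, smul_eq_mul]
  congr 2
  have : -2 * π * ((2 * π)⁻¹ * ⟪x, p⟫) = -⟪x, p⟫ := by field_simp
  rw [this]
  push_cast
  ring

lemma integrable_ft (k : 𝓢(R3, ℂ)) : Integrable (ft k) := by
  have h1 : Integrable fun p : R3 => 𝓕 (k : R3 → ℂ) ((2 * π)⁻¹ • p) :=
    ((𝓕 k).integrable (μ := volume)).comp_smul (by positivity)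
  refine (h1.const_mul (fourierConst : ℂ)).congr (ae_of_all _ fun p => ?_)
  rw [ft_eq_fourier]

lemma ft_schwartzPartial (ψ : 𝓢(R3, ℂ)) (j : Fin 3) (p : R3) :
    ft (schwartzPartial j ψ) p = Complex.I * (p j : ℂ) * ft (fun z => ψ z) p := by
  rw [ft_eq_fourier, ft_eq_fourier]
  have h := congrArg (fun k : 𝓢(R3, ℂ) => k ((2 * π)⁻¹ • p))
    (SchwartzMap.fourier_lineDerivOp_eq ψ (EuclideanSpace.single j (1 : ℝ) : R3))
  have ht : (inner ℝ · (EuclideanSpace.single j (1 : ℝ) : R3)).HasTemperateGrowth := by fun_prop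
  have h2 : 𝓕 (schwartzPartial j ψ : R3 → ℂ) ((2 * π)⁻¹ • p) =
      (2 * π * Complex.I) * ((((2 * π)⁻¹ * p j : ℝ) : ℂ) * 𝓕 (ψ : R3 → ℂ) ((2 * π)⁻¹ • p)) := by
    refine Eq.trans h ?_
    have hin : ⟪(2 * π)⁻¹ • p, (EuclideanSpace.single j (1 : ℝ) : R3)⟫ = (2 * π)⁻¹ * p j := by
      rw [real_inner_smul_left, EuclideanSpace.inner_single_right]
      simp
    rw [smul_apply, SchwartzMap.smulLeftCLM_apply_apply ht, SchwartzMap.fourier_coe, hin]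
    simp
  rw [h2]
  have hpi : (π : ℂ) ≠ 0 := by exact_mod_cast Real.pi_ne_zero
  push_cast
  field_simp

lemma ift_ft (k : 𝓢(R3, ℂ)) (x : R3) : ift (ft k) x = k x := by
  have h1 := congrFun (k.continuous.fourierInv_fourier_eq k.integrable (𝓕 k).integrable) x
  rw [Real.fourierInv_eq'] at h1
  have h2 : ∀ p : R3, Complex.exp (Complex.I * (⟪p, x⟫ : ℝ)) * ft k p = fourierConst *
      (fun q : R3 => Complex.exp (↑(2 * π * ⟪q, x⟫) * Complex.I) • 𝓕 (k : R3 → ℂ) q)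
        ((2 * π)⁻¹ • p) := by
    intro p
    simp only
    rw [ft_eq_fourier, real_inner_smul_left, smul_eq_mul]
    have : 2 * π * ((2 * π)⁻¹ * ⟪p, x⟫) = ⟪p, x⟫ := by field_simp
    rw [this, mul_comm Complex.I]
    ring
  rw [ift]
  simp only [h2]
  have h3 := Measure.integral_comp_smul volume
    (fun q : R3 => Complex.exp (↑(2 * π * ⟪q, x⟫) * Complex.I) • 𝓕 (k : R3 → ℂ) q) (2 * π)⁻¹
  rw [integral_const_mul]
  refine (congrArg (fun t : ℂ => (fourierConst : ℂ) * (fourierConst * t)) h3).trans ?_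
  rw [h1, ← mul_assoc, Complex.real_smul, ← mul_assoc, ← Complex.ofReal_mul, ← Complex.ofReal_mul, ← sq]
  have hf : Module.finrank ℝ R3 = 3 := by simp
  have : fourierConst ^ 2 * |(((2 * π)⁻¹) ^ 3)⁻¹| = 1 := by
    rw [fourierConst_sq, abs_of_pos (by positivity)]
    field_simp
  rw [hf, this, Complex.ofReal_one, one_mul]

lemma norm_exp_I_mul (t : ℝ) : ‖Complex.exp (Complex.I * t)‖ = 1 := by
  rw [mul_comm]; exact Complex.norm_exp_ofReal_mul_I t

variable {m : R3 → ℂ} {h : R3 → ℂ}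

/-- Multiplying by `m` on the Fourier side is correlating with the Fourier transform of `m`. -/
lemma ift_mul_ft (hm : Integrable m) (hh : ∀ x, h x = ft m x) (k : 𝓢(R3, ℂ)) (x : R3) :
    ift (fun p => m p * ft k p) x = fourierConst * correlation h k x := by
  have hprod : Integrable (Function.uncurry fun p z : R3 =>
      Complex.exp (-(Complex.I * (⟪p, z - x⟫ : ℝ))) * (m p * k z)) (volume.prod volume) := by
    refine (hm.mul_prod k.integrable).bdd_mul (c := 1)
      (f := fun q : R3 × R3 => Complex.exp (-(Complex.I * (⟪q.1, q.2 - x⟫ : ℝ)))) ?_ ?_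
    · exact (by fun_prop : Continuous fun q : R3 × R3 =>
        Complex.exp (-(Complex.I * (⟪q.1, q.2 - x⟫ : ℝ)))).aestronglyMeasurable
    · refine ae_of_all _ fun q => ?_
      rw [← mul_neg, ← Complex.ofReal_neg, norm_exp_I_mul]
  have h1 : ∀ p : R3, Complex.exp (Complex.I * (⟪p, x⟫ : ℝ)) * (m p * ft k p) =
      fourierConst * ∫ z, Complex.exp (-(Complex.I * (⟪p, z - x⟫ : ℝ))) * (m p * k z) := by
    intro p
    rw [ft, ← mul_assoc, ← mul_assoc, mul_comm _ (fourierConst : ℂ), mul_assoc,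
      ← integral_const_mul]
    congr 2 with z
    have : Complex.exp (-(Complex.I * (⟪p, z - x⟫ : ℝ))) =
        Complex.exp (Complex.I * (⟪p, x⟫ : ℝ)) * Complex.exp (-(Complex.I * (⟪z, p⟫ : ℝ))) := by
      rw [← Complex.exp_add, inner_sub_right, real_inner_comm p z]
      push_cast
      ring_nf
    rw [this]
    ring
  have h2 : ∀ z : R3, fourierConst *
      ∫ p, Complex.exp (-(Complex.I * (⟪p, z - x⟫ : ℝ))) * (m p * k z) = h (z - x) * k z := by
    intro z
    rw [hh, ft, mul_assoc, ← integral_mul_const]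
    simp only [mul_assoc]
  rw [ift]
  simp only [h1]
  rw [integral_const_mul, integral_integral_swap hprod, ← integral_const_mul]
  simp only [h2]
  rw [correlation, ← integral_sub_right_eq_self (fun u => h u * k (x + u)) x]
  simp

lemma ift_cutoff_eq_filteredPartial {χ : R3 → ℝ} (hχ_int : Integrable fun p : R3 => 1 - χ p)
    (hχ_nonneg : ∀ p, 0 ≤ χ p) (hχ_le_one : ∀ p, χ p ≤ 1)
    (hh : ∀ x, h x = ft (fun p => 1 - (χ p : ℂ)) x) (ψ : 𝓢(R3, ℂ)) (j : Fin 3) (x : R3) :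
    ift (fun p => (χ p : ℂ) * (Complex.I * (p j : ℂ)) * ft (fun z => ψ z) p) x =
      filteredPartial h ψ j x := by
  have hm : Integrable fun p : R3 => 1 - (χ p : ℂ) := by
    simpa using hχ_int.ofReal (𝕜 := ℂ)
  have hb : ∀ {f : R3 → ℂ}, Integrable f →
      Integrable fun p : R3 => Complex.exp (Complex.I * (⟪p, x⟫ : ℝ)) * f p := by
    intro f hf
    refine hf.bdd_mul (c := 1) (by fun_prop) (ae_of_all _ fun p => ?_)
    rw [norm_exp_I_mul]
  have hft := integrable_ft (schwartzPartial j ψ)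
  have hft2 : Integrable fun p => (1 - (χ p : ℂ)) * ft (schwartzPartial j ψ) p := by
    refine hft.bdd_mul (c := 1) hm.aestronglyMeasurable (ae_of_all _ fun p => ?_)
    rw [← Complex.ofReal_one, ← Complex.ofReal_sub, Complex.norm_real, Real.norm_of_nonneg] <;>
      linarith [hχ_nonneg p, hχ_le_one p]
  rw [filteredPartial, ← ift_mul_ft hm hh, ← ift_ft, ift, ift, ift, ← mul_sub,
    ← integral_sub (hb hft) (hb hft2)]
  congr 2 with p
  rw [ft_schwartzPartial]
  ring

end Fourier

section Oscillation

open scoped SchwartzMap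

variable {h : R3 → ℂ} {fR : R3 → ℝ} {R : ℝ}

lemma norm_sub_le_osc (hh_bdd : ∃ C, ∀ x, ‖h x‖ ≤ C)
    (hfR : ∀ x : R3, fR x = ⨆ y ∈ Metric.closedBall (0 : R3) R, ‖h (x - y) - h x‖)
    {y : R3} (hy : ‖y‖ ≤ R) (x : R3) : ‖h (x - y) - h x‖ ≤ fR x := by
  obtain ⟨C, hC⟩ := hh_bdd
  have hC0 : 0 ≤ C := (norm_nonneg _).trans (hC 0)
  have hle : ∀ y, ‖h (x - y) - h x‖ ≤ C + C := fun y =>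
    (norm_sub_le _ _).trans (add_le_add (hC _) (hC _))
  have hy' : y ∈ Metric.closedBall (0 : R3) R := by simpa using hy
  rw [hfR]
  refine le_ciSup_of_le ⟨C + C, ?_⟩ y ?_
  · rintro _ ⟨z, rfl⟩
    exact Real.iSup_le (fun _ => hle z) (by positivity)
  · rw [ciSup_pos hy']

lemma osc_nonneg
    (hfR : ∀ x : R3, fR x = ⨆ y ∈ Metric.closedBall (0 : R3) R, ‖h (x - y) - h x‖)
    (x : R3) : 0 ≤ fR x := by
  rw [hfR]
  exact Real.iSup_nonneg fun y => Real.iSup_nonneg fun _ => norm_nonneg _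

lemma norm_correlation_sub_le (hh : Integrable h) (hh_bdd : ∃ C, ∀ x, ‖h x‖ ≤ C)
    (hfR : ∀ x : R3, fR x = ⨆ y ∈ Metric.closedBall (0 : R3) R, ‖h (x - y) - h x‖)
    (hfR_int : Integrable fR) (ψ : 𝓢(R3, ℂ)) (y : R3) {x : R3} (hx : ‖x‖ ≤ R) :
    ‖correlation h ψ (y + x) - correlation h ψ y‖ ≤ ∫ z, fR z * ‖ψ (y + z)‖ := by
  obtain ⟨C, hC⟩ := ψ.exists_norm_le
  have hi := integrable_correlation_integrand hh ψ y
  have hi2 : Integrable fun z => h (z - x) * ψ (y + z) := by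
    refine ((integrable_correlation_integrand hh ψ (y + x)).comp_sub_right x).congr
      (ae_of_all _ fun z => ?_)
    simp only
    congr 2
    abel
  have h1 : correlation h ψ (y + x) = ∫ z, h (z - x) * ψ (y + z) := by
    rw [correlation, ← integral_sub_right_eq_self _ x]
    congr 1 with z
    congr 2
    abel
  rw [h1, correlation, ← integral_sub hi2 hi]
  refine norm_integral_le_of_norm_le ?_ (ae_of_all _ fun z => ?_)
  · refine hfR_int.mul_bdd (c := C) ?_ (ae_of_all _ fun z => ?_)
    · have := ψ.continuous
      exact (by fun_prop : Continuous fun z => ‖ψ (y + z)‖).aestronglyMeasurable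
    · rw [norm_norm]; exact hC _
  · rw [← sub_mul, norm_mul]
    exact mul_le_mul_of_nonneg_right (norm_sub_le_osc hh_bdd hfR hx z) (norm_nonneg _)

/-- The Cauchy–Schwarz inequality for a weighted integral. -/
lemma sq_integral_mul_le {α : Type*} [MeasurableSpace α] {μ : Measure α} {w u : α → ℝ}
    (hw : ∀ x, 0 ≤ w x) (hwi : Integrable w μ)
    (h1 : Integrable (fun x => w x * u x) μ) (h2 : Integrable (fun x => w x * u x ^ 2) μ) :
    (∫ x, w x * u x ∂μ) ^ 2 ≤ (∫ x, w x ∂μ) * ∫ x, w x * u x ^ 2 ∂μ := by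
  have h : ∀ t : ℝ, 0 ≤ (∫ x, w x ∂μ) * (t * t) + (-2 * ∫ x, w x * u x ∂μ) * t +
      ∫ x, w x * u x ^ 2 ∂μ := by
    intro t
    have h3 : 0 ≤ ∫ x, w x * (u x - t) ^ 2 ∂μ :=
      integral_nonneg fun x => mul_nonneg (hw x) (sq_nonneg _)
    have h4 : ∫ x, w x * (u x - t) ^ 2 ∂μ =
        ∫ x, (w x * (t * t) + w x * u x * (-2 * t) + w x * u x ^ 2) ∂μ := by
      congr 1 with x
      ring
    have h5 : Integrable (fun x => w x * (t * t) + w x * u x * (-2 * t)) μ :=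
      (hwi.mul_const _).add (h1.mul_const _)
    rw [h4, integral_add h5 h2,
      integral_add (hwi.mul_const _) (h1.mul_const _), integral_mul_const,
      integral_mul_const] at h3
    linarith
  have := discrim_le_zero h
  rw [discrim] at this
  nlinarith

end Oscillation

section Center

open scoped SchwartzMap

/-- A bound on rays emanating from the origin, averaged against a radial weight. -/
lemma integral_radial_weight_mul_le {U G P : R3 → ℝ} (hU0 : ∀ x, 0 ≤ U x)
    (hU_radial : ∀ x y : R3, ‖x‖ = ‖y‖ → U x = U y) (hU_int : ∫ x, U x = 4 * π)
    (hG : Integrable G) (hUP : Integrable fun x => U x * P x) (K : ℝ)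
    (hray : ∀ ω : Metric.sphere (0 : R3) 1,
      IntegrableOn (fun s : ℝ => s ^ 2 • G (s • (ω : R3))) (Set.Ioi 0) →
      ∀ r : ℝ, 0 < r → U (r • (ω : R3)) ≠ 0 →
        P (r • (ω : R3)) ≤ (∫ s in Set.Ioi (0 : ℝ), s ^ 2 • G (s • (ω : R3))) + K) :
    ∫ x, U x * P x ≤ (∫ x, G x) + 4 * π * K := by
  have hUi : Integrable U := by
    by_contra hn
    rw [integral_undef hn] at hU_int
    have := Real.pi_pos
    linarith
  have hone : ∀ ω : Metric.sphere (0 : R3) 1,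
      ∫ s in Set.Ioi (0 : ℝ), s ^ 2 • U (s • (ω : R3)) = 1 := by
    intro ω
    have hc : ∀ ω' : Metric.sphere (0 : R3) 1,
        ∫ s in Set.Ioi (0 : ℝ), s ^ 2 • U (s • (ω' : R3)) =
          ∫ s in Set.Ioi (0 : ℝ), s ^ 2 • U (s • (ω : R3)) := by
      intro ω'
      congr 1 with s
      rw [hU_radial (s • (ω' : R3)) (s • (ω : R3)) (by simp [norm_smul])]
    have h1 := integral_polar hUi
    simp only [hc] at h1
    rw [integral_const, sphereMeasure_real_univ, hU_int, smul_eq_mul] at h1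
    exact mul_left_cancel₀ (by positivity) (h1.trans (mul_one _).symm)
  have hUs : ∀ ω : Metric.sphere (0 : R3) 1,
      IntegrableOn (fun s : ℝ => s ^ 2 • U (s • (ω : R3))) (Set.Ioi 0) := by
    intro ω
    by_contra hn
    have := hone ω
    rw [integral_undef hn] at this
    exact zero_ne_one this
  have hE := (integrable_polar hG).integral_prod_left
  rw [← integral_polar hUP, ← integral_polar hG]
  calc _ ≤ ∫ ω, ((∫ s in Set.Ioi (0 : ℝ), s ^ 2 • G (s • (ω : R3))) + K) ∂sphereMeasure := by
        refine integral_mono_ae (integrable_polar hUP).integral_prod_left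
          (hE.add (integrable_const K)) ?_
        filter_upwards [(integrable_polar hUP).prod_right_ae,
          (integrable_polar hG).prod_right_ae] with ω h1 h2
        have h3 := hray ω h2
        set E := (∫ s in Set.Ioi (0 : ℝ), s ^ 2 • G (s • (ω : R3))) + K with hEdef
        calc _ ≤ ∫ s in Set.Ioi (0 : ℝ), s ^ 2 • U (s • (ω : R3)) * E := by
              refine setIntegral_mono_on h1 ((hUs ω).mul_const E) measurableSet_Ioi fun r hr => ?_
              simp only [smul_eq_mul, mul_assoc]
              refine mul_le_mul_of_nonneg_left ?_ (sq_nonneg r)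
              by_cases h0 : U (r • (ω : R3)) = 0
              · simp [h0]
              · exact mul_le_mul_of_nonneg_left (h3 r hr h0) (hU0 _)
          _ = E := by rw [integral_mul_const, hone, one_mul]
    _ = _ := by
        rw [integral_add hE (integrable_const K), integral_const, sphereMeasure_real_univ,
          smul_eq_mul]

variable {v φ : R3 → ℝ} {R0 a R : ℝ} {h : R3 → ℂ} {fR U : R3 → ℝ}

lemma SchwartzMap.integrable_mul_normSq (ψ : 𝓢(R3, ℂ)) {w : R3 → ℝ} (hw : Integrable w) (y : R3) :
    Integrable fun x => w x * ‖ψ (y + x)‖ ^ 2 := by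
  obtain ⟨C, hC⟩ := ψ.exists_norm_le
  have := ψ.continuous
  refine hw.mul_bdd (c := C ^ 2)
    (by fun_prop : Continuous fun x => ‖ψ (y + x)‖ ^ 2).aestronglyMeasurable
    (ae_of_all _ fun x => ?_)
  rw [norm_pow, norm_norm]
  exact pow_le_pow_left₀ (norm_nonneg _) (hC _) 2

lemma SchwartzMap.integrable_bdd_mul_normSq (ψ : 𝓢(R3, ℂ)) {w : R3 → ℝ} (hw : Measurable w)
    {C : ℝ} (hC : ∀ x, |w x| ≤ C) (y : R3) :
    Integrable fun x => w x * ‖ψ (y + x)‖ ^ 2 := by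
  obtain ⟨D, hD⟩ := ψ.exists_norm_le
  have h1 : Integrable fun x => ψ (y + x) := ψ.integrable.comp_add_left y
  have h2 : Integrable fun x => ‖ψ (y + x)‖ * ‖ψ (y + x)‖ :=
    h1.norm.mul_bdd (c := D) h1.norm.aestronglyMeasurable
      (ae_of_all _ fun x => by rw [norm_norm]; exact hD _)
  simp only [pow_two]
  exact h2.bdd_mul (c := C) hw.aestronglyMeasurable (ae_of_all _ hC)

/-- The generalized Dyson lemma for one scattering center, with the kinetic energy localized in
the ball of radius `R` around it. -/
lemma dyson_one_center (hR0 : 0 < R0) (hv_meas : Measurable v) (hv_nonneg : ∀ x, 0 ≤ v x)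
    (hv_bdd : ∃ C, ∀ x, v x ≤ C) (hv_radial : ∀ x y : R3, ‖x‖ = ‖y‖ → v x = v y)
    (hφ_C1 : ContDiff ℝ 1 φ) (hφ_nonneg : ∀ x, 0 ≤ φ x) (hφ_le_one : ∀ x, φ x ≤ 1)
    (hφ_eq : ∀ x : R3, R0 ≤ ‖x‖ → φ x = 1 - a / ‖x‖)
    (hφ_scatt : ∀ g : R3 → ℝ, ContDiff ℝ (⊤ : ℕ∞) g → HasCompactSupport g →
      (∫ x : R3, ⟪gradient φ x, gradient g x⟫) + (1/2) * ∫ x : R3, v x * φ x * g x = 0)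
    (hh_bdd : ∃ C, ∀ x, ‖h x‖ ≤ C) (hh_int : Integrable h)
    (hfR : ∀ x : R3, fR x = ⨆ y ∈ Metric.closedBall (0 : R3) R, ‖h (x - y) - h x‖)
    (hfR_int : Integrable fR) (hU_nonneg : ∀ x, 0 ≤ U x)
    (hU_radial : ∀ x y : R3, ‖x‖ = ‖y‖ → U x = U y)
    (hU_supp : ∀ x : R3, ‖x‖ < R0 ∨ R < ‖x‖ → U x = 0)
    (hU_int : (∫ x : R3, U x) = 4 * π) {ε : ℝ} (hε : 0 < ε) (ψ : 𝓢(R3, ℂ)) (y : R3) :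
    (1 - ε) * a * (∫ x, U x * ‖ψ (y + x)‖ ^ 2) ≤
      (∫ x in Metric.ball 0 R, ∑ j, ‖filteredPartial h ψ j (y + x)‖ ^ 2) +
        1 / 2 * (∫ x, v x * ‖ψ (y + x)‖ ^ 2) +
        a / ε * ((2 / π ^ 2) * ((∫ z, fR z) * ∫ x, fR x * ‖ψ (y + x)‖ ^ 2)) := by
  obtain ⟨C, hC⟩ := hv_bdd
  have hvC : ∀ x, |v x| ≤ C := fun x => by rw [abs_of_nonneg (hv_nonneg x)]; exact hC x
  have ha : 0 ≤ a := by
    have h1 : ‖(EuclideanSpace.single 0 R0 : R3)‖ = R0 := by simp [abs_of_pos hR0]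
    have h2 := hφ_eq (EuclideanSpace.single 0 R0 : R3) h1.ge
    have h3 := hφ_le_one (EuclideanSpace.single 0 R0 : R3)
    rw [h2, h1] at h3
    rw [← div_mul_cancel₀ a hR0.ne']
    exact mul_nonneg (by linarith) hR0.le
  set V : ℝ → ℝ := fun s => v (EuclideanSpace.single 0 s) with hVdef
  have hvV : ∀ x, v x = V ‖x‖ := fun x => hv_radial _ _ (by simp)
  have hcs : Continuous fun s : ℝ => (EuclideanSpace.single 0 s : R3) :=
    (PiLp.continuous_toLp 2 _).comp (continuous_single (A := fun _ : Fin 3 => ℝ) 0)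
  have hV_meas : Measurable V := hv_meas.comp hcs.measurable
  set Φ : R3 → ℝ := fun x => ∑ j, ‖filteredPartial h ψ j (y + x)‖ ^ 2 with hΦ
  have hΦ0 : ∀ x, 0 ≤ Φ x := fun x => Finset.sum_nonneg fun j _ => sq_nonneg _
  have hΦi : Integrable Φ := integrable_finsetSum _ fun j _ =>
    (integrable_normSq_filteredPartial hh_int ψ j).comp_add_left y
  have hvi := ψ.integrable_bdd_mul_normSq hv_meas hvC y
  have hUi : Integrable U := by
    by_contra hn
    rw [integral_undef hn] at hU_int
    have := Real.pi_pos
    linarith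
  set T : ℝ := ∫ z, fR z * ‖ψ (y + z)‖ with hT
  have hψc := ψ.continuous
  have hT_sq : T ^ 2 ≤ (∫ z, fR z) * ∫ x, fR x * ‖ψ (y + x)‖ ^ 2 := by
    obtain ⟨D, hD⟩ := ψ.exists_norm_le
    refine sq_integral_mul_le (osc_nonneg hfR) hfR_int ?_ (ψ.integrable_mul_normSq hfR_int y)
    exact hfR_int.mul_bdd (c := D)
      (by fun_prop : Continuous fun x => ‖ψ (y + x)‖).aestronglyMeasurable
      (ae_of_all _ fun x => by rw [norm_norm]; exact hD _)
  have hc0 : 0 < fourierConst := by unfold fourierConst; positivity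
  set G : R3 → ℝ := fun x =>
    (Metric.ball (0 : R3) R).indicator Φ x + 1 / 2 * (v x * ‖ψ (y + x)‖ ^ 2) with hG
  have hGi : Integrable G := (hΦi.indicator measurableSet_ball).add (hvi.const_mul _)
  have key := integral_radial_weight_mul_le (G := G)
    (P := fun x => (1 - ε) * a * ‖ψ (y + x)‖ ^ 2) hU_nonneg hU_radial hU_int hGi
    (((ψ.integrable_mul_normSq hUi y).const_mul ((1 - ε) * a)).congr
      (ae_of_all _ fun x => by ring))
    (a / ε * (fourierConst * (2 * T)) ^ 2) ?_
  · have e1 : ∫ x, U x * ((1 - ε) * a * ‖ψ (y + x)‖ ^ 2) =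
        (1 - ε) * a * ∫ x, U x * ‖ψ (y + x)‖ ^ 2 := by
      rw [← integral_const_mul]
      congr 1 with x
      ring
    have e2 : ∫ x, G x = (∫ x in Metric.ball 0 R, Φ x) +
        1 / 2 * ∫ x, v x * ‖ψ (y + x)‖ ^ 2 := by
      rw [hG, integral_add (hΦi.indicator measurableSet_ball) (hvi.const_mul _),
        integral_indicator measurableSet_ball, integral_const_mul]
    have e3 : 4 * π * (a / ε * (fourierConst * (2 * T)) ^ 2) = a / ε * (2 / π ^ 2 * T ^ 2) := by
      rw [mul_pow, fourierConst_sq]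
      field_simp
      ring
    rw [e1, e2, e3] at key
    refine key.trans (add_le_add_right ?_ _)
    gcongr
  · intro ω hω r hr hUr
    have hωn : ‖(ω : R3)‖ = 1 := by simp
    have hnorm : ∀ s : ℝ, 0 ≤ s → ‖s • (ω : R3)‖ = s := fun s hs => by
      rw [norm_smul, hωn, mul_one, Real.norm_of_nonneg hs]
    have hrR0 : R0 ≤ r := by
      by_contra hn
      exact hUr (hU_supp _ (Or.inl (by rw [hnorm r hr.le]; linarith)))
    have hrR : r ≤ R := by
      by_contra hn
      exact hUr (hU_supp _ (Or.inr (by rw [hnorm r hr.le]; linarith)))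
    have hcF := fun j => continuous_filteredPartial hh_int ψ j
    have hray := ray_inequality (f := sphericalMean φ) (d := sphericalMeanDeriv φ) hV_meas
      (fun s => hv_nonneg _) (fun s => hvC _) (continuous_sphericalMeanDeriv hφ_C1)
      (hasDerivAt_sphericalMean hφ_C1) (sphericalMean_nonneg hφ_nonneg)
      (sphericalMean_le_one hφ_C1.continuous hφ_le_one)
      (fun s hs => sq_mul_sphericalMeanDeriv_eq_integral hφ_C1 hvV hV_meas (fun s => hvC _)
        hφ_scatt hs) ha hr (sq_mul_sphericalMeanDeriv_eq hφ_C1 hR0 hφ_eq hrR0)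
      (g := fun s => ψ (y + s • (ω : R3)))
      (by fun_prop) (hasDerivAt_filtered_ray hh_int ψ y ω)
      (by fun_prop) (δ := fourierConst * (2 * T)) ?_ hε
    · refine hray.trans (add_le_add_left ?_ _)
      rw [intervalIntegral.integral_of_le hr.le, integral_Ioc_eq_integral_Ioo]
      have hGs : ∀ s : ℝ, 0 ≤ s ^ 2 • G (s • (ω : R3)) := fun s =>
        mul_nonneg (sq_nonneg s) (add_nonneg (Set.indicator_nonneg (fun x _ => hΦ0 x) _)
          (mul_nonneg (by norm_num) (mul_nonneg (hv_nonneg _) (sq_nonneg _))))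
      refine le_trans ?_ (setIntegral_mono_set hω (ae_of_all _ hGs)
        (Set.Ioo_subset_Ioi_self : Set.Ioo 0 r ⊆ Set.Ioi (0 : ℝ)).eventuallyLE)
      refine integral_mono_of_nonneg (ae_of_all _ fun s => ?_)
        (hω.mono_set Set.Ioo_subset_Ioi_self) ?_
      · have := hv_nonneg (EuclideanSpace.single 0 s)
        have : 0 ≤ V s := this
        positivity
      · filter_upwards [ae_restrict_mem measurableSet_Ioo] with s hs
        have hmem : s • (ω : R3) ∈ Metric.ball (0 : R3) R := by
          rw [mem_ball_zero_iff, hnorm s hs.1.le]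
          exact hs.2.trans_le hrR
        simp only [hG, Set.indicator_of_mem hmem, smul_eq_mul, hvV, hnorm s hs.1.le]
        have := mul_le_mul_of_nonneg_left
          (normSq_sum_mul_le ω fun j => filteredPartial h ψ j (y + s • (ω : R3))) (sq_nonneg s)
        linarith
    · intro s hs hsr
      have b1 := norm_correlation_sub_le hh_int hh_bdd hfR hfR_int ψ y (x := r • (ω : R3))
        (by rw [hnorm r hr.le]; exact hrR)
      have b2 := norm_correlation_sub_le hh_int hh_bdd hfR hfR_int ψ y (x := s • (ω : R3))
        (by rw [hnorm s hs]; exact hsr.trans hrR)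
      have b3 : ∀ p q c c' k k' : ℂ, (p - k * c - (q - k * c')) - (p - q) =
          -(k * ((c - k') - (c' - k'))) := fun p q c c' k k' => by ring
      rw [b3 _ _ _ _ _ (correlation h ψ y), norm_neg, norm_mul, Complex.norm_real,
        Real.norm_of_nonneg hc0.le]
      refine mul_le_mul_of_nonneg_left ((norm_sub_le _ _).trans ?_) hc0.le
      linarith

/-- Integrals over disjoint balls add up to at most the whole integral. -/
lemma sum_setIntegral_ball_le {ι : Type*} [Fintype ι] {Φ : R3 → ℝ} (hΦ0 : ∀ x, 0 ≤ Φ x)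
    (hΦ : Integrable Φ) {y : ι → R3} (hy : ∀ i j, i ≠ j → 2 * R ≤ ‖y i - y j‖) :
    ∑ i, ∫ x in Metric.ball (y i) R, Φ x ≤ ∫ x, Φ x := by
  rw [← integral_iUnion_fintype (fun i => measurableSet_ball) ?_ fun i => hΦ.integrableOn]
  · exact setIntegral_le_integral hΦ (ae_of_all _ hΦ0)
  · intro i j hij
    refine Metric.ball_disjoint_ball ?_
    rw [dist_eq_norm]
    linarith [hy i j hij]

lemma setIntegral_ball_add_left (Φ : R3 → ℝ) (y : R3) (R : ℝ) :
    ∫ x in Metric.ball 0 R, Φ (y + x) = ∫ x in Metric.ball y R, Φ x := by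
  have h := (measurePreserving_add_left volume y).setIntegral_preimage_emb
    (measurableEmbedding_addLeft y) Φ (Metric.ball y R)
  rw [← h]
  congr 2
  ext x
  simp [Metric.mem_ball, dist_eq_norm]

end Center

theorem generalized_dyson_lemma_multi_centered
    (v φ : R3 → ℝ) (R0 a : ℝ) (hR0 : 0 < R0)
    (hv_meas : Measurable v)
    (hv_nonneg : ∀ x, 0 ≤ v x)
    (hv_bdd : ∃ C, ∀ x, v x ≤ C)
    (hv_radial : ∀ x y : R3, ‖x‖ = ‖y‖ → v x = v y)
    (hv_supp : ∀ x : R3, R0 ≤ ‖x‖ → v x = 0)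
    (hφ_C1 : ContDiff ℝ 1 φ)
    (hφ_nonneg : ∀ x, 0 ≤ φ x)
    (hφ_le_one : ∀ x, φ x ≤ 1)
    (hφ_eq : ∀ x : R3, R0 ≤ ‖x‖ → φ x = 1 - a / ‖x‖)
    (hφ_scatt : ∀ g : R3 → ℝ, ContDiff ℝ (⊤ : ℕ∞) g → HasCompactSupport g →
      (∫ x : R3, ⟪gradient φ x, gradient g x⟫) + (1/2) * ∫ x : R3, v x * φ x * g x = 0)
    (R : ℝ) (hR : R0 < R)
    -- the radial cutoff function χ and `h = \widehat{1-χ}`: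
    (χ : R3 → ℝ)
    (hχ_meas : Measurable χ)
    (hχ_nonneg : ∀ p, 0 ≤ χ p)
    (hχ_le_one : ∀ p, χ p ≤ 1)
    (hχ_radial : ∀ p p' : R3, ‖p‖ = ‖p'‖ → χ p = χ p')
    (hχ_int : Integrable (fun p : R3 => 1 - χ p))
    (h : R3 → ℂ)
    (hh : ∀ x, h x = ft (fun p => 1 - (χ p : ℂ)) x)
    (hh_bdd : ∃ C, ∀ x, ‖h x‖ ≤ C)
    (hh_int : Integrable h)
    -- `f_R` and its integrability:
    (fR : R3 → ℝ)
    (hfR : ∀ x : R3, fR x = ⨆ y ∈ Metric.closedBall (0 : R3) R, ‖h (x - y) - h x‖)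
    (hfR_int : Integrable fR)
    -- the soft potential U:
    (U : R3 → ℝ)
    (hU_meas : Measurable U)
    (hU_nonneg : ∀ x, 0 ≤ U x)
    (hU_radial : ∀ x y : R3, ‖x‖ = ‖y‖ → U x = U y)
    (hU_supp : ∀ x : R3, ‖x‖ < R0 ∨ R < ‖x‖ → U x = 0)
    (hU_int : (∫ x : R3, U x) = 4 * π)
    -- the scattering centers, at mutual distance at least 2R:
    (M : ℕ) (y : Fin M → R3)
    (hy : ∀ i j : Fin M, i ≠ j → 2 * R ≤ ‖y i - y j‖)
    (ε : ℝ) (hε : 0 < ε)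
    (ψ : SchwartzMap R3 ℂ) :
    (∑ i : Fin M, ∫ x : R3,
        ((1 - ε) * a * U (x - y i)
          - (a / ε) * ((2 / π ^ 2) * fR (x - y i) * ∫ z : R3, fR z)) * ‖ψ x‖ ^ 2) ≤
      (∫ x : R3, ∑ j : Fin 3,
          ‖ift (fun p => (χ p : ℂ) * (Complex.I * (p j : ℂ)) * ft (fun z => ψ z) p) x‖ ^ 2)
        + (1/2) * ∑ i : Fin M, ∫ x : R3, v (x - y i) * ‖ψ x‖ ^ 2 := by
  have hterm : ∀ i : Fin M, (∫ x : R3,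
        ((1 - ε) * a * U (x - y i)
          - (a / ε) * ((2 / π ^ 2) * fR (x - y i) * ∫ z : R3, fR z)) * ‖ψ x‖ ^ 2) ≤
      (∫ x in Metric.ball (y i) R, ∑ j, ‖filteredPartial h ψ j x‖ ^ 2) +
        1 / 2 * ∫ x, v (x - y i) * ‖ψ x‖ ^ 2 := by
    intro i
    have key := dyson_one_center hR0 hv_meas hv_nonneg hv_bdd hv_radial hφ_C1 hφ_nonneg hφ_le_one
      hφ_eq hφ_scatt hh_bdd hh_int hfR hfR_int hU_nonneg hU_radial hU_supp hU_int hε ψ (y i)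
    have hUi : Integrable U := by
      by_contra hn
      rw [integral_undef hn] at hU_int
      have := Real.pi_pos
      linarith
    rw [setIntegral_ball_add_left fun x => ∑ j, ‖filteredPartial h ψ j x‖ ^ 2] at key
    rw [← integral_add_left_eq_self (fun x => v (x - y i) * ‖ψ x‖ ^ 2) (y i),
      ← integral_add_left_eq_self (fun x => ((1 - ε) * a * U (x - y i)
          - (a / ε) * ((2 / π ^ 2) * fR (x - y i) * ∫ z : R3, fR z)) * ‖ψ x‖ ^ 2) (y i)]
    simp only [add_sub_cancel_left]
    have hsplit : ∫ x, ((1 - ε) * a * U x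
          - (a / ε) * ((2 / π ^ 2) * fR x * ∫ z : R3, fR z)) * ‖ψ (y i + x)‖ ^ 2 =
        (1 - ε) * a * (∫ x, U x * ‖ψ (y i + x)‖ ^ 2) -
          a / ε * ((2 / π ^ 2) * ((∫ z, fR z) * ∫ x, fR x * ‖ψ (y i + x)‖ ^ 2)) := by
      rw [← mul_assoc (2 / π ^ 2), ← mul_assoc (a / ε), ← integral_const_mul,
        ← integral_const_mul, ← integral_sub ((ψ.integrable_mul_normSq hUi _).const_mul _)
          ((ψ.integrable_mul_normSq hfR_int _).const_mul _)]
      congr 1 with x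
      ring
    rw [hsplit]
    linarith
  simp only [ift_cutoff_eq_filteredPartial hχ_int hχ_nonneg hχ_le_one hh]
  refine (Finset.sum_le_sum fun i _ => hterm i).trans ?_
  rw [Finset.sum_add_distrib, ← Finset.mul_sum]
  refine add_le_add_left (sum_setIntegral_ball_le (fun x => ?_) ?_ hy) _
  · exact Finset.sum_nonneg fun j _ => sq_nonneg _
  · exact integrable_finsetSum _ fun j _ => integrable_normSq_filteredPartial hh_int ψ j
end
end

section
/- Nearest-neighbor counting lemma: There is a universal constant C > 0 with the following property. For every N ∈ ℕ, every R > 0, and every antisymmetric function Ψ ∈ H¹((ℝ³)ᴺ) with ‖Ψ‖_{L²} = 1 (antisymmetric means Ψ changes sign under exchange of any two of its N variables y_i ∈ ℝ³), one has ∫_{(ℝ³)ᴺ} I_R(Y) |Ψ(Y)|² dY ≤ C R² Σ_{i=1}ᴺ ∫_{(ℝ³)ᴺ} |∇_{y_i} Ψ(Y)|² dY, where for Y = (y₁,…,y_N) the quantity I_R(Y) denotes the number of indices i ∈ {1,…,N} such that there exists j ≠ i with |y_i − y_j| < 2R. -/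
/-!
STATEMENT 9: Nearest-neighbor counting lemma.
There is a universal constant `C > 0` such that for every `N`, every `R > 0`
and every normalized antisymmetric `Ψ ∈ H¹((ℝ³)ᴺ)` (formalized on the dense
subclass of smooth compactly supported functions),
`∫ I_R(Y) |Ψ(Y)|² dY ≤ C R² ∑_i ∫ |∇_{y_i} Ψ|² dY`,
where `I_R(Y)` is the number of points `y_i` at distance less than `2R` from
some other point `y_j`.
-/

open MeasureTheory Real
open scoped Classical

noncomputable section

/-- `|∇f|²(x) = ∑_j |∂_j f(x)|²` for a complex-valued function on ℝ³. -/
def gradSq (f : R3 → ℂ) (x : R3) : ℝ :=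
  ∑ j : Fin 3, ‖fderiv ℝ f x (EuclideanSpace.single j 1)‖ ^ 2

/-- `I_R(Y)`: the number of indices `i` such that some other point `y_j`
is within distance `2R` of `y_i`. -/
def IR (N : ℕ) (R : ℝ) (Y : Fin N → R3) : ℕ :=
  (Finset.univ.filter fun i : Fin N => ∃ j : Fin N, j ≠ i ∧ ‖Y i - Y j‖ < 2 * R).card

theorem lintegral_comp_smul_add_const {c : ℝ} (hc : c ≠ 0) (b : R3) {F : R3 → ENNReal}
    (hF : Measurable F) :
    ∫⁻ x, F (c • x + b) = ENNReal.ofReal |(c ^ 3)⁻¹| * ∫⁻ x, F x := by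
  have h1 : ∫⁻ x, F (c • x + b) = ∫⁻ y, F (y + b) ∂(Measure.map (c • ·) (volume : Measure R3)) := by
    rw [lintegral_map (by fun_prop) (by fun_prop)]
  rw [h1, Measure.map_addHaar_smul volume hc, lintegral_smul_measure, smul_eq_mul,
    lintegral_add_right_eq_self F b]
  simp

theorem sq_norm_intervalIntegral_le {u : ℝ → ℂ} (hu : Continuous u) :
    ‖∫ t in (0 : ℝ)..(1 / 2), u t‖ ^ 2 ≤ ∫ t in (0 : ℝ)..(1 / 2), ‖u t‖ ^ 2 := by
  have h1 : ‖∫ t in (0 : ℝ)..(1 / 2), u t‖ ≤ ∫ t in (0 : ℝ)..(1 / 2), ‖u t‖ :=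
    intervalIntegral.norm_integral_le_integral_norm (by norm_num)
  set S := ∫ t in (0 : ℝ)..(1 / 2), ‖u t‖ with hS
  have h2 : 0 ≤ ∫ t in (0 : ℝ)..(1 / 2), (‖u t‖ - 2 * S) ^ 2 :=
    intervalIntegral.integral_nonneg (by norm_num) fun t _ => sq_nonneg _
  have h3 : ∫ t in (0 : ℝ)..(1 / 2), (‖u t‖ - 2 * S) ^ 2 =
      (∫ t in (0 : ℝ)..(1 / 2), ‖u t‖ ^ 2) - 4 * S * S + 2 * S ^ 2 := by
    have : ∀ t, (‖u t‖ - 2 * S) ^ 2 = ‖u t‖ ^ 2 - 4 * S * ‖u t‖ + 4 * S ^ 2 := fun t => by ring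
    simp_rw [this]
    rw [intervalIntegral.integral_add, intervalIntegral.integral_sub,
      intervalIntegral.integral_const_mul, intervalIntegral.integral_const, ← hS]
    · simp only [smul_eq_mul]; ring
    all_goals exact Continuous.intervalIntegrable (by fun_prop) _ _
  have h4 := norm_nonneg (∫ t in (0 : ℝ)..(1 / 2), u t)
  nlinarith

theorem enorm_sub_midpoint_sq_le {g : R3 → ℂ} (hg : ContDiff ℝ 1 g) (x z : R3) :
    ‖g x - g (midpoint ℝ x z)‖ₑ ^ 2 ≤
      ‖z - x‖ₑ ^ 2 * ∫⁻ t in Set.Ioc (0 : ℝ) (1 / 2), ‖fderiv ℝ g (x + t • (z - x))‖ₑ ^ 2 := by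
  have hc : Continuous fun t : ℝ => fderiv ℝ g (x + t • (z - x)) :=
    (hg.continuous_fderiv one_ne_zero).comp (by fun_prop)
  have hc' : Continuous fun t : ℝ => fderiv ℝ g (x + t • (z - x)) (z - x) :=
    hc.clm_apply continuous_const
  have hd : ∀ t : ℝ, HasDerivAt (fun t : ℝ => g (x + t • (z - x)))
      (fderiv ℝ g (x + t • (z - x)) (z - x)) t := fun t => by
    have h1 : HasDerivAt (fun t : ℝ => x + t • (z - x)) (z - x) t := by
      simpa using ((hasDerivAt_id t).smul_const (z - x)).const_add x
    exact ((hg.differentiable one_ne_zero _).hasFDerivAt).comp_hasDerivAt t h1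
  have hF := intervalIntegral.integral_eq_sub_of_hasDerivAt (a := 0) (b := 1 / 2)
    (fun t _ => hd t) (hc'.intervalIntegrable _ _)
  have hm : x + (1 / 2 : ℝ) • (z - x) = midpoint ℝ x z := by
    rw [midpoint_eq_smul_add, invOf_eq_inv]
    module
  have h0 : ‖g x - g (midpoint ℝ x z)‖ ^ 2 ≤
      ∫ t in (0 : ℝ)..(1 / 2), ‖z - x‖ ^ 2 * ‖fderiv ℝ g (x + t • (z - x))‖ ^ 2 := by
    rw [norm_sub_rev, ← hm]
    rw [zero_smul, add_zero] at hF
    rw [← hF]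
    refine (sq_norm_intervalIntegral_le hc').trans ?_
    refine intervalIntegral.integral_mono_on (by norm_num)
      (Continuous.intervalIntegrable (by fun_prop) _ _)
      (Continuous.intervalIntegrable (by fun_prop) _ _) fun t _ => ?_
    rw [← mul_pow, mul_comm]
    exact pow_le_pow_left₀ (norm_nonneg _) (ContinuousLinearMap.le_opNorm _ _) 2
  rw [intervalIntegral.integral_of_le (by norm_num)] at h0
  have h1 := ENNReal.ofReal_le_ofReal h0
  rw [ofReal_integral_eq_lintegral_ofReal] at h1
  · simp only [ENNReal.ofReal_mul (sq_nonneg _), ENNReal.ofReal_pow (norm_nonneg _),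
      ofReal_norm] at h1
    rwa [lintegral_const_mul'] at h1
    simp
  · refine (Continuous.integrableOn_Icc ?_).mono_set Set.Ioc_subset_Icc_self
    fun_prop
  · exact .of_forall fun t => by positivity

theorem midpoint_poincare {g : R3 → ℂ} (hg : ContDiff ℝ 1 g) {Q : Set R3} (hQ : Convex ℝ Q)
    (hQm : MeasurableSet Q) {D : ENNReal} (hD : ∀ x ∈ Q, ∀ z ∈ Q, ‖z - x‖ₑ ≤ D) :
    ∫⁻ x in Q, ∫⁻ z in Q, ‖g x - g (midpoint ℝ x z)‖ₑ ^ 2 ≤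
      4 * D ^ 2 * (volume Q * ∫⁻ x in Q, ‖fderiv ℝ g x‖ₑ ^ 2) := by
  have hfc : Continuous (fderiv ℝ g) := hg.continuous_fderiv one_ne_zero
  set h : R3 → ENNReal := fun x => ‖fderiv ℝ g x‖ₑ ^ 2
  have hhm : Measurable h := (by fun_prop : Continuous h).measurable
  calc ∫⁻ x in Q, ∫⁻ z in Q, ‖g x - g (midpoint ℝ x z)‖ₑ ^ 2
      ≤ ∫⁻ x in Q, ∫⁻ z in Q, D ^ 2 *
          ∫⁻ t in Set.Ioc (0 : ℝ) (1 / 2), h (x + t • (z - x)) := by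
        refine setLIntegral_mono' hQm fun x hx => setLIntegral_mono' hQm fun z hz => ?_
        refine (enorm_sub_midpoint_sq_le hg x z).trans ?_
        gcongr
        exact hD x hx z hz
    _ = D ^ 2 * ∫⁻ z in Q, ∫⁻ t in Set.Ioc (0 : ℝ) (1 / 2),
          ∫⁻ x in Q, h (x + t • (z - x)) := by
        have e1 : ∀ x, ∫⁻ z in Q, D ^ 2 *
            ∫⁻ t in Set.Ioc (0 : ℝ) (1 / 2), h (x + t • (z - x)) =
            D ^ 2 * ∫⁻ z in Q, ∫⁻ t in Set.Ioc (0 : ℝ) (1 / 2), h (x + t • (z - x)) := fun x =>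
          lintegral_const_mul _ (Measurable.lintegral_prod_right'
            (f := fun p : R3 × ℝ => h (x + p.2 • (p.1 - x))) (hhm.comp (by fun_prop)))
        simp_rw [e1]
        have m1 : Measurable (Function.uncurry fun x z : R3 =>
            ∫⁻ t in Set.Ioc (0 : ℝ) (1 / 2), h (x + t • (z - x))) :=
          Measurable.lintegral_prod_right'
            (f := fun p : (R3 × R3) × ℝ => h (p.1.1 + p.2 • (p.1.2 - p.1.1)))
            (hhm.comp (by fun_prop))
        have m2 : Measurable fun x : R3 => ∫⁻ z in Q,
            ∫⁻ t in Set.Ioc (0 : ℝ) (1 / 2), h (x + t • (z - x)) := m1.lintegral_prod_right'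
        rw [lintegral_const_mul _ m2, lintegral_lintegral_swap m1.aemeasurable]
        congr 2 with z
        rw [lintegral_lintegral_swap]
        exact Measurable.aemeasurable (hhm.comp (by fun_prop))
    _ ≤ D ^ 2 * ∫⁻ z in Q, ∫⁻ t in Set.Ioc (0 : ℝ) (1 / 2), 8 * ∫⁻ x in Q, h x := by
        gcongr 1
        refine setLIntegral_mono' hQm fun z hz => setLIntegral_mono' measurableSet_Ioc
          fun t ht => ?_
        have ht' : 0 < 1 - t := by linarith [ht.2]
        have hI : Measurable (Q.indicator h) := hhm.indicator hQm
        calc ∫⁻ x in Q, h (x + t • (z - x))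
            ≤ ∫⁻ x, Q.indicator h ((1 - t) • x + t • z) := by
              rw [← lintegral_indicator hQm]
              refine lintegral_mono fun x => ?_
              by_cases hx : x ∈ Q
              · have e : x + t • (z - x) = (1 - t) • x + t • z := by module
                rw [Set.indicator_of_mem hx, e, Set.indicator_of_mem]
                exact hQ hx hz ht'.le ht.1.le (by ring)
              · simp [hx]
          _ = ENNReal.ofReal |((1 - t) ^ 3)⁻¹| * ∫⁻ x in Q, h x := by
              rw [lintegral_comp_smul_add_const ht'.ne' _ hI, lintegral_indicator hQm]
          _ ≤ 8 * ∫⁻ x in Q, h x := by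
              gcongr
              rw [abs_of_pos (by positivity)]
              have h8 : ((1 - t) ^ 3)⁻¹ ≤ 8 := by
                rw [inv_le_comm₀ (by positivity) (by norm_num)]
                have : (1 / 2 : ℝ) ^ 3 ≤ (1 - t) ^ 3 :=
                  pow_le_pow_left₀ (by norm_num) (by linarith [ht.2]) 3
                norm_num at this ⊢
                linarith
              simpa using ENNReal.ofReal_le_ofReal h8
    _ = 4 * D ^ 2 * (volume Q * ∫⁻ x in Q, h x) := by
        simp only [lintegral_const, MeasurableSet.univ, Measure.restrict_apply, Set.univ_inter,
          Real.volume_Ioc]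
        have e : ENNReal.ofReal (1 / 2 - 0) * 8 = 4 := by
          rw [← ENNReal.ofReal_ofNat 8, ← ENNReal.ofReal_mul (by norm_num)]
          norm_num
        calc _ = (ENNReal.ofReal (1 / 2 - 0) * 8) * D ^ 2 * (volume Q * ∫⁻ x in Q, h x) := by ring
          _ = _ := by rw [e]

theorem lintegral_lintegral_add_swap {α : Type*} [MeasurableSpace α] {μ : Measure α} [SFinite μ]
    {M : α → α → ENNReal} (hM : Measurable (Function.uncurry M)) :
    ∫⁻ x, ∫⁻ z, (2 * M x z + 2 * M z x) ∂μ ∂μ = 4 * ∫⁻ x, ∫⁻ z, M x z ∂μ ∂μ := by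
  have hM' : Measurable (Function.uncurry fun x z => M z x) :=
    hM.comp (measurable_snd.prodMk measurable_fst)
  have e1 : ∀ x, ∫⁻ z, (2 * M x z + 2 * M z x) ∂μ =
      2 * (∫⁻ z, M x z ∂μ) + 2 * ∫⁻ z, M z x ∂μ := fun x => by
    have a1 : Measurable fun z => M x z := hM.of_uncurry_left
    have a2 : Measurable fun z => M z x := hM.of_uncurry_right
    rw [lintegral_add_left (a1.const_mul 2), lintegral_const_mul _ a1,
      lintegral_const_mul _ a2]
  simp_rw [e1]
  have b1 : Measurable fun x => ∫⁻ z, M x z ∂μ := hM.lintegral_prod_right'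
  have b2 : Measurable fun x => ∫⁻ z, M z x ∂μ := hM'.lintegral_prod_right'
  rw [lintegral_add_left (b1.const_mul 2), lintegral_const_mul _ b1,
    lintegral_const_mul _ b2, lintegral_lintegral_swap hM'.aemeasurable]
  ring

theorem lintegral_triple_add {α : Type*} [MeasurableSpace α] {μ : Measure α} [SFinite μ]
    {A : α → α → α → ENNReal} (hA : Measurable fun p : α × α × α => A p.1 p.2.1 p.2.2) :
    ∫⁻ x, ∫⁻ y, ∫⁻ z, (A x z y + (A y x z + A z y x)) ∂μ ∂μ ∂μ =
      3 * ∫⁻ c, ∫⁻ a, ∫⁻ b, A a b c ∂μ ∂μ ∂μ := by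
  have mi : ∀ u : α → α → α → ENNReal, Measurable (fun p : (α × α) × α => u p.1.1 p.1.2 p.2) →
      Measurable (Function.uncurry fun x y => ∫⁻ z, u x y z ∂μ) := fun u hu =>
    Measurable.lintegral_prod_right' hu
  have m1 : Measurable fun p : (α × α) × α => A p.1.1 p.2 p.1.2 :=
    hA.comp (by fun_prop : Measurable fun p : (α × α) × α => (p.1.1, p.2, p.1.2))
  have m2 : Measurable fun p : (α × α) × α => A p.1.2 p.1.1 p.2 :=
    hA.comp (by fun_prop : Measurable fun p : (α × α) × α => (p.1.2, p.1.1, p.2))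
  have m3 : Measurable fun p : (α × α) × α => A p.2 p.1.2 p.1.1 :=
    hA.comp (by fun_prop : Measurable fun p : (α × α) × α => (p.2, p.1.2, p.1.1))
  have m4 : Measurable fun p : (α × α) × α => A p.2 p.1.1 p.1.2 :=
    hA.comp (by fun_prop : Measurable fun p : (α × α) × α => (p.2, p.1.1, p.1.2))
  have n1 := mi (fun x y z => A x z y) m1
  have n2 := mi (fun x y z => A y x z) m2
  have n4 := mi (fun x z y => A y x z) m4
  have pair : ∀ (u : (α × α) × α → ENNReal), Measurable u → ∀ x,
      Measurable fun p : α × α => u ((x, p.1), p.2) := fun u hu x =>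
    hu.comp (by fun_prop : Measurable fun p : α × α => ((x, p.1), p.2))
  have sing : ∀ (u : (α × α) × α → ENNReal), Measurable u → ∀ x y,
      Measurable fun z : α => u ((x, y), z) := fun u hu x y =>
    hu.comp (by fun_prop : Measurable fun z : α => ((x, y), z))
  have I1 : ∫⁻ x, ∫⁻ y, ∫⁻ z, A x z y ∂μ ∂μ ∂μ = ∫⁻ c, ∫⁻ a, ∫⁻ b, A a b c ∂μ ∂μ ∂μ :=
    lintegral_lintegral_swap n1.aemeasurable
  have I2 : ∫⁻ x, ∫⁻ y, ∫⁻ z, A y x z ∂μ ∂μ ∂μ = ∫⁻ c, ∫⁻ a, ∫⁻ b, A a b c ∂μ ∂μ ∂μ := by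
    have e1 : ∀ x, ∫⁻ y, ∫⁻ z, A y x z ∂μ ∂μ = ∫⁻ z, ∫⁻ y, A y x z ∂μ ∂μ := fun x =>
      lintegral_lintegral_swap (pair _ m2 x).aemeasurable
    simp_rw [e1]
    rw [lintegral_lintegral_swap n4.aemeasurable]
    refine lintegral_congr fun z => lintegral_lintegral_swap (Measurable.aemeasurable ?_)
    exact hA.comp (by fun_prop : Measurable fun p : α × α => (p.2, p.1, z))
  have I3 : ∫⁻ x, ∫⁻ y, ∫⁻ z, A z y x ∂μ ∂μ ∂μ = ∫⁻ c, ∫⁻ a, ∫⁻ b, A a b c ∂μ ∂μ ∂μ :=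
    lintegral_congr fun x => lintegral_lintegral_swap (pair _ m3 x).aemeasurable
  have e1 : ∀ x y, ∫⁻ z, (A x z y + (A y x z + A z y x)) ∂μ =
      (∫⁻ z, A x z y ∂μ) + ((∫⁻ z, A y x z ∂μ) + ∫⁻ z, A z y x ∂μ) := fun x y => by
    rw [lintegral_add_left (sing _ m1 x y), lintegral_add_left (sing _ m2 x y)]
  have e2 : ∀ x, ∫⁻ y, ((∫⁻ z, A x z y ∂μ) +
      ((∫⁻ z, A y x z ∂μ) + ∫⁻ z, A z y x ∂μ)) ∂μ =
      (∫⁻ y, ∫⁻ z, A x z y ∂μ ∂μ) +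
      ((∫⁻ y, ∫⁻ z, A y x z ∂μ ∂μ) + ∫⁻ y, ∫⁻ z, A z y x ∂μ ∂μ) := fun x => by
    rw [lintegral_add_left n1.of_uncurry_left, lintegral_add_left n2.of_uncurry_left]
  simp_rw [e1, e2]
  have b1 : Measurable fun x => ∫⁻ y, ∫⁻ z, A x z y ∂μ ∂μ := n1.lintegral_prod_right'
  have b2 : Measurable fun x => ∫⁻ y, ∫⁻ z, A y x z ∂μ ∂μ := n2.lintegral_prod_right'
  rw [lintegral_add_left b1, lintegral_add_left b2, I1, I2, I3]
  ring

theorem two_point_poincare {g : R3 → ℂ} (hg : ContDiff ℝ 1 g) {Q : Set R3} (hQ : Convex ℝ Q)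
    (hQm : MeasurableSet Q) {D : ENNReal} (hD : ∀ x ∈ Q, ∀ z ∈ Q, ‖z - x‖ₑ ≤ D) :
    ∫⁻ x in Q, ∫⁻ z in Q, ‖g x - g z‖ₑ ^ 2 ≤
      16 * D ^ 2 * (volume Q * ∫⁻ x in Q, ‖fderiv ℝ g x‖ₑ ^ 2) := by
  have hgc := hg.continuous
  have hmid : Continuous fun p : R3 × R3 => midpoint ℝ p.1 p.2 := by
    simp only [midpoint_eq_smul_add]; fun_prop
  have hMc : Continuous fun p : R3 × R3 => ‖g p.1 - g (midpoint ℝ p.1 p.2)‖ₑ ^ 2 := by fun_prop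
  have hMm : Measurable fun p : R3 × R3 => ‖g p.1 - g (midpoint ℝ p.1 p.2)‖ₑ ^ 2 := hMc.measurable
  calc ∫⁻ x in Q, ∫⁻ z in Q, ‖g x - g z‖ₑ ^ 2
      ≤ ∫⁻ x in Q, ∫⁻ z in Q, (2 * ‖g x - g (midpoint ℝ x z)‖ₑ ^ 2 +
        2 * ‖g z - g (midpoint ℝ z x)‖ₑ ^ 2) := by
        refine lintegral_mono fun x => lintegral_mono fun z => ?_
        have h1 : g x - g z = (g x - g (midpoint ℝ x z)) + (g (midpoint ℝ x z) - g z) := by ring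
        have h2 : ‖g x - g z‖ ^ 2 ≤ 2 * ‖g x - g (midpoint ℝ x z)‖ ^ 2 +
            2 * ‖g z - g (midpoint ℝ z x)‖ ^ 2 := by
          have h3 := norm_add_le (g x - g (midpoint ℝ x z)) (g (midpoint ℝ x z) - g z)
          rw [← h1, norm_sub_rev (g (midpoint ℝ x z)), midpoint_comm (R := ℝ) x z] at h3
          rw [midpoint_comm (R := ℝ) x z]
          have h4 := norm_nonneg (g x - g z)
          nlinarith [sq_nonneg (‖g x - g (midpoint ℝ z x)‖ - ‖g z - g (midpoint ℝ z x)‖)]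
        have h5 := ENNReal.ofReal_le_ofReal h2
        rw [ENNReal.ofReal_add (by positivity) (by positivity)] at h5
        simpa only [ENNReal.ofReal_mul zero_le_two, ENNReal.ofReal_pow (norm_nonneg _),
          ofReal_norm, ENNReal.ofReal_ofNat] using h5
    _ = 4 * ∫⁻ x in Q, ∫⁻ z in Q, ‖g x - g (midpoint ℝ x z)‖ₑ ^ 2 :=
        lintegral_lintegral_add_swap (M := fun x z => ‖g x - g (midpoint ℝ x z)‖ₑ ^ 2) hMm
    _ ≤ 4 * (4 * D ^ 2 * (volume Q * ∫⁻ x in Q, ‖fderiv ℝ g x‖ₑ ^ 2)) := by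
        gcongr
        exact midpoint_poincare hg hQ hQm hD
    _ = _ := by ring

theorem antisymm_pair_poincare {f : R3 → R3 → ℂ} (hf : Continuous (Function.uncurry f))
    (hfd : ∀ y, ContDiff ℝ 1 fun x => f x y) (hanti : ∀ x y, f x y = -f y x)
    (hfm : Measurable fun p : R3 × R3 => ‖fderiv ℝ (fun x => f x p.2) p.1‖ₑ ^ 2)
    {Q : Set R3} (hQ : Convex ℝ Q) (hQm : MeasurableSet Q) (hQ0 : volume Q ≠ 0)
    (hQt : volume Q ≠ ⊤) {D : ENNReal} (hD : ∀ x ∈ Q, ∀ z ∈ Q, ‖z - x‖ₑ ≤ D) :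
    ∫⁻ x in Q, ∫⁻ y in Q, ‖f x y‖ₑ ^ 2 ≤
      36 * D ^ 2 * ∫⁻ x in Q, ∫⁻ y in Q, ‖fderiv ℝ (fun x => f x y) x‖ₑ ^ 2 := by
  set A : R3 → R3 → R3 → ENNReal := fun a b c => ‖f a c - f b c‖ₑ ^ 2
  have hAm : Measurable fun p : R3 × R3 × R3 => A p.1 p.2.1 p.2.2 := by
    have h1 : Continuous fun p : R3 × R3 × R3 => f p.1 p.2.2 :=
      hf.comp (by fun_prop : Continuous fun p : R3 × R3 × R3 => (p.1, p.2.2))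
    have h2 : Continuous fun p : R3 × R3 × R3 => f p.2.1 p.2.2 :=
      hf.comp (by fun_prop : Continuous fun p : R3 × R3 × R3 => (p.2.1, p.2.2))
    have h3 : Continuous fun p : R3 × R3 × R3 => ‖f p.1 p.2.2 - f p.2.1 p.2.2‖ₑ ^ 2 := by fun_prop
    exact h3.measurable
  set G := ∫⁻ x in Q, ∫⁻ y in Q, ‖fderiv ℝ (fun x => f x y) x‖ₑ ^ 2 with hG
  set I := ∫⁻ c in Q, ∫⁻ a in Q, ∫⁻ b in Q, A a b c with hI
  have hIG : I ≤ 16 * D ^ 2 * (volume Q * G) := by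
    have e : G = ∫⁻ y in Q, ∫⁻ x in Q, ‖fderiv ℝ (fun x => f x y) x‖ₑ ^ 2 :=
      lintegral_lintegral_swap hfm.aemeasurable
    have m : Measurable fun y => ∫⁻ x in Q, ‖fderiv ℝ (fun x => f x y) x‖ₑ ^ 2 :=
      Measurable.lintegral_prod_left' hfm
    rw [e, ← lintegral_const_mul _ m, ← lintegral_const_mul _ (m.const_mul _)]
    exact lintegral_mono fun y => two_point_poincare (hfd y) hQ hQm hD
  have hpt : ∀ x y z, 4 * ‖f x y‖ₑ ^ 2 ≤ 3 * (A x z y + (A y x z + A z y x)) := by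
    intro x y z
    have h1 : 2 * f x y = (f x y - f z y) - (f y z - f x z) + (f z x - f y x) := by
      rw [hanti z y, hanti z x, hanti y x]; ring
    have h2 : 2 * ‖f x y‖ ≤ ‖f x y - f z y‖ + ‖f y z - f x z‖ + ‖f z x - f y x‖ := by
      calc 2 * ‖f x y‖ = ‖2 * f x y‖ := by simp
        _ ≤ _ := by
          rw [h1]
          refine (norm_add_le _ _).trans ?_
          gcongr
          exact norm_sub_le _ _
    have h3 : 4 * ‖f x y‖ ^ 2 ≤
        3 * (‖f x y - f z y‖ ^ 2 + (‖f y z - f x z‖ ^ 2 + ‖f z x - f y x‖ ^ 2)) := by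
      generalize ‖f x y - f z y‖ = p at *
      generalize ‖f y z - f x z‖ = q at *
      generalize ‖f z x - f y x‖ = r at *
      have := norm_nonneg (f x y)
      nlinarith [sq_nonneg (p - q), sq_nonneg (q - r), sq_nonneg (p - r)]
    have h5 := ENNReal.ofReal_le_ofReal h3
    rw [ENNReal.ofReal_mul (by norm_num), ENNReal.ofReal_mul (by norm_num),
      ENNReal.ofReal_add (by positivity) (by positivity),
      ENNReal.ofReal_add (by positivity) (by positivity)] at h5
    simpa only [ENNReal.ofReal_pow (norm_nonneg _), ofReal_norm, ENNReal.ofReal_ofNat] using h5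
  have hL : 4 * ∫⁻ x in Q, ∫⁻ y in Q, volume Q * ‖f x y‖ₑ ^ 2 ≤ 9 * I := by
    calc 4 * ∫⁻ x in Q, ∫⁻ y in Q, volume Q * ‖f x y‖ₑ ^ 2
        = ∫⁻ x in Q, ∫⁻ y in Q, ∫⁻ z in Q, 4 * ‖f x y‖ₑ ^ 2 := by
          simp only [lintegral_const, MeasurableSet.univ, Measure.restrict_apply, Set.univ_inter]
          have e : ∀ x y, 4 * ‖f x y‖ₑ ^ 2 * volume Q = 4 * (volume Q * ‖f x y‖ₑ ^ 2) :=
            fun x y => by ring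
          simp_rw [e]
          simp_rw [lintegral_const_mul' 4 _ ENNReal.ofNat_ne_top]
      _ ≤ ∫⁻ x in Q, ∫⁻ y in Q, ∫⁻ z in Q, 3 * (A x z y + (A y x z + A z y x)) :=
          lintegral_mono fun x => lintegral_mono fun y => lintegral_mono fun z => hpt x y z
      _ = 3 * (3 * I) := by
          simp_rw [lintegral_const_mul' 3 _ ENNReal.ofNat_ne_top]
          rw [lintegral_triple_add hAm]
      _ = 9 * I := by ring
  simp_rw [lintegral_const_mul' _ _ hQt] at hL
  have h6 : 4 * volume Q * ∫⁻ x in Q, ∫⁻ y in Q, ‖f x y‖ₑ ^ 2 ≤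
      4 * volume Q * (36 * D ^ 2 * G) := by
    calc _ = 4 * (volume Q * ∫⁻ x in Q, ∫⁻ y in Q, ‖f x y‖ₑ ^ 2) := by ring
      _ ≤ 9 * I := hL
      _ ≤ 9 * (16 * D ^ 2 * (volume Q * G)) := by gcongr
      _ = _ := by ring
  exact (ENNReal.mul_le_mul_iff_right (by simp [hQ0]) (ENNReal.mul_ne_top (by simp) hQt)).1 h6

/-- The derivative of `Ψ` in its `i`-th variable. -/
def partialFDeriv {N : ℕ} (Ψ : (Fin N → R3) → ℂ) (i : Fin N) (Y : Fin N → R3) : R3 →L[ℝ] ℂ :=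
  fderiv ℝ (fun z => Ψ (Function.update Y i z)) (Y i)

theorem partialFDeriv_eq {N : ℕ} {Ψ : (Fin N → R3) → ℂ} (hΨ : ContDiff ℝ 1 Ψ) (i : Fin N)
    (Y : Fin N → R3) :
    partialFDeriv Ψ i Y =
      (fderiv ℝ Ψ Y).comp (ContinuousLinearMap.pi (Pi.single i (ContinuousLinearMap.id ℝ R3))) := by
  have h1 : HasFDerivAt Ψ (fderiv ℝ Ψ Y) (Function.update Y i (Y i)) := by
    rw [Function.update_eq_self]
    exact (hΨ.differentiable one_ne_zero Y).hasFDerivAt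
  exact (h1.comp (Y i) (hasFDerivAt_update Y (Y i))).fderiv

theorem continuous_partialFDeriv {N : ℕ} {Ψ : (Fin N → R3) → ℂ} (hΨ : ContDiff ℝ 1 Ψ)
    (i : Fin N) : Continuous (partialFDeriv Ψ i) := by
  rw [funext (partialFDeriv_eq hΨ i)]
  exact (hΨ.continuous_fderiv one_ne_zero).clm_comp continuous_const

theorem enorm_fderiv_sq_le_gradSq (g : R3 → ℂ) (x : R3) :
    ‖fderiv ℝ g x‖ₑ ^ 2 ≤ ENNReal.ofReal (gradSq g x) := by
  have h0 : 0 ≤ gradSq g x := Finset.sum_nonneg fun _ _ => sq_nonneg _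
  have h1 : ‖fderiv ℝ g x‖ ≤ √(gradSq g x) := by
    refine ContinuousLinearMap.opNorm_le_bound _ (Real.sqrt_nonneg _) fun v => ?_
    have hv : v = ∑ k : Fin 3, v k • EuclideanSpace.single k (1 : ℝ) := by
      ext l
      simp [Finset.sum_apply, Pi.single_apply]
    calc ‖fderiv ℝ g x v‖ = ‖∑ k : Fin 3, v k • fderiv ℝ g x (EuclideanSpace.single k (1 : ℝ))‖ := by
          conv_lhs => rw [hv]
          simp only [map_sum, map_smul]
      _ ≤ ∑ k : Fin 3, ‖fderiv ℝ g x (EuclideanSpace.single k (1 : ℝ))‖ * ‖v k‖ := by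
          refine (norm_sum_le _ _).trans (Finset.sum_le_sum fun k _ => ?_)
          rw [norm_smul, mul_comm]
      _ ≤ √(∑ k : Fin 3, ‖fderiv ℝ g x (EuclideanSpace.single k (1 : ℝ))‖ ^ 2) *
            √(∑ k : Fin 3, ‖v k‖ ^ 2) := Real.sum_mul_le_sqrt_mul_sqrt _ _ _
      _ = √(gradSq g x) * ‖v‖ := by rw [EuclideanSpace.norm_eq v, gradSq]
  have h2 : ‖fderiv ℝ g x‖ ^ 2 ≤ gradSq g x := by
    rw [← Real.sq_sqrt h0]
    exact pow_le_pow_left₀ (norm_nonneg _) h1 2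
  simpa only [ENNReal.ofReal_pow (norm_nonneg _), ofReal_norm] using ENNReal.ofReal_le_ofReal h2

theorem antisymm_fiber_poincare {N : ℕ} {Ψ : (Fin N → R3) → ℂ} (hΨ : ContDiff ℝ 1 Ψ)
    {i j : Fin N} (hij : i ≠ j) (hanti : ∀ Y, Ψ (Y ∘ Equiv.swap i j) = -Ψ Y)
    {Q : Set R3} (hQ : Convex ℝ Q) (hQm : MeasurableSet Q) (hQ0 : volume Q ≠ 0)
    (hQt : volume Q ≠ ⊤) {D : ENNReal} (hD : ∀ x ∈ Q, ∀ z ∈ Q, ‖z - x‖ₑ ≤ D)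
    (Y : Fin N → R3) :
    ∫⁻ x in Q, ∫⁻ y in Q, ‖Ψ (Function.update (Function.update Y i x) j y)‖ₑ ^ 2 ≤
      36 * D ^ 2 * ∫⁻ x in Q, ∫⁻ y in Q,
        ‖partialFDeriv Ψ i (Function.update (Function.update Y i x) j y)‖ₑ ^ 2 := by
  have hu : Continuous fun p : R3 × R3 => Function.update (Function.update Y i p.1) j p.2 := by
    fun_prop
  have hder : ∀ x y, fderiv ℝ (fun z => Ψ (Function.update (Function.update Y i z) j y)) x =
      partialFDeriv Ψ i (Function.update (Function.update Y i x) j y) := fun x y => by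
    simp only [partialFDeriv, Function.update_of_ne hij,
      Function.update_self, Function.update_comm hij, Function.update_idem]
  simp_rw [← hder]
  refine antisymm_pair_poincare (f := fun x y => Ψ (Function.update (Function.update Y i x) j y))
    (hΨ.continuous.comp hu) ?_ ?_ ?_ hQ hQm hQ0 hQt hD
  · intro y
    simp_rw [Function.update_comm hij]
    exact hΨ.comp (contDiff_update 1 _ i)
  · intro x y
    rw [eq_neg_iff_add_eq_zero, ← eq_neg_iff_add_eq_zero, ← hanti]
    congr 1
    funext k
    simp only [Function.comp_apply]
    rcases eq_or_ne k i with rfl | hki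
    · simp [hij]
    rcases eq_or_ne k j with rfl | hkj
    · simp [hij]
    · simp [Equiv.swap_apply_of_ne_of_ne hki hkj, hki, hkj]
  · simp_rw [hder]
    have h1 := (continuous_partialFDeriv hΨ i).comp hu
    have h2 : Continuous fun p : R3 × R3 =>
      ‖partialFDeriv Ψ i (Function.update (Function.update Y i p.1) j p.2)‖ₑ ^ 2 :=
      (ENNReal.continuous_pow 2).comp h1.enorm
    exact h2.measurable

theorem lintegral_lintegral_const_mul {α : Type*} [MeasurableSpace α] {μ : Measure α} [SFinite μ]
    {c : ENNReal} {u : α → α → ENNReal} (hu : Measurable fun p : α × α => u p.1 p.2) :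
    ∫⁻ x, ∫⁻ y, c * u x y ∂μ ∂μ = c * ∫⁻ x, ∫⁻ y, u x y ∂μ ∂μ := by
  have e1 : ∀ x, ∫⁻ y, c * u x y ∂μ = c * ∫⁻ y, u x y ∂μ := fun x =>
    lintegral_const_mul _ (hu.comp (measurable_const.prodMk measurable_id))
  simp_rw [e1]
  exact lintegral_const_mul _ (Measurable.lintegral_prod_right' hu)

theorem lintegral_pair_cell_indicator {N : ℕ} {i j : Fin N} (hij : i ≠ j) {Q : Set R3}
    (hQm : MeasurableSet Q) {B : Set (Fin N → R3)} (Y : Fin N → R3)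
    (hBu : ∀ x y, Function.update (Function.update Y i x) j y ∈ B ↔ Y ∈ B)
    (G : (Fin N → R3) → ENNReal) :
    ∫⁻ x, ∫⁻ y, ({Y | Y i ∈ Q ∧ Y j ∈ Q} ∩ B).indicator G
      (Function.update (Function.update Y i x) j y) =
      B.indicator (fun _ => ∫⁻ x in Q, ∫⁻ y in Q,
        G (Function.update (Function.update Y i x) j y)) Y := by
  by_cases hY : Y ∈ B
  · rw [Set.indicator_of_mem hY, ← lintegral_indicator hQm]
    refine lintegral_congr fun x => ?_
    by_cases hx : x ∈ Q
    · rw [Set.indicator_of_mem hx, ← lintegral_indicator hQm]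
      refine lintegral_congr fun y => ?_
      by_cases hy : y ∈ Q
      · rw [Set.indicator_of_mem hy, Set.indicator_of_mem]
        exact ⟨⟨by simpa [hij] using hx, by simpa using hy⟩, (hBu x y).2 hY⟩
      · rw [Set.indicator_of_notMem hy, Set.indicator_of_notMem]
        exact fun h => hy (by simpa using h.1.2)
    · rw [Set.indicator_of_notMem hx]
      refine lintegral_eq_zero_of_ae_eq_zero (.of_forall fun y => ?_)
      exact Set.indicator_of_notMem (fun h => hx (by simpa [hij] using h.1.1)) _
  · rw [Set.indicator_of_notMem hY]
    refine lintegral_eq_zero_of_ae_eq_zero (.of_forall fun x => ?_)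
    refine lintegral_eq_zero_of_ae_eq_zero (.of_forall fun y => ?_)
    exact Set.indicator_of_notMem (fun h => hY ((hBu x y).1 h.2)) _

theorem antisymm_pair_cell_le {N : ℕ} {Ψ : (Fin N → R3) → ℂ} (hΨ : ContDiff ℝ 1 Ψ)
    {i j : Fin N} (hij : i ≠ j) (hanti : ∀ Y, Ψ (Y ∘ Equiv.swap i j) = -Ψ Y)
    {Q : Set R3} (hQ : Convex ℝ Q) (hQm : MeasurableSet Q) (hQ0 : volume Q ≠ 0)
    (hQt : volume Q ≠ ⊤) {D : ENNReal} (hD : ∀ x ∈ Q, ∀ z ∈ Q, ‖z - x‖ₑ ≤ D)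
    {B : Set (Fin N → R3)} (hB : MeasurableSet B)
    (hBu : ∀ Y x y, Function.update (Function.update Y i x) j y ∈ B ↔ Y ∈ B) :
    ∫⁻ Y in {Y | Y i ∈ Q ∧ Y j ∈ Q} ∩ B, ‖Ψ Y‖ₑ ^ 2 ≤
      36 * D ^ 2 * ∫⁻ Y in {Y | Y i ∈ Q ∧ Y j ∈ Q} ∩ B,
        ‖partialFDeriv Ψ i Y‖ₑ ^ 2 := by
  set S : Set (Fin N → R3) := {Y | Y i ∈ Q ∧ Y j ∈ Q} ∩ B with hS
  have hSm : MeasurableSet S :=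
    ((measurable_pi_apply i hQm).inter (measurable_pi_apply j hQm)).inter hB
  set F : (Fin N → R3) → ENNReal := fun Y => ‖Ψ Y‖ₑ ^ 2 with hF
  set H : (Fin N → R3) → ENNReal := fun Y =>
    ‖partialFDeriv Ψ i Y‖ₑ ^ 2 with hH
  have hFm : Measurable F := ((ENNReal.continuous_pow 2).comp hΨ.continuous.enorm).measurable
  have hHm : Measurable H := 
    ((ENNReal.continuous_pow 2).comp (continuous_partialFDeriv hΨ i).enorm).measurable
  rw [← lintegral_const_mul _ hHm, ← lintegral_indicator hSm, ← lintegral_indicator hSm, volume_pi]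
  have m1 := hFm.indicator hSm
  have m2 := (hHm.const_mul (36 * D ^ 2)).indicator hSm
  refine lintegral_le_of_lmarginal_le {i, j} m1 m2 fun Y => ?_
  have hn : i ∉ ({j} : Finset (Fin N)) := by simpa using hij
  rw [lmarginal_insert _ m1 hn, lmarginal_insert _ m2 hn]
  simp only [lmarginal_singleton]
  rw [hS, lintegral_pair_cell_indicator hij hQm Y (hBu Y),
    lintegral_pair_cell_indicator hij hQm Y (hBu Y)]
  refine Set.indicator_le_indicator ?_
  have hm : Measurable fun p : R3 × R3 => H (Function.update (Function.update Y i p.1) j p.2) :=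
    hHm.comp (by fun_prop : Continuous fun p : R3 × R3 =>
      Function.update (Function.update Y i p.1) j p.2).measurable
  rw [lintegral_lintegral_const_mul hm]
  exact antisymm_fiber_poincare hΨ hij hanti hQ hQm hQ0 hQt hD Y

/-- The half-open cube of side `L` with index `m` in the grid shifted by `s / 2` sides. -/
def gridCell (L : ℝ) (s : Fin 3 → Fin 2) (m : Fin 3 → ℤ) : Set R3 :=
  {x | ∀ k, ⌊x k / L - ((s k : ℕ) : ℝ) / 2⌋ = m k}

theorem mem_gridCell_iff {L : ℝ} (hL : 0 < L) {s : Fin 3 → Fin 2} {m : Fin 3 → ℤ} {x : R3} :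
    x ∈ gridCell L s m ↔ ∀ k, (m k + ((s k : ℕ) : ℝ) / 2) * L ≤ x k ∧
      x k < (m k + 1 + ((s k : ℕ) : ℝ) / 2) * L := by
  refine forall_congr' fun k => ?_
  rw [Int.floor_eq_iff, ← le_div_iff₀ hL, ← div_lt_iff₀ hL]
  constructor <;> rintro ⟨h1, h2⟩ <;> constructor <;> linarith

theorem convex_gridCell {L : ℝ} (hL : 0 < L) (s : Fin 3 → Fin 2) (m : Fin 3 → ℤ) :
    Convex ℝ (gridCell L s m) := by
  intro x hx y hy a b ha hb hab
  rw [mem_gridCell_iff hL] at *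
  intro k
  have := convex_Ico ((m k + ((s k : ℕ) : ℝ) / 2) * L) ((m k + 1 + ((s k : ℕ) : ℝ) / 2) * L)
    (hx k) (hy k) ha hb hab
  simpa using this

theorem measurableSet_gridCell (L : ℝ) (s : Fin 3 → Fin 2) (m : Fin 3 → ℤ) :
    MeasurableSet (gridCell L s m) := by
  rw [gridCell, Set.ofPred_forall]
  refine MeasurableSet.iInter fun k => ?_
  have : Measurable fun x : R3 => ⌊x k / L - ((s k : ℕ) : ℝ) / 2⌋ :=
    Int.measurable_floor.comp (by fun_prop)
  exact this (measurableSet_singleton (m k))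

theorem enorm_sub_le_of_mem_gridCell {L : ℝ} (hL : 0 < L) {s : Fin 3 → Fin 2} {m : Fin 3 → ℤ}
    {x z : R3} (hx : x ∈ gridCell L s m) (hz : z ∈ gridCell L s m) :
    ‖z - x‖ₑ ≤ ENNReal.ofReal (2 * L) := by
  rw [mem_gridCell_iff hL] at hx hz
  rw [← ofReal_norm]
  refine ENNReal.ofReal_le_ofReal (abs_le_of_sq_le_sq' ?_ (by positivity)).2
  rw [EuclideanSpace.norm_sq_eq]
  have h : ∀ k, ‖(z - x) k‖ ^ 2 ≤ L ^ 2 := fun k => by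
    rw [Real.norm_eq_abs, sq_abs, PiLp.sub_apply]
    have := hx k
    have := hz k
    apply sq_le_sq' <;> linarith
  rw [Fin.sum_univ_three]
  nlinarith [h 0, h 1, h 2, sq_nonneg L]

theorem volume_gridCell_ne_zero {L : ℝ} (hL : 0 < L) (s : Fin 3 → Fin 2) (m : Fin 3 → ℤ) :
    volume (gridCell L s m) ≠ 0 := by
  set U : Set R3 := ⋂ k, {x | (m k + ((s k : ℕ) : ℝ) / 2) * L < x k ∧
      x k < (m k + 1 + ((s k : ℕ) : ℝ) / 2) * L} with hU
  have hUo : IsOpen U := by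
    refine isOpen_iInter_of_finite fun k => ?_
    have hk : Continuous fun x : R3 => x k := by fun_prop
    exact (isOpen_lt continuous_const hk).inter (isOpen_lt hk continuous_const)
  have hUn : U.Nonempty := by
    refine ⟨WithLp.toLp 2 fun k => (m k + 1 / 2 + ((s k : ℕ) : ℝ) / 2) * L, ?_⟩
    simp only [hU, Set.mem_iInter, Set.mem_ofPred_eq]
    intro k
    constructor <;> nlinarith
  have hsub : U ⊆ gridCell L s m := fun x hx => by
    rw [mem_gridCell_iff hL]
    intro k
    have := Set.mem_iInter.1 hx k
    exact ⟨this.1.le, this.2⟩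
  exact fun h => (hUo.measure_pos volume hUn).ne' (measure_mono_null hsub h)

theorem volume_gridCell_ne_top {L : ℝ} (hL : 0 < L) (s : Fin 3 → Fin 2) (m : Fin 3 → ℤ) :
    volume (gridCell L s m) ≠ ⊤ := by
  refine (Bornology.IsBounded.measure_lt_top ?_).ne
  rw [Metric.isBounded_iff]
  refine ⟨2 * L, fun x hx z hz => ?_⟩
  have h := enorm_sub_le_of_mem_gridCell hL hz hx
  rw [← ofReal_norm] at h
  rw [dist_eq_norm]
  exact (ENNReal.ofReal_le_ofReal_iff (by positivity)).1 h

theorem exists_floor_sub_eq {a b : ℝ} (h : |a - b| < 1 / 2) :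
    ∃ s : Fin 2, ⌊a - ((s : ℕ) : ℝ) / 2⌋ = ⌊b - ((s : ℕ) : ℝ) / 2⌋ := by
  wlog hab : a ≤ b generalizing a b
  · obtain ⟨s, hs⟩ := this (by rwa [abs_sub_comm]) (le_of_not_ge hab)
    exact ⟨s, hs.symm⟩
  by_contra! hne
  have h0 : ⌊a⌋ < ⌊b⌋ := lt_of_le_of_ne (Int.floor_mono hab) (by simpa using hne 0)
  have h1 : ⌊a - 1 / 2⌋ < ⌊b - 1 / 2⌋ :=
    lt_of_le_of_ne (Int.floor_mono (by linarith)) (by simpa using hne 1)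
  have a0 := Int.floor_lt.1 h0
  have a1 := Int.floor_lt.1 h1
  have b0 := Int.floor_le b
  have b1 := Int.floor_le (b - 1 / 2)
  have hlt := (abs_lt.1 h).1
  have c0 : ⌊b - 1 / 2⌋ < ⌊b⌋ := by
    have : (⌊b - 1 / 2⌋ : ℝ) < ⌊b⌋ := by linarith
    exact_mod_cast this
  have c1 : ⌊b⌋ < ⌊b - 1 / 2⌋ + 1 := by
    have : (⌊b⌋ : ℝ) < ⌊b - 1 / 2⌋ + 1 := by linarith
    exact_mod_cast this
  omega

theorem exists_gridCell_of_norm_sub_lt {R : ℝ} (hR : 0 < R) {x y : R3} (h : ‖x - y‖ < 2 * R) :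
    ∃ s m, x ∈ gridCell (4 * R) s m ∧ y ∈ gridCell (4 * R) s m := by
  have hk : ∀ k, ∃ t : Fin 2, ⌊x k / (4 * R) - ((t : ℕ) : ℝ) / 2⌋ =
      ⌊y k / (4 * R) - ((t : ℕ) : ℝ) / 2⌋ := fun k => by
    refine exists_floor_sub_eq ?_
    rw [← sub_div, abs_div, abs_of_pos (by positivity : 0 < 4 * R), div_lt_iff₀ (by positivity)]
    have h1 := PiLp.norm_apply_le (x - y) k
    rw [Real.norm_eq_abs, PiLp.sub_apply] at h1
    linarith
  choose s hs using hk
  exact ⟨s, fun k => ⌊x k / (4 * R) - ((s k : ℕ) : ℝ) / 2⌋, fun k => rfl, fun k => (hs k).symm⟩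

/-- Configurations whose points `i` and `j` lie in `Q`, with no point before `j` other than `i`
in `Q`. -/
def firstCompanion {N : ℕ} (i j : Fin N) (Q : Set R3) : Set (Fin N → R3) :=
  {Y | Y i ∈ Q ∧ Y j ∈ Q} ∩ {Y | ∀ k, k < j → k ≠ i → Y k ∉ Q}

theorem measurableSet_forall_lt_notMem {N : ℕ} (i j : Fin N) {Q : Set R3} (hQ : MeasurableSet Q) :
    MeasurableSet {Y : Fin N → R3 | ∀ k, k < j → k ≠ i → Y k ∉ Q} := by
  simp only [Set.ofPred_forall]
  exact .iInter fun k => .iInter fun _ => .iInter fun _ => (measurable_pi_apply k hQ).compl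

theorem measurableSet_firstCompanion {N : ℕ} (i j : Fin N) {Q : Set R3} (hQ : MeasurableSet Q) :
    MeasurableSet (firstCompanion i j Q) :=
  ((measurable_pi_apply i hQ).inter (measurable_pi_apply j hQ)).inter
    (measurableSet_forall_lt_notMem i j hQ)

theorem exists_mem_firstCompanion {N : ℕ} {i j : Fin N} (hij : j ≠ i) {Q : Set R3}
    {Y : Fin N → R3} (hi : Y i ∈ Q) (hj : Y j ∈ Q) :
    ∃ j, j ≠ i ∧ Y ∈ firstCompanion i j Q := by
  obtain ⟨l, ⟨hl1, hl2⟩, hl⟩ := (wellFounded_lt (α := Fin N)).has_min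
    {l | l ≠ i ∧ Y l ∈ Q} ⟨j, hij, hj⟩
  exact ⟨l, hl1, ⟨hi, hl2⟩, fun k hk hki hkQ => hl k ⟨hki, hkQ⟩ hk⟩

theorem eq_of_mem_firstCompanion {N : ℕ} {i j j' : Fin N} {L : ℝ} {s : Fin 3 → Fin 2}
    {m m' : Fin 3 → ℤ} {Y : Fin N → R3} (hj : j ≠ i) (hj' : j' ≠ i)
    (h : Y ∈ firstCompanion i j (gridCell L s m))
    (h' : Y ∈ firstCompanion i j' (gridCell L s m')) : m = m' ∧ j = j' := by
  have hm : m = m' := funext fun k => (h.1.1 k).symm.trans (h'.1.1 k)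
  subst hm
  refine ⟨rfl, le_antisymm ?_ ?_⟩
  · by_contra hlt
    exact h.2 j' (not_le.1 hlt) hj' h'.1.2
  · by_contra hlt
    exact h'.2 j (not_le.1 hlt) hj h.1.2

theorem lintegral_close_pair_le {N : ℕ} {R : ℝ} (hR : 0 < R) {Ψ : (Fin N → R3) → ℂ}
    (hΨ : ContDiff ℝ 1 Ψ)
    (hanti : ∀ i j : Fin N, i ≠ j → ∀ Y, Ψ (Y ∘ Equiv.swap i j) = -Ψ Y) (i : Fin N) :
    ∫⁻ Y in {Y : Fin N → R3 | ∃ j, j ≠ i ∧ ‖Y i - Y j‖ < 2 * R}, ‖Ψ Y‖ₑ ^ 2 ≤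
      8 * (36 * ENNReal.ofReal (2 * (4 * R)) ^ 2 * ∫⁻ Y, ‖partialFDeriv Ψ i Y‖ₑ ^ 2) := by
  have hL : 0 < 4 * R := by positivity
  set K := 36 * ENNReal.ofReal (2 * (4 * R)) ^ 2 with hK
  set T : (Fin 3 → Fin 2) → ((Fin 3 → ℤ) × {j : Fin N // j ≠ i}) → Set (Fin N → R3) :=
    fun s p => firstCompanion i p.2 (gridCell (4 * R) s p.1) with hT
  have hTm : ∀ s p, MeasurableSet (T s p) := fun s p =>
    measurableSet_firstCompanion _ _ (measurableSet_gridCell _ _ _)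
  have hTd : ∀ s, Pairwise (Function.onFun Disjoint (T s)) := fun s p q hpq => by
    refine Set.disjoint_left.2 fun Y hp hq => hpq ?_
    obtain ⟨h1, h2⟩ := eq_of_mem_firstCompanion p.2.2 q.2.2 hp hq
    exact Prod.ext h1 (Subtype.ext h2)
  have hcell : ∀ s p, ∫⁻ Y in T s p, ‖Ψ Y‖ₑ ^ 2 ≤
      K * ∫⁻ Y in T s p, ‖partialFDeriv Ψ i Y‖ₑ ^ 2 := fun s p => by
    refine antisymm_pair_cell_le hΨ p.2.2.symm (hanti _ _ p.2.2.symm) (convex_gridCell hL s p.1)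
      (measurableSet_gridCell _ _ _) (volume_gridCell_ne_zero hL _ _)
      (volume_gridCell_ne_top hL _ _)
      (fun x hx z hz => enorm_sub_le_of_mem_gridCell hL hx hz)
      (measurableSet_forall_lt_notMem _ _ (measurableSet_gridCell _ _ _)) fun Y x y => ?_
    refine forall_congr' fun k => forall_congr' fun hk => forall_congr' fun hki => ?_
    rw [Function.update_of_ne hk.ne, Function.update_of_ne hki]
  calc ∫⁻ Y in {Y : Fin N → R3 | ∃ j, j ≠ i ∧ ‖Y i - Y j‖ < 2 * R}, ‖Ψ Y‖ₑ ^ 2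
      ≤ ∫⁻ Y in ⋃ s, ⋃ p, T s p, ‖Ψ Y‖ₑ ^ 2 := by
        refine lintegral_mono_set ?_
        rintro Y ⟨j, hji, hj⟩
        obtain ⟨s, m, h1, h2⟩ := exists_gridCell_of_norm_sub_lt hR hj
        obtain ⟨l, hl, hY⟩ := exists_mem_firstCompanion hji h1 h2
        exact Set.mem_iUnion.2 ⟨s, Set.mem_iUnion.2 ⟨(m, ⟨l, hl⟩), hY⟩⟩
    _ ≤ ∑' s, ∫⁻ Y in ⋃ p, T s p, ‖Ψ Y‖ₑ ^ 2 := lintegral_iUnion_le _ _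
    _ ≤ ∑' _ : Fin 3 → Fin 2, K * ∫⁻ Y, ‖partialFDeriv Ψ i Y‖ₑ ^ 2 := by
        refine ENNReal.tsum_le_tsum fun s => ?_
        calc ∫⁻ Y in ⋃ p, T s p, ‖Ψ Y‖ₑ ^ 2 = ∑' p, ∫⁻ Y in T s p, ‖Ψ Y‖ₑ ^ 2 :=
              lintegral_iUnion (hTm s) (hTd s) _
          _ ≤ ∑' p, K * ∫⁻ Y in T s p, ‖partialFDeriv Ψ i Y‖ₑ ^ 2 :=
              ENNReal.tsum_le_tsum (hcell s)
          _ = K * ∫⁻ Y in ⋃ p, T s p, ‖partialFDeriv Ψ i Y‖ₑ ^ 2 := by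
              rw [ENNReal.tsum_mul_left, lintegral_iUnion (hTm s) (hTd s)]
          _ ≤ K * ∫⁻ Y, ‖partialFDeriv Ψ i Y‖ₑ ^ 2 := by
              gcongr
              exact Measure.restrict_le_self
    _ = 8 * (K * ∫⁻ Y, ‖partialFDeriv Ψ i Y‖ₑ ^ 2) := by
        rw [tsum_fintype, Finset.sum_const, nsmul_eq_mul]
        simp

theorem measurableSet_close_pair {N : ℕ} (R : ℝ) (i : Fin N) :
    MeasurableSet {Y : Fin N → R3 | ∃ j, j ≠ i ∧ ‖Y i - Y j‖ < 2 * R} := by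
  simp only [Set.ofPred_exists, Set.ofPred_and]
  exact .iUnion fun j => .inter (.const _) (measurableSet_lt (by fun_prop) (by fun_prop))

theorem integrable_gradSq {N : ℕ} {Ψ : (Fin N → R3) → ℂ} (hΨ : ContDiff ℝ 1 Ψ)
    (hs : HasCompactSupport Ψ) (i : Fin N) :
    Integrable fun Y : Fin N → R3 => gradSq (fun z => Ψ (Function.update Y i z)) (Y i) := by
  have hc := continuous_partialFDeriv hΨ i
  have e : (fun Y : Fin N → R3 => gradSq (fun z => Ψ (Function.update Y i z)) (Y i)) =
      fun Y => ∑ k : Fin 3, ‖partialFDeriv Ψ i Y (EuclideanSpace.single k 1)‖ ^ 2 := rfl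
  rw [e]
  refine Continuous.integrable_of_hasCompactSupport (by fun_prop) ?_
  refine (hs.fderiv ℝ).mono' ?_
  refine (Function.support_subset_iff'.2 fun Y hY => ?_)
  have h0 : fderiv ℝ Ψ Y = 0 := image_eq_zero_of_notMem_tsupport hY
  simp [partialFDeriv_eq hΨ, h0]

theorem integral_close_pair_le {N : ℕ} {R : ℝ} (hR : 0 < R) {Ψ : (Fin N → R3) → ℂ}
    (hΨ : ContDiff ℝ 1 Ψ) (hs : HasCompactSupport Ψ)
    (hanti : ∀ i j : Fin N, i ≠ j → ∀ Y, Ψ (Y ∘ Equiv.swap i j) = -Ψ Y)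
    (hi : Integrable fun Y => ‖Ψ Y‖ ^ 2) (i : Fin N) :
    ∫ Y in {Y : Fin N → R3 | ∃ j, j ≠ i ∧ ‖Y i - Y j‖ < 2 * R}, ‖Ψ Y‖ ^ 2 ≤
      18432 * R ^ 2 * ∫ Y : Fin N → R3, gradSq (fun z => Ψ (Function.update Y i z)) (Y i) := by
  have hg0 : ∀ Y : Fin N → R3, 0 ≤ gradSq (fun z => Ψ (Function.update Y i z)) (Y i) :=
    fun Y => Finset.sum_nonneg fun _ _ => sq_nonneg _
  have hI0 : 0 ≤ ∫ Y : Fin N → R3, gradSq (fun z => Ψ (Function.update Y i z)) (Y i) :=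
    integral_nonneg hg0
  rw [← ENNReal.ofReal_le_ofReal_iff (by positivity),
    ofReal_integral_eq_lintegral_ofReal hi.integrableOn (.of_forall fun _ => sq_nonneg _),
    ENNReal.ofReal_mul (by positivity),
    ofReal_integral_eq_lintegral_ofReal (integrable_gradSq hΨ hs i) (.of_forall hg0)]
  simp only [ENNReal.ofReal_pow (norm_nonneg _), ofReal_norm]
  refine (lintegral_close_pair_le hR hΨ hanti i).trans ?_
  have hc : ENNReal.ofReal (18432 * R ^ 2) = 8 * (36 * ENNReal.ofReal (2 * (4 * R)) ^ 2) := by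
    rw [← ENNReal.ofReal_pow (by positivity), ← ENNReal.ofReal_ofNat 8, ← ENNReal.ofReal_ofNat 36,
      ← ENNReal.ofReal_mul (by norm_num), ← ENNReal.ofReal_mul (by norm_num)]
    congr 1
    ring
  rw [hc, ← mul_assoc]
  gcongr with Y
  exact enorm_fderiv_sq_le_gradSq _ _

theorem nearest_neighbor_counting :
    ∃ C > (0:ℝ), ∀ (N : ℕ) (R : ℝ), 0 < R →
      ∀ Ψ : (Fin N → R3) → ℂ,
        ContDiff ℝ (⊤ : ℕ∞) Ψ →
        HasCompactSupport Ψ →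
        (∀ (i j : Fin N), i ≠ j → ∀ Y, Ψ (Y ∘ Equiv.swap i j) = - Ψ Y) →
        (∫ Y : Fin N → R3, ‖Ψ Y‖ ^ 2) = 1 →
        (∫ Y : Fin N → R3, (IR N R Y : ℝ) * ‖Ψ Y‖ ^ 2) ≤
          C * R ^ 2 * ∑ i : Fin N, ∫ Y : Fin N → R3,
            gradSq (fun z => Ψ (Function.update Y i z)) (Y i) := by
  refine ⟨18432, by norm_num, fun N R hR Ψ hΨ hs hanti _ => ?_⟩
  have hΨ1 : ContDiff ℝ 1 Ψ := hΨ.of_le (by exact_mod_cast le_top)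
  have hi : Integrable fun Y => ‖Ψ Y‖ ^ 2 := by
    have hcont := hΨ.continuous
    refine Continuous.integrable_of_hasCompactSupport (by fun_prop) ?_
    exact hs.comp_left (g := fun w : ℂ => ‖w‖ ^ 2) (by simp)
  set S : Fin N → Set (Fin N → R3) := fun i => {Y | ∃ j, j ≠ i ∧ ‖Y i - Y j‖ < 2 * R} with hS
  have e : ∀ Y : Fin N → R3, (IR N R Y : ℝ) * ‖Ψ Y‖ ^ 2 =
      ∑ i, (S i).indicator (fun Y => ‖Ψ Y‖ ^ 2) Y := fun Y => by
    rw [IR, Finset.card_filter, Nat.cast_sum, Finset.sum_mul]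
    refine Finset.sum_congr rfl fun i _ => ?_
    by_cases h : ∃ j : Fin N, j ≠ i ∧ ‖Y i - Y j‖ < 2 * R
    · rw [Set.indicator_of_mem (show Y ∈ S i from h), if_pos h]; simp
    · rw [Set.indicator_of_notMem (show Y ∉ S i from h), if_neg h]; simp
  simp_rw [e]
  rw [integral_finsetSum _ fun i _ => hi.indicator (measurableSet_close_pair R i), Finset.mul_sum]
  refine Finset.sum_le_sum fun i _ => ?_
  rw [integral_indicator (measurableSet_close_pair R i)]
  exact integral_close_pair_le hR hΨ1 hs hanti hi i
end
end

section
/- Key estimate on the overlap matrix: For every ε > 0 there exists δ > 0 with the following property. Let N ∈ ℕ, L > 0, and 0 < a ≤ s satisfy a/s ≤ δ and N^{1/3} s / L ≤ δ. Let u₁,…,u_N be the eigenfunctions of the Dirichlet Laplacian on Λ = [0,L]³ corresponding to the N lowest eigenvalues (counted with multiplicity), orthonormal in L²(Λ). Let f: ℝ³ → [0,1] be measurable with f(x) = 1 for |x| ≥ s and 1 − f(x) ≤ a/|x| for all x ≠ 0. Let Y = (y₁,…,y_N) ∈ (ℝ³)ᴺ satisfy |y_i − y_j| ≥ s for all i ≠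 j, and define the N×N matrix 𝓜(Y) by 𝓜(Y)_{αβ} = ∫_Λ u_α(x)* u_β(x) ∏_{j=1}ᴺ f(x − y_j)² dx. Then the operator norm satisfies ‖ I − 𝓜(Y) ‖ ≤ ε. -/
/-!
STATEMENT 12: Key estimate on the overlap matrix.
For every `ε > 0` there is `δ > 0` such that: if `0 < a ≤ s`, `a/s ≤ δ`,
`N^{1/3} s / L ≤ δ`, `u₁,…,u_N` are Dirichlet eigenfunctions of the cube
`Λ = [0,L]³` realizing the `N` lowest eigenvalues, `f : ℝ³ → [0,1]` satisfies
`f = 1` on `{|x| ≥ s}` and `1 - f(x) ≤ a/|x|`, and `y₁,…,y_N` satisfy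
`|y_i - y_j| ≥ s` for `i ≠ j`, then the matrix
`𝓜(Y)_{αβ} = ∫_Λ u_α u_β ∏_j f(x-y_j)² dx` satisfies `‖I - 𝓜(Y)‖ ≤ ε`
in the operator norm on `ℝᴺ` (Euclidean).
-/

open MeasureTheory Real

noncomputable section

/-- The (normalized) Dirichlet eigenfunction of the cube `[0,L]³` with
quantum numbers `k ∈ (ℤ_{>0})³`:
`u_k(x) = (2/L)^{3/2} ∏_j sin(π k_j x_j / L)`. -/
def cubeEigenfunction (L : ℝ) (k : Fin 3 → ℕ) (x : R3) : ℝ :=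
  (2 / L) ^ ((3:ℝ)/2) * ∏ j : Fin 3, Real.sin (π * k j * x j / L)

/-- The closed cube `[0,L]³`. -/
def cube (L : ℝ) : Set R3 := {x | ∀ j, x j ∈ Set.Icc 0 L}

/-- The operator norm (on Euclidean space) of a real square matrix. -/
def matrixOpNorm {N : ℕ} (A : Matrix (Fin N) (Fin N) ℝ) : ℝ :=
  ‖LinearMap.toContinuousLinearMap
    (Matrix.toEuclideanLin A : EuclideanSpace ℝ (Fin N) →ₗ[ℝ] EuclideanSpace ℝ (Fin N))‖

open Set

/-! ### One-dimensional sine integrals -/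

theorem integral_cos_int_mul_pi_div {L : ℝ} (hL : 0 < L) (m p q : ℤ) :
    ∫ t in (p * L)..(q * L), cos (π * m * t / L) = if m = 0 then (q - p) * L else 0 := by
  split_ifs with hm
  · simp [hm, sub_mul]
  · have hc : π * m / L ≠ 0 := by
      have : (m : ℝ) ≠ 0 := by exact_mod_cast hm
      positivity
    have hfun : ∀ t : ℝ, cos (π * m * t / L) = cos (π * m / L * t) := fun t => by
      congr 1; ring
    have hend : ∀ r : ℤ, sin (π * m / L * (r * L)) = 0 := fun r => by
      have : π * m / L * (r * L) = ((m * r : ℤ) : ℝ) * π := by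
        push_cast; field_simp
      rw [this, sin_int_mul_pi]
    simp_rw [hfun]
    rw [intervalIntegral.integral_comp_mul_left (fun x => cos x) hc, integral_cos, hend, hend]
    simp

theorem integral_sin_mul_sin_Icc {L : ℝ} (hL : 0 < L) {k l : ℕ} (hk : 1 ≤ k) {p q : ℤ}
    (hpq : p ≤ q) :
    ∫ t in Icc (p * L) (q * L), sin (π * k * t / L) * sin (π * l * t / L)
      = if k = l then (q - p) * (L / 2) else 0 := by
  have hle : (p : ℝ) * L ≤ q * L := by
    have : (p : ℝ) ≤ q := by exact_mod_cast hpq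
    gcongr
  rw [integral_Icc_eq_integral_Ioc, ← intervalIntegral.integral_of_le hle]
  have hfun : ∀ t : ℝ, sin (π * k * t / L) * sin (π * l * t / L)
      = 2⁻¹ * cos (π * ((k - l : ℤ) : ℝ) * t / L) - 2⁻¹ * cos (π * ((k + l : ℤ) : ℝ) * t / L) := by
    intro t
    have h1 : π * ((k - l : ℤ) : ℝ) * t / L = π * k * t / L - π * l * t / L := by
      push_cast; ring
    have h2 : π * ((k + l : ℤ) : ℝ) * t / L = π * k * t / L + π * l * t / L := by
      push_cast; ring
    rw [h1, h2, cos_sub, cos_add]; ring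
  simp_rw [hfun]
  rw [intervalIntegral.integral_sub, intervalIntegral.integral_const_mul,
    intervalIntegral.integral_const_mul, integral_cos_int_mul_pi_div hL,
    integral_cos_int_mul_pi_div hL, if_neg (by lia : ¬ ((k : ℤ) + l = 0))]
  · by_cases h : k = l
    · simp [h]; ring
    · rw [if_neg h, if_neg (by lia)]; simp
  all_goals
    apply Continuous.intervalIntegrable
    fun_prop

theorem integral_sin_Icc_centered {b h : ℝ} (hb : b ≠ 0) (hh : 0 < h) (x : ℝ) :
    ∫ t in Icc (x - h / 2) (x + h / 2), sin (b * t)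
      = h * (sin (b * h / 2) / (b * h / 2)) * sin (b * x) := by
  rw [integral_Icc_eq_integral_Ioc, ← intervalIntegral.integral_of_le (by linarith),
    intervalIntegral.integral_comp_mul_left (fun x => sin x) hb, integral_sin]
  have h1 : b * (x - h / 2) = b * x - b * h / 2 := by ring
  have h2 : b * (x + h / 2) = b * x + b * h / 2 := by ring
  rw [h1, h2, cos_sub, cos_add, smul_eq_mul]
  field_simp
  ring

/-! ### Boxes in `R3` -/

/-- The closed axis-parallel box with corners `p` and `q`. -/
def box (p q : Fin 3 → ℝ) : Set R3 := {x | ∀ j, x j ∈ Icc (p j) (q j)}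

theorem box_eq_preimage (p q : Fin 3 → ℝ) :
    box p q = WithLp.ofLp ⁻¹' (univ.pi fun j => Icc (p j) (q j)) := by
  ext x; simp only [box, mem_ofPred_eq, mem_preimage, mem_univ_pi]

theorem cube_eq_box (L : ℝ) : cube L = box (fun _ => ((0 : ℤ) : ℝ) * L)
    (fun _ => ((1 : ℤ) : ℝ) * L) := by
  simp [cube, box]

theorem isCompact_box (p q : Fin 3 → ℝ) : IsCompact (box p q) := by
  rw [box_eq_preimage]
  exact (EuclideanSpace.equiv (Fin 3) ℝ).toHomeomorph.isCompact_preimage.2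
    (isCompact_univ_pi fun _ => isCompact_Icc)

theorem integral_box_prod (p q : Fin 3 → ℝ) (g : Fin 3 → ℝ → ℝ) :
    ∫ x in box p q, ∏ j, g j (x j) = ∏ j, ∫ t in Icc (p j) (q j), g j t := by
  have hmp := PiLp.volume_preserving_ofLp (Fin 3)
  rw [box_eq_preimage]
  rw [hmp.setIntegral_preimage_emb
    (MeasurableEquiv.toLp 2 (Fin 3 → ℝ)).symm.measurableEmbedding
    (fun y : Fin 3 → ℝ => ∏ j, g j (y j)), volume_pi, Measure.restrict_pi_pi]
  exact integral_fintype_prod_eq_prod g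

theorem integral_box_const (p q : Fin 3 → ℝ) (hpq : ∀ j, p j ≤ q j) :
    volume.real (box p q) = ∏ j, (q j - p j) := by
  have := integral_box_prod p q (fun _ _ => 1)
  simpa [hpq] using this

/-! ### The eigenfunctions on boxes -/

theorem continuous_cubeEigenfunction (L : ℝ) (k : Fin 3 → ℕ) :
    Continuous (cubeEigenfunction L k) := by
  unfold cubeEigenfunction; fun_prop

theorem integral_cubeEigenfunction_mul {L : ℝ} (hL : 0 < L) {k l : Fin 3 → ℕ}
    (hk : ∀ j, 1 ≤ k j) {p q : ℤ} (hpq : p ≤ q) :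
    ∫ x in box (fun _ => p * L) (fun _ => q * L), cubeEigenfunction L k x * cubeEigenfunction L l x
      = if k = l then ((q : ℝ) - p) ^ 3 else 0 := by
  have hfun : ∀ x : R3, cubeEigenfunction L k x * cubeEigenfunction L l x
      = (2 / L) ^ 3 * ∏ j, (sin (π * k j * x j / L) * sin (π * l j * x j / L)) := by
    intro x
    have : ((2 / L) ^ ((3 : ℝ) / 2)) * ((2 / L) ^ ((3 : ℝ) / 2)) = (2 / L) ^ 3 := by
      rw [← rpow_add (by positivity)]; norm_num
    rw [cubeEigenfunction, cubeEigenfunction, Finset.prod_mul_distrib, ← this]; ring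
  simp_rw [hfun]
  rw [integral_const_mul,
    integral_box_prod _ _ (fun j t => sin (π * k j * t / L) * sin (π * l j * t / L))]
  simp_rw [integral_sin_mul_sin_Icc hL (hk _) hpq]
  split_ifs with h
  · simp [h]; field_simp
  · obtain ⟨j, hj⟩ := Function.ne_iff.1 h
    rw [Finset.prod_eq_zero (Finset.mem_univ j) (if_neg hj), mul_zero]

/-- The factor by which averaging over a centred box of side `h` scales the eigenfunction with
quantum numbers `k`. -/
def averagingFactor (L h : ℝ) (k : Fin 3 → ℕ) : ℝ :=
  ∏ j, (sin (π * k j / L * h / 2) / (π * k j / L * h / 2))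

theorem integral_cubeEigenfunction_box {L h : ℝ} (hL : 0 < L) (hh : 0 < h) {k : Fin 3 → ℕ}
    (hk : ∀ j, 1 ≤ k j) (x : R3) :
    ∫ y in box (fun j => x j - h / 2) (fun j => x j + h / 2), cubeEigenfunction L k y
      = h ^ 3 * averagingFactor L h k * cubeEigenfunction L k x := by
  have hb : ∀ j, π * k j / L ≠ 0 := fun j => by
    have : (0 : ℝ) < k j := by exact_mod_cast hk j
    positivity
  have harg : ∀ (j : Fin 3) (t : ℝ), π * k j * t / L = π * k j / L * t := fun j t => by ring
  simp_rw [cubeEigenfunction, harg]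
  rw [integral_const_mul, integral_box_prod _ _ (fun j t => sin (π * k j / L * t))]
  simp_rw [integral_sin_Icc_centered (hb _) hh]
  rw [averagingFactor, Finset.prod_mul_distrib, Finset.prod_mul_distrib]
  simp only [Finset.prod_const, Finset.card_univ, Fintype.card_fin]
  ring

theorem averagingFactor_ge {L h : ℝ} (hL : 0 < L) (hh : 0 < h) {k : Fin 3 → ℕ}
    (hk : ∀ j, 1 ≤ k j) (hkh : ∀ j, π * k j / L * h / 2 ≤ π / 2) :
    1 / 8 ≤ averagingFactor L h k := by
  have hpi : (1 : ℝ) / 2 ≤ 2 / π := by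
    rw [div_le_div_iff₀ (by norm_num) pi_pos]; linarith [pi_le_four]
  have hfac : ∀ j ∈ Finset.univ, (1 : ℝ) / 2 ≤
      sin (π * k j / L * h / 2) / (π * k j / L * h / 2) := fun j _ => by
    have : (0 : ℝ) < k j := by exact_mod_cast hk j
    have hpos : 0 < π * k j / L * h / 2 := by positivity
    rw [le_div_iff₀ hpos]
    exact (mul_le_mul_of_nonneg_right hpi hpos.le).trans (mul_le_sin hpos.le (hkh j))
  have := Finset.prod_le_prod (fun _ _ => by norm_num) hfac
  rw [averagingFactor]
  refine le_trans ?_ this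
  norm_num

/-! ### Quantum numbers of the lowest eigenfunctions -/

/-- The quantum numbers of the `N` lowest Dirichlet eigenfunctions are at most `3 N^{1/3}`. -/
theorem quantumNumber_le {N : ℕ} {K : Fin N → (Fin 3 → ℕ)} (hK : ∀ i j, 1 ≤ K i j)
    (hmin : ∀ k : Fin 3 → ℕ, (∀ j, 1 ≤ k j) → k ∉ Set.range K →
      ∀ i, (∑ j : Fin 3, (K i j) ^ 2) ≤ ∑ j : Fin 3, (k j) ^ 2) (i : Fin N) (j : Fin 3) :
    (K i j : ℝ) ≤ 3 * (N : ℝ) ^ ((1 : ℝ) / 3) := by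
  set n := K i j / 2 with hn
  have hsum : (2 * n) ^ 2 + 1 ≤ ∑ t, K i t ^ 2 := by
    have h2n : (2 * n) ^ 2 ≤ K i j ^ 2 := Nat.pow_le_pow_left (by lia) 2
    have hone : ∀ t, 1 ≤ K i t ^ 2 := fun t => Nat.one_le_pow _ _ (hK i t)
    have h0 := hone 0
    have h1 := hone 1
    have h2 := hone 2
    rw [Fin.sum_univ_three]
    fin_cases j <;> simp at h2n <;> lia
  have hmem : ∀ v : Fin 3 → Fin n, ∃ β, K β = fun t => (v t : ℕ) + 1 := by
    intro v
    by_contra hv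
    have hle := hmin (fun t => (v t : ℕ) + 1) (fun _ => Nat.le_add_left _ _) hv i
    have hub : ∑ t, ((v t : ℕ) + 1) ^ 2 ≤ ∑ _t : Fin 3, n ^ 2 :=
      Finset.sum_le_sum fun t _ => Nat.pow_le_pow_left (v t).2 2
    simp only [Finset.sum_const, Finset.card_univ, Fintype.card_fin, smul_eq_mul] at hub
    nlinarith
  choose g hg using hmem
  have hinj : Function.Injective g := by
    intro v w hvw
    have := (hg v).symm.trans ((congrArg K hvw).trans (hg w))
    funext t
    have ht := congrFun this t
    exact Fin.ext (by simpa using ht)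
  have hcard : n ^ 3 ≤ N := by
    simpa using Fintype.card_le_of_injective g hinj
  have hroot : ∀ m : ℕ, m ^ 3 ≤ N → (m : ℝ) ≤ (N : ℝ) ^ ((1 : ℝ) / 3) := by
    intro m hm
    have hm' : (m : ℝ) ^ (3 : ℝ) ≤ N := by exact_mod_cast hm
    calc (m : ℝ) = ((m : ℝ) ^ (3 : ℝ)) ^ ((1 : ℝ) / 3) := by
          rw [← rpow_mul (by positivity)]; norm_num
      _ ≤ _ := by gcongr
  have h1 := hroot n hcard
  have h2 := hroot 1 (by have := i.2; lia)
  have h3 : (K i j : ℝ) ≤ 2 * n + 1 := by exact_mod_cast (by lia : K i j ≤ 2 * n + 1)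
  push_cast at h2
  linarith

/-! ### Superpositions of eigenfunctions -/

/-- The superposition `∑ α, c α • u_{K α}` of eigenfunctions of the cube. -/
def packet {N : ℕ} (L : ℝ) (K : Fin N → (Fin 3 → ℕ)) (c : Fin N → ℝ) (x : R3) : ℝ :=
  ∑ α, c α * cubeEigenfunction L (K α) x

section Packet

variable {N : ℕ} {L : ℝ} {K : Fin N → (Fin 3 → ℕ)}

theorem continuous_packet (c : Fin N → ℝ) : Continuous (packet L K c) := by
  have := continuous_cubeEigenfunction L
  unfold packet
  fun_prop

theorem integrableOn_box {g : R3 → ℝ} (hg : Continuous g) (p q : Fin 3 → ℝ) :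
    IntegrableOn g (box p q) :=
  hg.continuousOn.integrableOn_compact (isCompact_box p q)

theorem integral_packet_sq (hL : 0 < L) (hK : ∀ i j, 1 ≤ K i j) (hinj : Function.Injective K)
    {p q : ℤ} (hpq : p ≤ q) (c : Fin N → ℝ) :
    ∫ x in box (fun _ => p * L) (fun _ => q * L), packet L K c x ^ 2
      = ((q : ℝ) - p) ^ 3 * ∑ α, c α ^ 2 := by
  have hfun : ∀ x, packet L K c x ^ 2 = ∑ α, ∑ β, c α * c β *
      (cubeEigenfunction L (K α) x * cubeEigenfunction L (K β) x) := fun x => by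
    rw [packet, sq, Finset.sum_mul_sum]
    exact Finset.sum_congr rfl fun _ _ => Finset.sum_congr rfl fun _ _ => by ring
  have hcont := continuous_cubeEigenfunction L
  simp_rw [hfun]
  rw [integral_finsetSum _ fun α _ => integrableOn_box (by fun_prop) _ _, Finset.mul_sum]
  refine Finset.sum_congr rfl fun α _ => ?_
  rw [integral_finsetSum _ fun β _ => integrableOn_box (by fun_prop) _ _]
  simp_rw [integral_const_mul, integral_cubeEigenfunction_mul hL (hK _) hpq, hinj.eq_iff]
  simp
  ring

theorem packet_sq_le_integral {h : ℝ} (hL : 0 < L) (hh : 0 < h) (hK : ∀ i j, 1 ≤ K i j)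
    (hm : ∀ α, averagingFactor L h (K α) ≠ 0) (c : Fin N → ℝ) (x : R3) :
    h ^ 3 * packet L K c x ^ 2 ≤ ∫ y in box (fun j => x j - h / 2) (fun j => x j + h / 2),
      packet L K (fun α => c α / averagingFactor L h (K α)) y ^ 2 := by
  set ψ := packet L K (fun α => c α / averagingFactor L h (K α)) with hψ
  set t := packet L K c x with ht
  set B := box (fun j => x j - h / 2) (fun j => x j + h / 2) with hB
  have hψc : Continuous ψ := continuous_packet _
  have hcont := continuous_cubeEigenfunction L
  have hmean : ∫ y in B, ψ y = h ^ 3 * t := by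
    simp only [hψ, packet]
    rw [integral_finsetSum _ fun β _ => integrableOn_box (by fun_prop) _ _]
    simp_rw [integral_const_mul, fun β => integral_cubeEigenfunction_box hL hh (hK β) x]
    rw [ht, packet, Finset.mul_sum]
    refine Finset.sum_congr rfl fun α _ => ?_
    have := hm α
    field_simp
  have hvol : volume.real B = h ^ 3 := by
    rw [hB, integral_box_const _ _ fun j => by linarith]
    have : ∀ j, x j + h / 2 - (x j - h / 2) = h := fun j => by ring
    simp [this]
  have hnonneg : 0 ≤ ∫ y in B, (ψ y - t) ^ 2 := integral_nonneg fun _ => sq_nonneg _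
  have hexp : ∀ y, (ψ y - t) ^ 2 = ψ y ^ 2 - 2 * t * ψ y + t ^ 2 := fun y => by ring
  simp_rw [hexp] at hnonneg
  rw [integral_add, integral_sub, integral_const_mul, hmean, setIntegral_const, hvol,
    smul_eq_mul] at hnonneg
  · linarith
  all_goals exact integrableOn_box (by fun_prop) _ _

/-- Sampling inequality: the squares of a superposition of low eigenfunctions at `s`-separated
points of the cube sum up to at most a constant times `s⁻³`. -/
theorem sum_packet_sq_le {s : ℝ} (hL : 0 < L) (hs : 0 < s) (hsL : s ≤ L)
    (hK : ∀ i j, 1 ≤ K i j) (hinj : Function.Injective K)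
    (hfreq : ∀ i j, π * K i j / L * (s / 2) / 2 ≤ π / 2)
    {ι : Type*} (J : Finset ι) (X : ι → R3) (hX : ∀ i ∈ J, X i ∈ cube L)
    (hsep : ∀ i ∈ J, ∀ j ∈ J, i ≠ j → s ≤ ‖X i - X j‖) (c : Fin N → ℝ) :
    ∑ i ∈ J, packet L K c (X i) ^ 2 ≤ 13824 / s ^ 3 * ∑ α, c α ^ 2 := by
  set h := s / 2 with hh
  have hh0 : 0 < h := by positivity
  have hm : ∀ α, 1 / 8 ≤ averagingFactor L h (K α) := fun α =>
    averagingFactor_ge hL hh0 (hK α) (hfreq α)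
  set d : Fin N → ℝ := fun α => c α / averagingFactor L h (K α) with hd
  set Q : ι → Set R3 := fun i => box (fun j => X i j - h / 2) (fun j => X i j + h / 2) with hQ
  have hdisj : Set.Pairwise (J : Set ι) (Function.onFun Disjoint Q) := by
    intro i hi j hj hij
    refine Set.disjoint_left.2 fun y hyi hyj => ?_
    have hsq : ‖X i - X j‖ ^ 2 ≤ 3 * h ^ 2 := by
      rw [EuclideanSpace.real_norm_sq_eq, Fin.sum_univ_three]
      have hcoord : ∀ t, (X i - X j) t ^ 2 ≤ h ^ 2 := fun t => by
        have h1 := hyi t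
        have h2 := hyj t
        simp only [mem_Icc] at h1 h2
        rw [PiLp.sub_apply]
        apply sq_le_sq' <;> linarith
      linarith [hcoord 0, hcoord 1, hcoord 2]
    have := pow_le_pow_left₀ hs.le (hsep i hi j hj hij) 2
    nlinarith
  have hsub : (⋃ i ∈ J, Q i) ⊆ box (fun _ => ((-1 : ℤ) : ℝ) * L) (fun _ => ((2 : ℤ) : ℝ) * L) := by
    refine Set.iUnion₂_subset fun i hi y hy t => ?_
    have h1 := hX i hi t
    have h2 := hy t
    simp only [mem_Icc] at h1 h2 ⊢
    push_cast
    constructor <;> linarith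
  have hd_sq : ∑ α, d α ^ 2 ≤ 64 * ∑ α, c α ^ 2 := by
    rw [Finset.mul_sum]
    refine Finset.sum_le_sum fun α _ => ?_
    have hpos : 0 < averagingFactor L h (K α) := lt_of_lt_of_le (by norm_num) (hm α)
    rw [hd, div_pow, div_le_iff₀ (by positivity)]
    have : (1 / 8 : ℝ) ^ 2 ≤ averagingFactor L h (K α) ^ 2 :=
      pow_le_pow_left₀ (by norm_num) (hm α) 2
    nlinarith [sq_nonneg (c α)]
  have hcont : Continuous fun y => packet L K d y ^ 2 := (continuous_packet d).pow 2
  have key : h ^ 3 * ∑ i ∈ J, packet L K c (X i) ^ 2 ≤ 27 * ∑ α, d α ^ 2 := by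
    calc h ^ 3 * ∑ i ∈ J, packet L K c (X i) ^ 2
        ≤ ∑ i ∈ J, ∫ y in Q i, packet L K d y ^ 2 := by
          rw [Finset.mul_sum]
          exact Finset.sum_le_sum fun i _ => packet_sq_le_integral hL hh0 hK
            (fun α => (lt_of_lt_of_le (by norm_num) (hm α)).ne') c (X i)
      _ = ∫ y in ⋃ i ∈ J, Q i, packet L K d y ^ 2 :=
          (integral_biUnion_finset J (fun i _ => (isCompact_box _ _).measurableSet) hdisj
            fun i _ => integrableOn_box hcont _ _).symm
      _ ≤ ∫ y in box (fun _ => ((-1 : ℤ) : ℝ) * L) (fun _ => ((2 : ℤ) : ℝ) * L),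
            packet L K d y ^ 2 :=
          setIntegral_mono_set (integrableOn_box hcont _ _)
            (Filter.Eventually.of_forall fun _ => sq_nonneg _) hsub.eventuallyLE
      _ = 27 * ∑ α, d α ^ 2 := by
          rw [integral_packet_sq hL hK hinj (by norm_num)]; norm_num
  have hs3 : h ^ 3 = s ^ 3 / 8 := by rw [hh]; ring
  rw [hs3] at key
  rw [div_mul_eq_mul_div, le_div_iff₀ (by positivity)]
  linarith

theorem sum_integral_packet_sq_ball_le {s r : ℝ} (hL : 0 < L) (hs : 0 < s) (hsL : s ≤ L)
    (hr : 0 ≤ r) (hK : ∀ i j, 1 ≤ K i j) (hinj : Function.Injective K)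
    (hfreq : ∀ i j, π * K i j / L * (s / 2) / 2 ≤ π / 2)
    {Y : Fin N → R3} (hY : ∀ i j, i ≠ j → s ≤ ‖Y i - Y j‖) (c : Fin N → ℝ) :
    ∑ j, ∫ x in cube L, packet L K c x ^ 2 * (Metric.ball (0 : R3) r).indicator 1 (x - Y j)
      ≤ 13824 / s ^ 3 * (∑ α, c α ^ 2) * (6 * r ^ 3) := by
  classical
  set C := 13824 / s ^ 3 * ∑ α, c α ^ 2 with hC
  have hC0 : 0 ≤ C := mul_nonneg (by positivity) (Finset.sum_nonneg fun _ _ => sq_nonneg _)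
  have hcube : MeasurableSet (cube L) := by
    rw [cube_eq_box]; exact (isCompact_box _ _).measurableSet
  set F : R3 → ℝ := (cube L).indicator fun x => packet L K c x ^ 2 with hF
  have hFint : Integrable F := by
    rw [hF, integrable_indicator_iff hcube, cube_eq_box]
    exact integrableOn_box ((continuous_packet c).pow 2) _ _
  have htrans : ∀ j, ∫ x in cube L,
      packet L K c x ^ 2 * (Metric.ball (0 : R3) r).indicator 1 (x - Y j)
      = ∫ z in Metric.ball (0 : R3) r, F (z + Y j) := fun j => by
    rw [← integral_indicator hcube, ← integral_add_right_eq_self _ (Y j),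
      ← integral_indicator Metric.isOpen_ball.measurableSet]
    congr 1 with z
    by_cases h1 : z + Y j ∈ cube L <;> by_cases h2 : z ∈ Metric.ball (0 : R3) r <;>
      simp [hF, h1, h2, -Metric.mem_ball]
  have hpoint : ∀ z, ∑ j, F (z + Y j) ≤ C := fun z => by
    simp only [hF, Set.indicator_apply]
    rw [← Finset.sum_filter]
    refine sum_packet_sq_le hL hs hsL hK hinj hfreq _ _ (fun i hi => ?_) (fun i _ j _ hij => ?_) c
    · exact (Finset.mem_filter.1 hi).2
    · simpa using hY i j hij
  have hvol : volume.real (Metric.ball (0 : R3) r) ≤ 6 * r ^ 3 := by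
    rw [measureReal_def, EuclideanSpace.volume_ball_fin_three, ENNReal.toReal_mul,
      ENNReal.toReal_pow, ENNReal.toReal_ofReal hr, ENNReal.toReal_ofReal (by positivity), mul_comm]
    have := pi_le_four
    gcongr
    linarith
  simp_rw [htrans]
  rw [← integral_finsetSum _ fun j _ => (hFint.comp_add_right (Y j)).integrableOn]
  calc ∫ z in Metric.ball (0 : R3) r, ∑ j, F (z + Y j)
      ≤ ∫ _z in Metric.ball (0 : R3) r, C :=
        integral_mono (integrable_finsetSum _ fun j _ => (hFint.comp_add_right (Y j)).integrableOn)
          (integrableOn_const measure_ball_lt_top.ne) hpoint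
    _ = C * volume.real (Metric.ball (0 : R3) r) := by
        rw [setIntegral_const, smul_eq_mul, mul_comm]
    _ ≤ C * (6 * r ^ 3) := by gcongr

/-- The quadratic form of `1 - 𝓜(Y)` is small. -/
theorem integral_packet_sq_mul_le {s η : ℝ} (hL : 0 < L) (hs : 0 < s) (hsL : s ≤ L)
    (hη0 : 0 ≤ η) (hη1 : η ≤ 1) (hK : ∀ i j, 1 ≤ K i j) (hinj : Function.Injective K)
    (hfreq : ∀ i j, π * K i j / L * (s / 2) / 2 ≤ π / 2)
    {Y : Fin N → R3} (hY : ∀ i j, i ≠ j → s ≤ ‖Y i - Y j‖)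
    {g : R3 → ℝ} (hgm : Measurable g) (hg0 : ∀ x, 0 ≤ g x) (hg1 : ∀ x, g x ≤ 1)
    (hg : ∀ x, g x ≤ ∑ j, (2 * (Metric.ball (0 : R3) (η * s)).indicator 1 (x - Y j)
      + 2 * η * (Metric.ball (0 : R3) s).indicator 1 (x - Y j)))
    (c : Fin N → ℝ) :
    ∫ x in cube L, packet L K c x ^ 2 * g x ≤ 400000 * η * ∑ α, c α ^ 2 := by
  have hint : Integrable (fun x => packet L K c x ^ 2) (volume.restrict (cube L)) := by
    rw [cube_eq_box]
    exact integrableOn_box ((continuous_packet c).pow 2) _ _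
  have hball : ∀ (r : ℝ) (j : Fin N), Integrable (fun x => packet L K c x ^ 2 *
      (Metric.ball (0 : R3) r).indicator 1 (x - Y j)) (volume.restrict (cube L)) := fun r j => by
    refine hint.mul_bdd (c := 1) ?_ (Filter.Eventually.of_forall fun x => ?_)
    · exact ((measurable_one.indicator Metric.isOpen_ball.measurableSet).comp
        (measurable_id.sub_const (Y j))).aestronglyMeasurable
    · refine (norm_indicator_le_norm_self _ _).trans ?_
      simp
  have hexp : ∀ x, packet L K c x ^ 2 *
      ∑ j, (2 * (Metric.ball (0 : R3) (η * s)).indicator 1 (x - Y j)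
        + 2 * η * (Metric.ball (0 : R3) s).indicator 1 (x - Y j))
      = ∑ j, (2 * (packet L K c x ^ 2 * (Metric.ball (0 : R3) (η * s)).indicator 1 (x - Y j))
        + 2 * η * (packet L K c x ^ 2 * (Metric.ball (0 : R3) s).indicator 1 (x - Y j))) :=
    fun x => by
      rw [Finset.mul_sum]
      exact Finset.sum_congr rfl fun _ _ => by ring
  have hterm : ∀ j, Integrable (fun x =>
      2 * (packet L K c x ^ 2 * (Metric.ball (0 : R3) (η * s)).indicator 1 (x - Y j))
        + 2 * η * (packet L K c x ^ 2 * (Metric.ball (0 : R3) s).indicator 1 (x - Y j)))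
      (volume.restrict (cube L)) :=
    fun j => ((hball _ j).const_mul 2).add ((hball _ j).const_mul (2 * η))
  have hS : 0 ≤ ∑ α, c α ^ 2 := Finset.sum_nonneg fun _ _ => sq_nonneg _
  have hsmall := sum_integral_packet_sq_ball_le hL hs hsL (by positivity : 0 ≤ η * s)
    hK hinj hfreq hY c
  have hlarge := sum_integral_packet_sq_ball_le hL hs hsL hs.le hK hinj hfreq hY c
  have hη3 : η ^ 3 ≤ η := by nlinarith [mul_nonneg hη0 hη0]
  calc ∫ x in cube L, packet L K c x ^ 2 * g x
      ≤ ∫ x in cube L, packet L K c x ^ 2 *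
          ∑ j, (2 * (Metric.ball (0 : R3) (η * s)).indicator 1 (x - Y j)
            + 2 * η * (Metric.ball (0 : R3) s).indicator 1 (x - Y j)) := by
        refine integral_mono ?_ ?_ fun x => mul_le_mul_of_nonneg_left (hg x) (sq_nonneg _)
        · refine hint.mul_bdd (c := 1) hgm.aestronglyMeasurable
            (Filter.Eventually.of_forall fun x => ?_)
          rw [norm_of_nonneg (hg0 x)]
          exact hg1 x
        · simp_rw [hexp]
          exact integrable_finsetSum _ fun j _ => hterm j
    _ = 2 * (∑ j, ∫ x in cube L, packet L K c x ^ 2 *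
            (Metric.ball (0 : R3) (η * s)).indicator 1 (x - Y j))
          + 2 * η * ∑ j, ∫ x in cube L, packet L K c x ^ 2 *
            (Metric.ball (0 : R3) s).indicator 1 (x - Y j) := by
        simp_rw [hexp]
        rw [integral_finsetSum _ fun j _ => hterm j, Finset.mul_sum, Finset.mul_sum,
          ← Finset.sum_add_distrib]
        refine Finset.sum_congr rfl fun j _ => ?_
        rw [integral_add ((hball _ j).const_mul 2) ((hball _ j).const_mul (2 * η)),
          integral_const_mul, integral_const_mul]
    _ ≤ 2 * (13824 / s ^ 3 * (∑ α, c α ^ 2) * (6 * (η * s) ^ 3))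
          + 2 * η * (13824 / s ^ 3 * (∑ α, c α ^ 2) * (6 * s ^ 3)) := by gcongr
    _ = 165888 * (η ^ 3 + η) * ∑ α, c α ^ 2 := by field_simp; ring
    _ ≤ 400000 * η * ∑ α, c α ^ 2 := mul_le_mul_of_nonneg_right (by linarith) hS

/-- The bilinear form of the matrix of a bounded potential in the eigenfunctions. -/
theorem sum_mul_integral_eq_integral_packet {g : R3 → ℝ} (hgm : Measurable g)
    (hg0 : ∀ x, 0 ≤ g x) (hg1 : ∀ x, g x ≤ 1) (c d : Fin N → ℝ) :
    ∑ α, c α * ∑ β, (∫ x in cube L,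
        cubeEigenfunction L (K α) x * cubeEigenfunction L (K β) x * g x) * d β
      = ∫ x in cube L, packet L K c x * packet L K d x * g x := by
  have hcont := continuous_cubeEigenfunction L
  have hint : ∀ α β, Integrable (fun x => cubeEigenfunction L (K α) x *
      cubeEigenfunction L (K β) x * g x) (volume.restrict (cube L)) := fun α β => by
    refine Integrable.mul_bdd (c := 1) ?_ hgm.aestronglyMeasurable
      (Filter.Eventually.of_forall fun x => ?_)
    · rw [cube_eq_box]
      exact integrableOn_box (by fun_prop) _ _
    · rw [norm_of_nonneg (hg0 x)]
      exact hg1 x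
  have hexp : ∀ x, packet L K c x * packet L K d x * g x = ∑ α, ∑ β, c α * d β *
      (cubeEigenfunction L (K α) x * cubeEigenfunction L (K β) x * g x) := fun x => by
    rw [packet, packet, Finset.sum_mul_sum, Finset.sum_mul]
    refine Finset.sum_congr rfl fun _ _ => ?_
    rw [Finset.sum_mul]
    exact Finset.sum_congr rfl fun _ _ => by ring
  simp_rw [hexp]
  rw [integral_finsetSum _ fun α _ => integrable_finsetSum _ fun β _ => (hint α β).const_mul _]
  refine Finset.sum_congr rfl fun α _ => ?_
  rw [integral_finsetSum _ fun β _ => (hint α β).const_mul _, Finset.mul_sum]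
  refine Finset.sum_congr rfl fun β _ => ?_
  rw [integral_const_mul]
  ring

/-- A potential whose quadratic form is bounded by `ε` has a bilinear form satisfying the
corresponding Young inequality. -/
theorem two_mul_integral_packet_le {g : R3 → ℝ} (hgm : Measurable g) (hg0 : ∀ x, 0 ≤ g x)
    (hg1 : ∀ x, g x ≤ 1) {ε : ℝ} (hε : 0 < ε)
    (hquad : ∀ c, ∫ x in cube L, packet L K c x ^ 2 * g x ≤ ε * ∑ α, c α ^ 2)
    (c d : Fin N → ℝ) :
    2 * ∫ x in cube L, packet L K c x * packet L K d x * g x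
      ≤ ∑ α, c α ^ 2 + ε ^ 2 * ∑ α, d α ^ 2 := by
  have hpc : ∀ c, Continuous (packet L K c) := continuous_packet
  have hint : ∀ {w : R3 → ℝ}, Continuous w →
      Integrable (fun x => w x * g x) (volume.restrict (cube L)) := fun {w} hw => by
    refine Integrable.mul_bdd (c := 1) ?_ hgm.aestronglyMeasurable
      (Filter.Eventually.of_forall fun x => ?_)
    · rw [cube_eq_box]
      exact integrableOn_box hw _ _
    · rw [norm_of_nonneg (hg0 x)]
      exact hg1 x
  calc 2 * ∫ x in cube L, packet L K c x * packet L K d x * g x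
      = ∫ x in cube L, 2 * (packet L K c x * packet L K d x * g x) := by rw [integral_const_mul]
    _ ≤ ∫ x in cube L, (ε⁻¹ * (packet L K c x ^ 2 * g x) + ε * (packet L K d x ^ 2 * g x)) := by
        refine integral_mono ((hint (by fun_prop)).const_mul _)
          (((hint (by fun_prop)).const_mul _).add ((hint (by fun_prop)).const_mul _)) fun x => ?_
        have hyoung : 2 * (packet L K c x * packet L K d x)
            ≤ ε⁻¹ * packet L K c x ^ 2 + ε * packet L K d x ^ 2 := by
          have h := mul_nonneg (inv_pos.2 hε).le (sq_nonneg (packet L K c x - ε * packet L K d x))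
          have heq : ε⁻¹ * (packet L K c x - ε * packet L K d x) ^ 2
              = ε⁻¹ * packet L K c x ^ 2 + ε * packet L K d x ^ 2
                - 2 * (packet L K c x * packet L K d x) := by field_simp; ring
          linarith
        have := mul_le_mul_of_nonneg_right hyoung (hg0 x)
        simp only
        linarith
    _ = ε⁻¹ * (∫ x in cube L, packet L K c x ^ 2 * g x)
          + ε * ∫ x in cube L, packet L K d x ^ 2 * g x := by
        rw [integral_add ((hint (by fun_prop)).const_mul _) ((hint (by fun_prop)).const_mul _),
          integral_const_mul, integral_const_mul]
    _ ≤ ε⁻¹ * (ε * ∑ α, c α ^ 2) + ε * (ε * ∑ α, d α ^ 2) := by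
        gcongr
        · exact hquad c
        · exact hquad d
    _ = _ := by field_simp

end Packet

/-! ### Operator norm and products -/

theorem matrixOpNorm_le_of_bilinear {N : ℕ} {A : Matrix (Fin N) (Fin N) ℝ} {ε : ℝ} (hε : 0 ≤ ε)
    (h : ∀ c d : Fin N → ℝ, 2 * ∑ α, c α * ∑ β, A α β * d β
      ≤ ∑ α, c α ^ 2 + ε ^ 2 * ∑ α, d α ^ 2) :
    matrixOpNorm A ≤ ε := by
  refine ContinuousLinearMap.opNorm_le_bound _ hε fun v => ?_
  set w := Matrix.toEuclideanLin A v with hw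
  change ‖w‖ ≤ ε * ‖v‖
  have hwα : ∀ α, ∑ β, A α β * v β = w α := fun α => rfl
  have hwv := h w v
  simp_rw [hwα, ← sq] at hwv
  rw [← EuclideanSpace.real_norm_sq_eq, ← EuclideanSpace.real_norm_sq_eq] at hwv
  exact le_of_sq_le_sq (by rw [mul_pow]; linarith) (by positivity)

theorem one_sub_prod_le_sum_one_sub {ι : Type*} (J : Finset ι) {b : ι → ℝ} (h0 : ∀ i, 0 ≤ b i)
    (h1 : ∀ i, b i ≤ 1) : 1 - ∏ i ∈ J, b i ≤ ∑ i ∈ J, (1 - b i) := by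
  classical
  induction J using Finset.induction_on with
  | empty => simp
  | insert i J hi ih =>
    rw [Finset.prod_insert hi, Finset.sum_insert hi]
    have := Finset.prod_nonneg fun i (_ : i ∈ J) => h0 i
    have := Finset.prod_le_one (fun i (_ : i ∈ J) => h0 i) fun i _ => h1 i
    nlinarith [h0 i, h1 i]

/-- Splitting the hard-core profile `1 - f²` into a small ball, where it is at most one, and the
rest of its support, where it is small. -/
theorem one_sub_sq_le_indicator {f : R3 → ℝ} {a s η : ℝ} (hs : 0 < s) (hη : 0 < η)
    (ha : a = η ^ 2 * s) (hfs : ∀ x : R3, s ≤ ‖x‖ → f x = 1)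
    (hfa : ∀ x : R3, x ≠ 0 → 1 - f x ≤ a / ‖x‖) (z : R3) :
    1 - f z ^ 2 ≤ 2 * (Metric.ball (0 : R3) (η * s)).indicator 1 z
      + 2 * η * (Metric.ball (0 : R3) s).indicator 1 z := by
  have hind : ∀ r : ℝ, 0 ≤ (Metric.ball (0 : R3) r).indicator (1 : R3 → ℝ) z := fun r =>
    Set.indicator_nonneg (fun _ _ => zero_le_one) _
  by_cases hz : s ≤ ‖z‖
  · rw [hfs z hz]
    have := hind (η * s)
    have := mul_nonneg hη.le (hind s)
    linarith
  · rw [Set.indicator_of_mem (by simpa using hz : z ∈ Metric.ball (0 : R3) s)]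
    by_cases hr : ‖z‖ < η * s
    · rw [Set.indicator_of_mem (by simpa using hr : z ∈ Metric.ball (0 : R3) (η * s))]
      simp only [Pi.one_apply]
      nlinarith [sq_nonneg (f z)]
    · rw [not_lt] at hr
      have hpos : 0 < ‖z‖ := lt_of_lt_of_le (by positivity) hr
      have hle : 1 - f z ≤ η := by
        refine (hfa z (norm_pos_iff.1 hpos)).trans ?_
        rw [div_le_iff₀ hpos, ha]
        nlinarith
      have := hind (η * s)
      simp only [Pi.one_apply]
      nlinarith [sq_nonneg (1 - f z)]

theorem key_overlap_matrix_estimate :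
    ∀ ε > (0:ℝ), ∃ δ > (0:ℝ),
      ∀ (N : ℕ) (L a s : ℝ), 0 < L → 0 < a → a ≤ s →
        a / s ≤ δ → (N : ℝ) ^ ((1:ℝ)/3) * s / L ≤ δ →
        -- `K` enumerates the quantum numbers of the `N` lowest Dirichlet
        -- eigenvalues of the cube, counted with multiplicity:
        ∀ K : Fin N → (Fin 3 → ℕ),
          (∀ i j, 1 ≤ K i j) →
          Function.Injective K →
          (∀ k : Fin 3 → ℕ, (∀ j, 1 ≤ k j) → k ∉ Set.range K →
            ∀ i, (∑ j : Fin 3, (K i j) ^ 2) ≤ ∑ j : Fin 3, (k j) ^ 2) →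
        ∀ f : R3 → ℝ,
          Measurable f →
          (∀ x, 0 ≤ f x) → (∀ x, f x ≤ 1) →
          (∀ x : R3, s ≤ ‖x‖ → f x = 1) →
          (∀ x : R3, x ≠ 0 → 1 - f x ≤ a / ‖x‖) →
        ∀ Y : Fin N → R3,
          (∀ i j, i ≠ j → s ≤ ‖Y i - Y j‖) →
          matrixOpNorm
            (1 - Matrix.of (fun α β : Fin N =>
              ∫ x in cube L, cubeEigenfunction L (K α) x * cubeEigenfunction L (K β) x
                * ∏ j : Fin N, f (x - Y j) ^ 2)) ≤ ε := by
  intro ε hε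
  refine ⟨min (1 / 3) ((ε / 400000) ^ 2), by positivity, ?_⟩
  intro N L a s hL ha has haδ hsδ K hK hinj hmin f hfm hf0 hf1 hfs hfa Y hY
  rcases Nat.eq_zero_or_pos N with rfl | hN
  · exact matrixOpNorm_le_of_bilinear hε.le fun c d => by simp
  have hs : 0 < s := ha.trans_le has
  have hδ3 : (N : ℝ) ^ ((1 : ℝ) / 3) * s / L ≤ 1 / 3 := hsδ.trans (min_le_left _ _)
  rw [div_le_iff₀ hL] at hδ3
  have hN1 : (1 : ℝ) ≤ (N : ℝ) ^ ((1 : ℝ) / 3) :=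
    one_le_rpow (by exact_mod_cast hN) (by norm_num)
  have hsL : s ≤ L := by nlinarith
  have hfreq : ∀ i j, π * K i j / L * (s / 2) / 2 ≤ π / 2 := fun i j => by
    have hKs : (K i j : ℝ) * s ≤ L := by
      have := mul_le_mul_of_nonneg_right (quantumNumber_le hK hmin i j) hs.le
      linarith
    have heq : π * K i j / L * (s / 2) / 2 = π / 4 * (K i j * s / L) := by ring
    have hone : (K i j : ℝ) * s / L ≤ 1 := (div_le_one hL).2 hKs
    rw [heq]
    nlinarith [pi_pos]
  set η := √(a / s) with hη
  have hη0 : 0 < η := sqrt_pos.2 (by positivity)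
  have hη1 : η ≤ 1 := sqrt_le_one.2 ((div_le_one hs).2 has)
  have hηa : a = η ^ 2 * s := by rw [hη, sq_sqrt (by positivity)]; field_simp
  have hηε : 400000 * η ≤ ε := by
    have : η ≤ ε / 400000 := by
      rw [hη, sqrt_le_left (by positivity)]
      exact haδ.trans (min_le_right _ _)
    linarith
  set g : R3 → ℝ := fun x => 1 - ∏ j : Fin N, f (x - Y j) ^ 2 with hg
  have hsq0 : ∀ x, 0 ≤ f x ^ 2 := fun x => sq_nonneg _
  have hsq1 : ∀ x, f x ^ 2 ≤ 1 := fun x => pow_le_one₀ (hf0 x) (hf1 x)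
  have hgm : Measurable g := by fun_prop
  have hg0 : ∀ x, 0 ≤ g x := fun x =>
    sub_nonneg.2 (Finset.prod_le_one (fun _ _ => hsq0 _) fun _ _ => hsq1 _)
  have hg1 : ∀ x, g x ≤ 1 := fun x =>
    sub_le_self _ (Finset.prod_nonneg fun _ _ => hsq0 _)
  have hgle : ∀ x, g x ≤ ∑ j, (2 * (Metric.ball (0 : R3) (η * s)).indicator 1 (x - Y j)
      + 2 * η * (Metric.ball (0 : R3) s).indicator 1 (x - Y j)) := fun x =>
    (one_sub_prod_le_sum_one_sub _ (fun _ => hsq0 _) fun _ => hsq1 _).trans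
      (Finset.sum_le_sum fun j _ => one_sub_sq_le_indicator hs hη0 hηa hfs hfa _)
  have hquad : ∀ c, ∫ x in cube L, packet L K c x ^ 2 * g x ≤ ε * ∑ α, c α ^ 2 := fun c =>
    (integral_packet_sq_mul_le hL hs hsL hη0.le hη1 hK hinj hfreq hY hgm hg0 hg1 hgle c).trans
      (mul_le_mul_of_nonneg_right hηε (Finset.sum_nonneg fun _ _ => sq_nonneg _))
  have hentry : ∀ α β, (1 - Matrix.of (fun α β : Fin N =>
      ∫ x in cube L, cubeEigenfunction L (K α) x * cubeEigenfunction L (K β) x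
        * ∏ j : Fin N, f (x - Y j) ^ 2)) α β
      = ∫ x in cube L, cubeEigenfunction L (K α) x * cubeEigenfunction L (K β) x * g x := by
    intro α β
    have hcont := continuous_cubeEigenfunction L
    have hint : Integrable (fun x => cubeEigenfunction L (K α) x * cubeEigenfunction L (K β) x)
        (volume.restrict (cube L)) := by
      rw [cube_eq_box]
      exact integrableOn_box (by fun_prop) _ _
    have hintg : Integrable (fun x => cubeEigenfunction L (K α) x * cubeEigenfunction L (K β) x
        * g x) (volume.restrict (cube L)) := by
      refine hint.mul_bdd (c := 1) hgm.aestronglyMeasurable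
        (Filter.Eventually.of_forall fun x => ?_)
      rw [norm_of_nonneg (hg0 x)]
      exact hg1 x
    have hone : (1 : Matrix (Fin N) (Fin N) ℝ) α β
        = ∫ x in cube L, cubeEigenfunction L (K α) x * cubeEigenfunction L (K β) x := by
      rw [cube_eq_box, integral_cubeEigenfunction_mul hL (hK α) zero_le_one, Matrix.one_apply]
      simp [hinj.eq_iff]
    have hprod : ∀ x, cubeEigenfunction L (K α) x * cubeEigenfunction L (K β) x
        * ∏ j : Fin N, f (x - Y j) ^ 2
        = cubeEigenfunction L (K α) x * cubeEigenfunction L (K β) x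
          - cubeEigenfunction L (K α) x * cubeEigenfunction L (K β) x * g x := fun x => by
      rw [hg]; ring
    rw [Matrix.sub_apply, Matrix.of_apply, hone]
    simp_rw [hprod]
    rw [integral_sub hint hintg]
    ring
  refine matrixOpNorm_le_of_bilinear hε.le fun c d => ?_
  simp_rw [hentry]
  rw [sum_mul_integral_eq_integral_packet hgm hg0 hg1]
  exact two_mul_integral_packet_le hgm hg0 hg1 hε hquad c d
end
end
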